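/- Let ω ⊂ ℝ^d be an open, bounded domain and let the codimension k satisfy k ≥ d(d+1). Let v ∈ C¹(ω̄, ℝ^k), w ∈ C¹(ω̄, ℝ^d) and A ∈ C^{0,β}(ω̄, ℝ^{d×d}_sym) with 0 < β ≤ 1, and assume that the deficit D = A − (½(∇v)ᵀ∇v + sym∇w) satisfies D > c·Id_d on ω̄ for some c > 0. Fix ε > 0 and an exponent α with 0 < α < min{β/2, 1}. Then there exist ṽ ∈ C^{1,α}(ω̄, ℝ^k) and w̃ ∈ C^{1,α}(ω̄, ℝ^d) such that ‖ṽ − v‖₀ ≤ ε, ‖w̃ − w‖₀ ≤ ε, and A − (½(∇ṽ)ᵀ∇ṽ + sym∇w̃) = 0 on ω̄. -/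

import Mathlib

noncomputable section
open MeasureTheory Real
open scoped BigOperators ENNReal NNReal

/-- Partial derivative of `f` in the `i`-th coordinate direction. -/
def pd {d : ℕ} {E : Type*} [NormedAddCommGroup E] [NormedSpace ℝ E]
    (i : Fin d) (f : (Fin d → ℝ) → E) (x : Fin d → ℝ) : E :=
  fderiv ℝ f x (Pi.single i 1)

/-- The matrix `(∇v)ᵀ∇v`, with entries `⟨∂ᵢv, ∂ⱼv⟩`. -/
def gradTgrad {d k : ℕ} (v : (Fin d → ℝ) → Fin k → ℝ) (x : Fin d → ℝ) :
    Fin d → Fin d → ℝ :=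
  fun i j => ∑ l, pd i (fun y => v y l) x * pd j (fun y => v y l) x

/-- The symmetrized gradient `sym∇w = ½(∇w + (∇w)ᵀ)`. -/
def symGrad {d : ℕ} (w : (Fin d → ℝ) → Fin d → ℝ) (x : Fin d → ℝ) :
    Fin d → Fin d → ℝ :=
  fun i j => (pd i (fun y => w y j) x + pd j (fun y => w y i) x) / 2

/-- The deficit `D = A − (½(∇v)ᵀ∇v + sym∇w)`. -/
def deficit {d k : ℕ} (A : (Fin d → ℝ) → Fin d → Fin d → ℝ)
    (v : (Fin d → ℝ) → Fin k → ℝ) (w : (Fin d → ℝ) → Fin d → ℝ)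
    (x : Fin d → ℝ) : Fin d → Fin d → ℝ :=
  fun i j => A x i j - ((1/2) * gradTgrad v x i j + symGrad w x i j)

/-- `C⁰` norm of `f` on the closure of `ω`. -/
def supNorm {d : ℕ} {E : Type*} [NormedAddCommGroup E]
    (ω : Set (Fin d → ℝ)) (f : (Fin d → ℝ) → E) : ℝ :=
  ⨆ x : closure ω, ‖f x.1‖

/-- `f` is (globally) `β`-Hölder, i.e. the restriction of a `C^{0,β}` map of `ℝ^d`. -/
def IsHolder {d : ℕ} {E : Type*} [NormedAddCommGroup E] (β : ℝ)
    (f : (Fin d → ℝ) → E) : Prop :=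
  ∃ C : ℝ≥0, HolderWith C β.toNNReal f

/-- `f` is of class `C^{1,α}`: it is `C¹` and its gradient is `α`-Hölder. -/
def IsC1Holder {d : ℕ} {E : Type*} [NormedAddCommGroup E] [NormedSpace ℝ E] (α : ℝ)
    (f : (Fin d → ℝ) → E) : Prop :=
  ContDiff ℝ 1 f ∧ IsHolder α (fderiv ℝ f)

/-- `M > c·Id` in the sense of quadratic forms. -/
def MatGt {d : ℕ} (M : Fin d → Fin d → ℝ) (c : ℝ) : Prop :=
  ∀ ξ : Fin d → ℝ, ξ ≠ 0 → c * ∑ i, ξ i ^ 2 < ∑ i, ∑ j, M i j * ξ i * ξ j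

section UniformBounds

variable {Θ : Type*} {X E F G : Type*} [NormedAddCommGroup X] [NormedSpace ℝ X]
  [NormedAddCommGroup E] [NormedSpace ℝ E] [NormedAddCommGroup F] [NormedSpace ℝ F]
  [NormedAddCommGroup G] [NormedSpace ℝ G]

/-- A family `f p` of `C^N` maps whose derivatives up to order `N` are bounded by a multiple of
`σ p`, uniformly in the parameter `p`. -/
def UniformCN (N : ℕ) (σ : Θ → ℝ) (f : Θ → X → E) : Prop :=
  (∀ p, ContDiff ℝ N (f p)) ∧
    ∃ C : ℝ, 0 ≤ C ∧ ∀ p j, j ≤ N → ∀ x, ‖iteratedFDeriv ℝ j (f p) x‖ ≤ C * σ p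

namespace UniformCN

variable {N : ℕ} {σ ρ : Θ → ℝ} {f g : Θ → X → E}

lemma contDiff (h : UniformCN N σ f) (p : Θ) : ContDiff ℝ N (f p) := h.1 p

lemma exists_norm_le (h : UniformCN N σ f) : ∃ C : ℝ, 0 ≤ C ∧ ∀ p x, ‖f p x‖ ≤ C * σ p := by
  obtain ⟨-, C, hC, h⟩ := h
  exact ⟨C, hC, fun p x => by simpa using h p 0 (Nat.zero_le _) x⟩

lemma exists_norm_fderiv_le (h : UniformCN (N + 1) σ f) :
    ∃ C : ℝ, 0 ≤ C ∧ ∀ p x, ‖fderiv ℝ (f p) x‖ ≤ C * σ p := by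
  obtain ⟨-, C, hC, h⟩ := h
  refine ⟨C, hC, fun p x => ?_⟩
  have := h p 1 (by omega) x
  rwa [norm_iteratedFDeriv_one] at this

lemma of_norm_le (hf : ∀ p, Continuous (f p)) {C : ℝ} (hC : 0 ≤ C)
    (h : ∀ p x, ‖f p x‖ ≤ C * σ p) : UniformCN 0 σ f := by
  refine ⟨fun p => by exact_mod_cast (contDiff_zero (𝕜 := ℝ)).2 (hf p), C, hC, fun p j hj x => ?_⟩
  obtain rfl : j = 0 := by omega
  simpa using h p x

lemma mono {M : ℕ} (h : UniformCN N σ f) (hM : M ≤ N) {c : ℝ} (hc : 0 ≤ c)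
    (hσ : ∀ p, σ p ≤ c * ρ p) : UniformCN M ρ f := by
  obtain ⟨hs, C, hC, h⟩ := h
  refine ⟨fun p => (hs p).of_le (by exact_mod_cast hM), C * c, by positivity, fun p j hj x => ?_⟩
  calc _ ≤ C * σ p := h p j (hj.trans hM) x
    _ ≤ C * (c * ρ p) := by gcongr; exact hσ p
    _ = _ := by ring

lemma order_mono {M : ℕ} (h : UniformCN N σ f) (hM : M ≤ N) : UniformCN M σ f :=
  h.mono hM zero_le_one (fun p => by simp)

lemma bound_mono (h : UniformCN N σ f) {c : ℝ} (hc : 0 ≤ c) (hσ : ∀ p, σ p ≤ c * ρ p) :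
    UniformCN N ρ f := h.mono le_rfl hc hσ

lemma fderiv (h : UniformCN (N + 1) σ f) : UniformCN N σ (fun p => fderiv ℝ (f p)) := by
  obtain ⟨hs, C, hC, h⟩ := h
  refine ⟨fun p => (hs p).fderiv_right (by norm_cast), C, hC, fun p j hj x => ?_⟩
  rw [norm_iteratedFDeriv_fderiv]
  exact h p (j + 1) (by omega) x

lemma of_fderiv (h0 : UniformCN 0 σ f) (hd : ∀ p, Differentiable ℝ (f p))
    (hσ : ∀ p, 0 ≤ σ p)
    (h : UniformCN N σ (fun p => _root_.fderiv ℝ (f p))) : UniformCN (N + 1) σ f := by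
  obtain ⟨-, C, hC, h0⟩ := h0
  obtain ⟨hs, C', hC', h⟩ := h
  refine ⟨fun p => ?_, C + C', by positivity, fun p j hj x => ?_⟩
  · have := (contDiff_succ_iff_fderiv (𝕜 := ℝ) (n := (N : WithTop ℕ∞)) (f := f p)).2
      ⟨hd p, by simp, hs p⟩
    exact_mod_cast this
  · have h1 : 0 ≤ C * σ p := mul_nonneg hC (hσ p)
    have h2 : 0 ≤ C' * σ p := mul_nonneg hC' (hσ p)
    rw [add_mul]
    rcases j with _ | j
    · linarith [h0 p 0 le_rfl x]
    · rw [← norm_iteratedFDeriv_fderiv]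
      linarith [h p j (by omega) x]

lemma add (hf : UniformCN N σ f) (hg : UniformCN N σ g) :
    UniformCN N σ (fun p x => f p x + g p x) := by
  obtain ⟨hs, C, hC, hf⟩ := hf
  obtain ⟨hs', C', hC', hg⟩ := hg
  refine ⟨fun p => (hs p).add (hs' p), C + C', by positivity, fun p j hj x => ?_⟩
  have hj' : (j : WithTop ℕ∞) ≤ N := by exact_mod_cast hj
  have : iteratedFDeriv ℝ j (fun x => f p x + g p x) x
      = iteratedFDeriv ℝ j (f p) x + iteratedFDeriv ℝ j (g p) x := by
    have := iteratedFDeriv_add (i := j) ((hs p).of_le hj') ((hs' p).of_le hj')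
    exact congrFun this x
  rw [this, add_mul]
  exact (norm_add_le _ _).trans (add_le_add (hf p j hj x) (hg p j hj x))

lemma sum {ι : Type*} (s : Finset ι) {f : ι → Θ → X → E}
    (hf : ∀ i, UniformCN N σ (f i)) :
    UniformCN N σ (fun p x => ∑ i ∈ s, f i p x) := by
  classical
  induction s using Finset.induction_on with
  | empty =>
    refine ⟨fun p => by simpa using contDiff_const, 0, le_rfl, fun p j hj x => ?_⟩
    simp only [Finset.sum_empty]
    rcases j with _ | j
    · simp
    · simp [iteratedFDeriv_const_of_ne (𝕜 := ℝ) (Nat.succ_ne_zero j)]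
  | insert a s ha ih =>
    simp only [Finset.sum_insert ha]
    exact (hf a).add ih

lemma bilin (B : E →L[ℝ] F →L[ℝ] G) {g : Θ → X → F} (hσ : ∀ p, 0 ≤ σ p)
    (hf : UniformCN N σ f) (hg : UniformCN N ρ g) :
    UniformCN N (fun p => σ p * ρ p) (fun p x => B (f p x) (g p x)) := by
  obtain ⟨hs, C, hC, hf⟩ := hf
  obtain ⟨hs', C', hC', hg⟩ := hg
  refine ⟨fun p => B.isBoundedBilinearMap.contDiff.comp₂ (hs p) (hs' p),
    ‖B‖ * (2 ^ N * (C * C')), by positivity, fun p j hj x => ?_⟩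
  have h2 : ((2 : ℝ) ^ j) ≤ 2 ^ N := pow_le_pow_right₀ (by norm_num) hj
  have hσ' := hσ p
  have hf0 : 0 ≤ C * σ p := by positivity
  have hg0 : 0 ≤ C' * ρ p := (norm_nonneg _).trans (hg p 0 (Nat.zero_le _) x)
  calc _ ≤ ‖B‖ * ∑ i ∈ Finset.range (j + 1), (j.choose i : ℝ) * ‖iteratedFDeriv ℝ i (f p) x‖ *
        ‖iteratedFDeriv ℝ (j - i) (g p) x‖ :=
        B.norm_iteratedFDeriv_le_of_bilinear (hs p) (hs' p) x (by exact_mod_cast hj)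
    _ ≤ ‖B‖ * ∑ i ∈ Finset.range (j + 1), (j.choose i : ℝ) * ((C * σ p) * (C' * ρ p)) := by
        gcongr ‖B‖ * ?_
        refine Finset.sum_le_sum fun i hi => ?_
        rw [mul_assoc]
        have hi' : i ≤ j := by simpa [Nat.lt_succ_iff] using hi
        gcongr
        · exact hf p i (hi'.trans hj) x
        · exact hg p _ ((Nat.sub_le _ _).trans hj) x
    _ = ‖B‖ * (2 ^ j * ((C * σ p) * (C' * ρ p))) := by
        rw [← Finset.sum_mul]
        congr 2
        exact_mod_cast Nat.sum_range_choose j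
    _ ≤ ‖B‖ * (2 ^ N * ((C * σ p) * (C' * ρ p))) := by gcongr
    _ = _ := by ring

lemma mul {f g : Θ → X → ℝ} (hσ : ∀ p, 0 ≤ σ p)
    (hf : UniformCN N σ f) (hg : UniformCN N ρ g) :
    UniformCN N (fun p => σ p * ρ p) (fun p x => f p x * g p x) := by
  simpa using bilin (ContinuousLinearMap.mul ℝ ℝ) hσ hf hg

lemma clm (L : E →L[ℝ] F) (hf : UniformCN N σ f) :
    UniformCN N σ (fun p x => L (f p x)) := by
  obtain ⟨hs, C, hC, hf⟩ := hf
  refine ⟨fun p => L.contDiff.comp (hs p), ‖L‖ * C, by positivity, fun p j hj x => ?_⟩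
  calc _ ≤ ‖L‖ * ‖iteratedFDeriv ℝ j (f p) x‖ :=
        L.norm_iteratedFDeriv_comp_left (hs p).contDiffAt (by exact_mod_cast hj)
    _ ≤ ‖L‖ * (C * σ p) := by gcongr; exact hf p j hj x
    _ = _ := by ring

lemma const_mul {f : Θ → X → ℝ} (c : ℝ) (hf : UniformCN N σ f) :
    UniformCN N σ (fun p x => c * f p x) := by
  simpa using hf.clm (c • ContinuousLinearMap.id ℝ ℝ)

lemma neg (hf : UniformCN N σ f) : UniformCN N σ (fun p x => -f p x) := by
  simpa using hf.clm (-ContinuousLinearMap.id ℝ E)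

lemma sub (hf : UniformCN N σ f) (hg : UniformCN N σ g) :
    UniformCN N σ (fun p x => f p x - g p x) := by
  simpa [sub_eq_add_neg] using hf.add hg.neg

lemma pi {ι : Type*} [Fintype ι] {E : ι → Type*} [∀ i, NormedAddCommGroup (E i)]
    [∀ i, NormedSpace ℝ (E i)] {f : Θ → X → ∀ i, E i}
    (h : ∀ i, UniformCN N σ (fun p x => f p x i)) : UniformCN N σ f := by
  classical
  have := UniformCN.sum Finset.univ
    (fun i => (h i).clm (ContinuousLinearMap.single ℝ E i))
  convert this using 3 with p x
  ext i
  simp [Finset.sum_apply, ContinuousLinearMap.single_apply]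

lemma prodMk {g : Θ → X → F} (hf : UniformCN N σ f) (hg : UniformCN N σ g) :
    UniformCN N σ (fun p x => (f p x, g p x)) := by
  simpa using (hf.clm (ContinuousLinearMap.inl ℝ E F)).add
    (hg.clm (ContinuousLinearMap.inr ℝ E F))

lemma const {c : E} : UniformCN N (fun _ : Θ => (1 : ℝ)) (fun _ (_ : X) => c) := by
  refine ⟨fun p => contDiff_const, ‖c‖, norm_nonneg _, fun p j _ x => ?_⟩
  rcases j with _ | j
  · simp
  · simp [iteratedFDeriv_const_of_ne (𝕜 := ℝ) (Nat.succ_ne_zero j)]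

/-- Composition with a fixed map having bounded derivatives. -/
lemma comp {Φ : E → F} (hΦ : UniformCN N (fun _ : Unit => (1 : ℝ)) (fun _ => Φ))
    (hf : UniformCN N (fun _ : Θ => (1 : ℝ)) f) :
    UniformCN N (fun _ : Θ => (1 : ℝ)) (fun p x => Φ (f p x)) := by
  obtain ⟨hs, C, hC, hΦ⟩ := hΦ
  obtain ⟨hs', C', hC', hf⟩ := hf
  refine ⟨fun p => (hs ()).comp (hs' p), N.factorial * C * (1 + C') ^ N, by positivity,
    fun p j hj x => ?_⟩
  have := norm_iteratedFDeriv_comp_le (hs ()) (hs' p) (n := j) (by exact_mod_cast hj) x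
    (C := C) (D := 1 + C') (fun i hi => by simpa using hΦ () i (hi.trans hj) (f p x))
    (fun i hi hij => ?_)
  · refine this.trans ?_
    rw [mul_one]
    gcongr
    linarith
  · calc _ ≤ C' * 1 := hf p i (hij.trans hj) x
      _ ≤ 1 + C' := by linarith
      _ ≤ _ := le_self_pow₀ (by linarith) (by omega)

/-- Composition gains the size of the derivative of the inner map. -/
lemma fderiv_comp {Φ : E → F} (hΦ : UniformCN (N + 1) (fun _ : Unit => (1 : ℝ)) (fun _ => Φ))
    (hf : UniformCN (N + 1) (fun _ : Θ => (1 : ℝ)) f)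
    (hf' : UniformCN N σ (fun p => _root_.fderiv ℝ (f p))) :
    UniformCN N σ (fun p => _root_.fderiv ℝ (fun x => Φ (f p x))) := by
  have h1 : UniformCN N (fun _ : Θ => (1 : ℝ)) (fun p x => _root_.fderiv ℝ Φ (f p x)) :=
    comp (Φ := _root_.fderiv ℝ Φ) hΦ.fderiv (hf.order_mono (Nat.le_succ _))
  have h2 := bilin (ContinuousLinearMap.compL ℝ X E F) (fun _ => zero_le_one) h1 hf'
  have h3 : ∀ p, _root_.fderiv ℝ (fun x => Φ (f p x))
      = fun x => (_root_.fderiv ℝ Φ (f p x)).comp (_root_.fderiv ℝ (f p) x) := by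
    intro p
    ext1 x
    refine _root_.fderiv_comp x (((hΦ.contDiff ()).differentiable (by simp)) _)
      (((hf.contDiff p).differentiable (by simp)) _)
  simp only [h3]
  simpa using h2

lemma of_hasCompactSupport {Φ : E → F} (hΦ : ContDiff ℝ N Φ) (hc : HasCompactSupport Φ) :
    UniformCN N (fun _ : Unit => (1 : ℝ)) (fun _ => Φ) := by
  have : ∀ j : Fin (N + 1), ∃ C : ℝ, ∀ x, ‖iteratedFDeriv ℝ j Φ x‖ ≤ C := fun j =>
    (hc.iteratedFDeriv j).exists_bound_of_continuous
      (hΦ.continuous_iteratedFDeriv (by exact_mod_cast Nat.lt_succ_iff.1 j.2))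
  choose C hC using this
  refine ⟨fun _ => hΦ, ∑ j, |C j|, by positivity, fun _ j hj x => ?_⟩
  have := hC ⟨j, by omega⟩ x
  calc _ ≤ |C ⟨j, by omega⟩| := this.trans (le_abs_self _)
    _ ≤ ∑ j, |C j| := Finset.single_le_sum (f := fun j => |C j|) (fun i _ => abs_nonneg _)
        (Finset.mem_univ _)
    _ = _ := by ring

end UniformCN

end UniformBounds

section Mollification

variable {d : ℕ}

/-- A bump function supported in the unit ball. -/
def unitBump (d : ℕ) : ContDiffBump (0 : Fin d → ℝ) := ⟨1 / 2, 1, by norm_num, by norm_num⟩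

/-- Convolution with a smooth probability density supported in the unit ball. -/
def mollify (f : (Fin d → ℝ) → ℝ) : (Fin d → ℝ) → ℝ :=
  convolution f ((unitBump d).normed volume) (ContinuousLinearMap.lsmul ℝ ℝ) volume

lemma fderiv_convolution_lsmul {F : Type} [NormedAddCommGroup F] [NormedSpace ℝ F]
    {f : (Fin d → ℝ) → ℝ} (hf : Continuous f) {φ : (Fin d → ℝ) → F} (hφ : ContDiff ℝ 1 φ)
    (hc : HasCompactSupport φ) :
    fderiv ℝ (convolution f φ (ContinuousLinearMap.lsmul ℝ ℝ) volume)
      = convolution f (fderiv ℝ φ) (ContinuousLinearMap.lsmul ℝ ℝ) volume := by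
  ext1 x
  rw [(hc.hasFDerivAt_convolution_right (ContinuousLinearMap.lsmul ℝ ℝ)
    hf.locallyIntegrable hφ x).fderiv]
  congr 1

lemma exists_norm_iteratedFDeriv_convolution_le (j : ℕ) {F : Type} [NormedAddCommGroup F]
    [NormedSpace ℝ F] (φ : (Fin d → ℝ) → F) (hφ : ContDiff ℝ (⊤ : ℕ∞) φ)
    (hsupp : tsupport φ ⊆ Metric.closedBall 0 1) :
    ∃ C : ℝ, 0 ≤ C ∧ ∀ (f : (Fin d → ℝ) → ℝ), Continuous f → ∀ (M : ℝ) (x : Fin d → ℝ),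
      (∀ y, dist x y ≤ 1 → |f y| ≤ M) →
      ‖iteratedFDeriv ℝ j (convolution f φ (ContinuousLinearMap.lsmul ℝ ℝ) volume) x‖
        ≤ C * M := by
  have hc : HasCompactSupport φ :=
    (isCompact_closedBall (0 : Fin d → ℝ) 1).of_isClosed_subset (isClosed_tsupport _) hsupp
  induction j generalizing F with
  | zero =>
    have hφnorm : Integrable (fun t => ‖φ t‖) volume :=
      (hφ.continuous.norm.integrable_of_hasCompactSupport hc.norm)
    refine ⟨∫ t, ‖φ t‖, integral_nonneg fun _ => norm_nonneg _, fun f hf M x hM => ?_⟩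
    rw [norm_iteratedFDeriv_zero, convolution_def]
    have h1 : Integrable (fun t => ‖φ (x - t)‖ * M) volume :=
      (hφnorm.comp_sub_left x).mul_const M
    refine (norm_integral_le_of_norm_le h1 (Filter.Eventually.of_forall fun t => ?_)).trans ?_
    · by_cases ht : φ (x - t) = 0
      · simp [ht]
      · have : x - t ∈ Metric.closedBall (0 : Fin d → ℝ) 1 := hsupp (subset_tsupport _ ht)
        have hd : dist x t ≤ 1 := by simpa [dist_eq_norm] using this
        simp only [ContinuousLinearMap.lsmul_apply, norm_smul, Real.norm_eq_abs]
        rw [mul_comm]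
        gcongr
        exact hM t hd
    · rw [integral_mul_const, integral_sub_left_eq_self (fun t => ‖φ t‖) volume x]
  | succ j ih =>
    obtain ⟨C, hC, h⟩ := ih (fderiv ℝ φ) (hφ.fderiv_right (by simp))
      ((tsupport_fderiv_subset ℝ).trans hsupp) (hc.fderiv ℝ)
    refine ⟨C, hC, fun f hf M x hM => ?_⟩
    rw [← norm_iteratedFDeriv_fderiv,
      fderiv_convolution_lsmul hf (hφ.of_le (by exact_mod_cast le_top)) hc]
    exact h f hf M x hM

lemma tsupport_unitBump_normed :
    tsupport ((unitBump d).normed volume) ⊆ Metric.closedBall (0 : Fin d → ℝ) 1 := by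
  rw [ContDiffBump.tsupport_normed_eq]
  exact subset_rfl

lemma hasCompactSupport_unitBump_normed :
    HasCompactSupport ((unitBump d).normed (volume : Measure (Fin d → ℝ))) :=
  (unitBump d).hasCompactSupport_normed

lemma mollify_contDiff {f : (Fin d → ℝ) → ℝ} (hf : Continuous f) {N : ℕ∞} :
    ContDiff ℝ N (mollify f) :=
  hasCompactSupport_unitBump_normed.contDiff_convolution_right _ hf.locallyIntegrable
    (unitBump d).contDiff_normed

lemma abs_mollify_sub_le {f : (Fin d → ℝ) → ℝ} (hf : Continuous f) {M : ℝ} {x : Fin d → ℝ}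
    (h : ∀ y, dist x y ≤ 1 → |f x - f y| ≤ M) : |mollify f x - f x| ≤ M := by
  have h1 : mollify f x = convolution ((unitBump d).normed volume) f
      (ContinuousLinearMap.lsmul ℝ ℝ) volume x := by
    rw [mollify, convolution_eq_swap, convolution_def]
    simp [mul_comm]
  rw [h1, ← Real.dist_eq]
  refine ContDiffBump.dist_normed_convolution_le hf.aestronglyMeasurable fun y hy => ?_
  rw [Real.dist_eq, abs_sub_comm]
  refine h y ?_
  rw [dist_comm]
  exact (Metric.mem_ball.1 hy).le

lemma mollify_sub_const {f : (Fin d → ℝ) → ℝ} (hf : Continuous f) (c : ℝ) :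
    mollify (fun x => f x - c) = fun x => mollify f x - c := by
  have hcs : HasCompactSupport ((unitBump d).normed (volume : Measure (Fin d → ℝ))) :=
    hasCompactSupport_unitBump_normed
  have hcont : Continuous ((unitBump d).normed (volume : Measure (Fin d → ℝ))) :=
    (unitBump d).continuous_normed
  ext1 x
  have hc' : mollify (fun _ : Fin d → ℝ => c) x = c := by
    have := abs_mollify_sub_le (f := fun _ : Fin d → ℝ => c) continuous_const (M := 0) (x := x)
      (by simp)
    linarith [abs_nonpos_iff.1 this]
  conv_rhs => rw [← hc']
  simp only [mollify, convolution_def]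
  rw [← integral_sub]
  · simp
  · exact hcs.convolutionExists_right _ hf.locallyIntegrable hcont x
  · exact hcs.convolutionExists_right (f := fun _ => c) (ContinuousLinearMap.lsmul ℝ ℝ)
      continuous_const.locallyIntegrable hcont x

variable {Θ : Type*} {σ : Θ → ℝ} {f : Θ → (Fin d → ℝ) → ℝ}

lemma UniformCN.mollify (N : ℕ) (hf : UniformCN 0 σ f) :
    UniformCN N σ (fun p => mollify (f p)) := by
  have hcont : ∀ p, Continuous (f p) := fun p => (hf.contDiff p).continuous
  obtain ⟨C, hC, h⟩ := hf.exists_norm_le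
  have := fun j : Fin (N + 1) => exists_norm_iteratedFDeriv_convolution_le j
    ((unitBump d).normed volume) (unitBump d).contDiff_normed tsupport_unitBump_normed
  choose K hK hb using this
  refine ⟨fun p => by exact_mod_cast mollify_contDiff (N := N) (hcont p), (∑ j, K j) * C,
    mul_nonneg (Finset.sum_nonneg fun i _ => hK i) hC, fun p j hj x => ?_⟩
  have h0 : 0 ≤ C * σ p := (norm_nonneg _).trans (h p x)
  calc _ ≤ K ⟨j, by omega⟩ * (C * σ p) := hb ⟨j, by omega⟩ (f p) (hcont p) _ x
        (fun y _ => h p y)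
    _ ≤ (∑ j, K j) * (C * σ p) := by
        gcongr
        exact Finset.single_le_sum (f := K) (fun i _ => hK i) (Finset.mem_univ _)
    _ = _ := by ring

lemma UniformCN.fderiv_mollify (N : ℕ) (hcont : ∀ p, Continuous (f p))
    (h : ∀ p x y, dist x y ≤ 1 → |f p x - f p y| ≤ σ p) :
    UniformCN N σ (fun p => _root_.fderiv ℝ (_root_.mollify (f p))) := by
  have := fun j : Fin (N + 1) => exists_norm_iteratedFDeriv_convolution_le (j + 1)
    ((unitBump d).normed volume) (unitBump d).contDiff_normed tsupport_unitBump_normed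
  choose K hK hb using this
  refine ⟨fun p => (mollify_contDiff (N := (N + 1 : ℕ)) (hcont p)).fderiv_right
      (by norm_cast), ∑ j, K j,
    Finset.sum_nonneg fun i _ => hK i, fun p j hj x => ?_⟩
  have h0 : 0 ≤ σ p := (abs_nonneg _).trans (h p x x (by simp))
  have h1 : _root_.fderiv ℝ (_root_.mollify (f p))
      = _root_.fderiv ℝ (_root_.mollify (fun y => f p y - f p x)) := by
    rw [mollify_sub_const (hcont p)]
    ext1 z
    rw [fderiv_sub_const]
  beta_reduce
  rw [h1, norm_iteratedFDeriv_fderiv]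
  calc _ ≤ K ⟨j, by omega⟩ * σ p := hb ⟨j, by omega⟩ (fun y => f p y - f p x)
        ((hcont p).sub continuous_const) _ x
        (fun y hy => by rw [abs_sub_comm]; exact h p x y hy)
    _ ≤ _ := by
        gcongr
        exact Finset.single_le_sum (f := K) (fun i _ => hK i) (Finset.mem_univ _)

end Mollification

section Algebra

variable {d k : ℕ}

section PartialDerivatives

variable {f g : (Fin d → ℝ) → ℝ} {x : Fin d → ℝ}

lemma pd_add (i : Fin d) (hf : DifferentiableAt ℝ f x) (hg : DifferentiableAt ℝ g x) :
    pd i (fun y => f y + g y) x = pd i f x + pd i g x := by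
  simp [pd, fderiv_fun_add hf hg]

lemma pd_sub (i : Fin d) (hf : DifferentiableAt ℝ f x) (hg : DifferentiableAt ℝ g x) :
    pd i (fun y => f y - g y) x = pd i f x - pd i g x := by
  simp [pd, fderiv_fun_sub hf hg]

lemma pd_mul (i : Fin d) (hf : DifferentiableAt ℝ f x) (hg : DifferentiableAt ℝ g x) :
    pd i (fun y => f y * g y) x = pd i f x * g x + f x * pd i g x := by
  simp [pd, fderiv_fun_mul hf hg]
  ring

lemma pd_sum {ι : Type*} (s : Finset ι) {f : ι → (Fin d → ℝ) → ℝ} (i : Fin d)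
    (hf : ∀ l, DifferentiableAt ℝ (f l) x) :
    pd i (fun y => ∑ l ∈ s, f l y) x = ∑ l ∈ s, pd i (f l) x := by
  simp [pd, fderiv_fun_sum (fun l _ => hf l)]

lemma ContDiff.pd {E : Type*} [NormedAddCommGroup E] [NormedSpace ℝ E] {f : (Fin d → ℝ) → E}
    {m n : WithTop ℕ∞} (hf : ContDiff ℝ n f) (hmn : m + 1 ≤ n) (i : Fin d) :
    ContDiff ℝ m (pd i f) :=
  (hf.fderiv_right hmn).clm_apply contDiff_const

end PartialDerivatives

/-- Second partial derivatives. -/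
def hess (f : (Fin d → ℝ) → ℝ) (x : Fin d → ℝ) : Fin d → Fin d → ℝ :=
  fun i j => pd i (pd j f) x

lemma hess_symm {f : (Fin d → ℝ) → ℝ} (hf : ContDiff ℝ 2 f) (x : Fin d → ℝ) (i j : Fin d) :
    hess f x i j = hess f x j i := by
  have h : Differentiable ℝ (fderiv ℝ f) :=
    (hf.fderiv_right (m := 1) (by norm_num)).differentiable (by simp)
  have h2 : ∀ i j, hess f x i j
      = fderiv ℝ (fderiv ℝ f) x (Pi.single i 1) (Pi.single j 1) := by
    intro i j
    have := fderiv_clm_apply (h x) (differentiableAt_const (Pi.single j (1 : ℝ)))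
    change fderiv ℝ (fun y => fderiv ℝ f y (Pi.single j 1)) x (Pi.single i 1) = _
    rw [this]
    simp
  rw [h2, h2]
  exact (hf.contDiffAt.isSymmSndFDerivAt (by simp)).eq _ _

/-- The matrix `½(∇v)ᵀ∇v + sym∇w`. -/
def strain (v : (Fin d → ℝ) → Fin k → ℝ) (w : (Fin d → ℝ) → Fin d → ℝ) (x : Fin d → ℝ) :
    Fin d → Fin d → ℝ :=
  fun i j => (1 / 2) * gradTgrad v x i j + symGrad w x i j

lemma gradTgrad_symm (v : (Fin d → ℝ) → Fin k → ℝ) (x : Fin d → ℝ) (i j : Fin d) :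
    gradTgrad v x i j = gradTgrad v x j i := by
  simp only [gradTgrad, mul_comm]

lemma strain_symm (v : (Fin d → ℝ) → Fin k → ℝ) (w : (Fin d → ℝ) → Fin d → ℝ)
    (x : Fin d → ℝ) (i j : Fin d) : strain v w x i j = strain v w x j i := by
  simp only [strain, gradTgrad_symm v x i j, symGrad, add_comm]

/-- The correction `w - (∇v)ᵀ P` compensating the cross term created by `v + P`. -/
def correctW (v P : (Fin d → ℝ) → Fin k → ℝ) (w : (Fin d → ℝ) → Fin d → ℝ) :
    (Fin d → ℝ) → Fin d → ℝ :=
  fun x j => w x j - ∑ l, pd j (fun y => v y l) x * P x l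

lemma strain_add_correctW {v P : (Fin d → ℝ) → Fin k → ℝ} {w : (Fin d → ℝ) → Fin d → ℝ}
    (hv : ContDiff ℝ 2 v) (hP : ContDiff ℝ 1 P) (hw : ContDiff ℝ 1 w) (x : Fin d → ℝ)
    (i j : Fin d) :
    strain (fun y l => v y l + P y l) (correctW v P w) x i j
      = strain v w x i j + ((1 / 2) * gradTgrad P x i j
        - ∑ l, P x l * hess (fun y => v y l) x i j) := by
  have hv2 : ∀ l, ContDiff ℝ 2 (fun y => v y l) := fun l => contDiff_pi.1 hv l
  have hv1 : ∀ l, DifferentiableAt ℝ (fun y => v y l) x := fun l =>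
    ((hv2 l).differentiable (by simp)) x
  have hP1 : ∀ l, DifferentiableAt ℝ (fun y => P y l) x := fun l =>
    ((contDiff_pi.1 hP l).differentiable (by simp)) x
  have hw1 : ∀ l, DifferentiableAt ℝ (fun y => w y l) x := fun l =>
    ((contDiff_pi.1 hw l).differentiable (by simp)) x
  have hpv : ∀ l i, DifferentiableAt ℝ (pd i (fun y => v y l)) x := fun l i =>
    (((hv2 l).pd (m := 1) (by norm_num) i).differentiable (by simp)) x
  have h1 : ∀ i j, pd i (fun y => correctW v P w y j) x = pd i (fun y => w y j) x
      - ∑ l, (hess (fun y => v y l) x i j * P x l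
        + pd j (fun y => v y l) x * pd i (fun y => P y l) x) := by
    intro i j
    simp only [correctW]
    rw [pd_sub i (hw1 j), pd_sum _ _ fun l => (hpv l j).fun_mul (hP1 l)]
    · congr 1
      refine Finset.sum_congr rfl fun l _ => ?_
      rw [pd_mul i (hpv l j) (hP1 l)]
      rfl
    · exact DifferentiableAt.fun_sum fun l _ => (hpv l j).fun_mul (hP1 l)
  simp only [strain, gradTgrad, symGrad, h1, fun i l => pd_add i (hv1 l) (hP1 l),
    fun l => hess_symm (hv2 l) x j i]
  rw [← sub_eq_zero]
  simp only [Finset.sum_add_distrib, mul_add, add_mul, mul_comm (P x _)]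
  have h2 : ∑ l, pd i (fun y => P y l) x * pd j (fun y => v y l) x
      = ∑ l, pd j (fun y => v y l) x * pd i (fun y => P y l) x :=
    Finset.sum_congr rfl fun _ _ => mul_comm _ _
  rw [h2]
  ring

/-- Cosine and sine, the two components of the unit circle. -/
def trig (b : Bool) : ℝ → ℝ := if b then sin else cos

/-- The linear phase `x ↦ η · x`. -/
def phase (η x : Fin d → ℝ) : ℝ := ∑ i, η i * x i

variable {ι : Type*} [Fintype ι]

/-- Superposition of spirals with amplitudes `a i` and phases `η i`, in mutually orthogonal planes
indexed by `e`. -/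
def spiral (η : ι → Fin d → ℝ) (e : ι × Bool → Fin k) (a : ι → (Fin d → ℝ) → ℝ) :
    (Fin d → ℝ) → Fin k → ℝ :=
  fun x => Function.extend e (fun q => a q.1 x * trig q.2 (phase (η q.1) x)) 0

lemma contDiff_trig (b : Bool) {n : WithTop ℕ∞} : ContDiff ℝ n (trig b) := by
  cases b
  · simpa [trig] using contDiff_cos
  · simpa [trig] using contDiff_sin

lemma contDiff_phase (η : Fin d → ℝ) {n : WithTop ℕ∞} : ContDiff ℝ n (phase η) := by
  unfold phase
  fun_prop

lemma pd_phase (η x : Fin d → ℝ) (i : Fin d) : pd i (phase η) x = η i := by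
  have h : HasFDerivAt (phase η)
      (∑ j, η j • (ContinuousLinearMap.proj j : (Fin d → ℝ) →L[ℝ] ℝ)) x := by
    unfold phase
    refine HasFDerivAt.fun_sum fun j _ => ?_
    exact ((ContinuousLinearMap.proj j : (Fin d → ℝ) →L[ℝ] ℝ).hasFDerivAt).const_mul (η j)
  rw [pd, h.fderiv]
  simp [Pi.single_apply]

lemma pd_trig_phase (b : Bool) (η x : Fin d → ℝ) (i : Fin d) :
    pd i (fun y => trig b (phase η y)) x
      = η i * (if b then cos (phase η x) else - sin (phase η x)) := by
  have hd := ((contDiff_phase η (n := 1)).differentiable (by simp)) x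
  have hp := pd_phase η x i
  rw [pd] at hp
  cases b
  · simp only [trig, pd, Bool.false_eq_true, if_false]
    rw [fderiv_cos hd]
    simp [hp, mul_comm]
  · simp only [trig, pd, if_true]
    rw [fderiv_sin hd]
    simp [hp, mul_comm]

variable {η : ι → Fin d → ℝ} {e : ι × Bool → Fin k} {a : ι → (Fin d → ℝ) → ℝ}

omit [Fintype ι] in
lemma spiral_apply (he : Function.Injective e) (q : ι × Bool) (x : Fin d → ℝ) :
    spiral η e a x (e q) = a q.1 x * trig q.2 (phase (η q.1) x) :=
  he.extend_apply _ _ _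

omit [Fintype ι] in
lemma spiral_apply_of_notMem {l : Fin k} (hl : l ∉ Set.range e) (x : Fin d → ℝ) :
    spiral η e a x l = 0 := by
  rw [spiral, Function.extend_apply' _ _ _ (by simpa using hl)]
  rfl

omit [Fintype ι] in
lemma contDiff_spiral (he : Function.Injective e) {n : WithTop ℕ∞}
    (ha : ∀ i, ContDiff ℝ n (a i)) : ContDiff ℝ n (spiral η e a) := by
  rw [contDiff_pi]
  intro l
  by_cases hl : l ∈ Set.range e
  · obtain ⟨q, rfl⟩ := hl
    simp only [spiral_apply he]
    exact (ha q.1).mul ((contDiff_trig _).comp (contDiff_phase _))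
  · simp only [spiral_apply_of_notMem hl]
    exact contDiff_const

lemma gradTgrad_spiral (he : Function.Injective e) (ha : ∀ i, ContDiff ℝ 1 (a i))
    (x : Fin d → ℝ) (p q : Fin d) :
    gradTgrad (spiral η e a) x p q
      = ∑ i, (pd p (a i) x * pd q (a i) x + a i x ^ 2 * (η i p * η i q)) := by
  have had : ∀ i, DifferentiableAt ℝ (a i) x := fun i => ((ha i).differentiable (by simp)) x
  have htd : ∀ b i, DifferentiableAt ℝ (fun y => trig b (phase (η i) y)) x := fun b i =>
    (((contDiff_trig b (n := 1)).comp (contDiff_phase (η i))).differentiable (by simp)) x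
  rw [gradTgrad, ← Fintype.sum_of_injective e he (fun s : ι × Bool =>
    (pd p (a s.1) x * trig s.2 (phase (η s.1) x) + a s.1 x * (η s.1 p *
      (if s.2 then cos (phase (η s.1) x) else - sin (phase (η s.1) x)))) *
    (pd q (a s.1) x * trig s.2 (phase (η s.1) x) + a s.1 x * (η s.1 q *
      (if s.2 then cos (phase (η s.1) x) else - sin (phase (η s.1) x)))))]
  · rw [Fintype.sum_prod_type]
    refine Finset.sum_congr rfl fun i _ => ?_
    simp only [Fintype.sum_bool, trig, if_true, Bool.false_eq_true, if_false]
    linear_combination (pd p (a i) x * pd q (a i) x + a i x ^ 2 * (η i p * η i q)) *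
      sin_sq_add_cos_sq (phase (η i) x)
  · intro l hl
    simp only [spiral_apply_of_notMem hl]
    simp [pd]
  · intro s
    simp only [spiral_apply he]
    rw [pd_mul p (had _) (htd _ _), pd_mul q (had _) (htd _ _), pd_trig_phase, pd_trig_phase]

lemma sum_spiral_mul (he : Function.Injective e) (x : Fin d → ℝ) (H : Fin k → ℝ) :
    ∑ l, spiral η e a x l * H l
      = ∑ i, a i x * ∑ b, trig b (phase (η i) x) * H (e (i, b)) := by
  rw [← Fintype.sum_of_injective e he (fun s : ι × Bool =>
    a s.1 x * (trig s.2 (phase (η s.1) x) * H (e s)))]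
  · rw [Fintype.sum_prod_type]
    simp only [Finset.mul_sum]
  · intro l hl
    simp [spiral_apply_of_notMem hl]
  · intro s
    rw [spiral_apply he, mul_assoc]

/-- The strain produced by adding a spiral. -/
def spiralStrain (η : ι → Fin d → ℝ) (e : ι × Bool → Fin k) (a : ι → (Fin d → ℝ) → ℝ)
    (v : (Fin d → ℝ) → Fin k → ℝ) (x : Fin d → ℝ) : Fin d → Fin d → ℝ :=
  fun p q => ∑ i, (1 / 2) * a i x ^ 2 * (η i p * η i q)
    + ∑ i, (1 / 2) * (pd p (a i) x * pd q (a i) x)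
    - ∑ i, a i x * ∑ b, trig b (phase (η i) x) * hess (fun y => v y (e (i, b))) x p q

lemma strain_add_spiral (he : Function.Injective e) (ha : ∀ i, ContDiff ℝ 1 (a i))
    {v : (Fin d → ℝ) → Fin k → ℝ} {w : (Fin d → ℝ) → Fin d → ℝ}
    (hv : ContDiff ℝ 2 v) (hw : ContDiff ℝ 1 w) (x : Fin d → ℝ) (p q : Fin d) :
    strain (fun y l => v y l + spiral η e a y l) (correctW v (spiral η e a) w) x p q
      = strain v w x p q + spiralStrain η e a v x p q := by
  rw [strain_add_correctW hv (contDiff_spiral he ha) hw, gradTgrad_spiral he ha,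
    sum_spiral_mul he x (fun l => hess (fun y => v y l) x p q), spiralStrain,
    Finset.sum_add_distrib, mul_add, Finset.mul_sum, Finset.mul_sum]
  simp only [mul_assoc]
  ring

end Algebra

section PrimitiveMatrices

/-- The vector `e_p + e_q` (or `e_p` if `p = q`) attached to the unordered pair `{p, q}`. -/
def pairVec {d : ℕ} (s : Sym2 (Fin d)) : Fin d → ℝ := fun i => if i ∈ s then 1 else 0

lemma exists_primitive_decomposition (d : ℕ) :
    ∃ R : (Fin d → Fin d → ℝ) →L[ℝ] (Sym2 (Fin d) → ℝ), ∀ S : Fin d → Fin d → ℝ,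
      (∀ i j, S i j = S j i) → ∀ p q, ∑ s, R S s * (pairVec s p * pairVec s q) = S p q := by
  let T : (Sym2 (Fin d) → ℝ) →ₗ[ℝ] (Fin d → Fin d → ℝ) :=
    Fintype.linearCombination ℝ (fun s p q => pairVec s p * pairVec s q)
  have hT : ∀ c p q, T c p q = ∑ s, c s * (pairVec s p * pairVec s q) := by
    intro c p q
    simp [T, Fintype.linearCombination_apply, Finset.sum_apply]
  have hT1 : ∀ s, T (Pi.single s 1) = fun p q => pairVec s p * pairVec s q := by
    intro s
    simp [T]
  have hsym : ∀ S : Fin d → Fin d → ℝ, (∀ i j, S i j = S j i) → S ∈ LinearMap.range T := by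
    intro S hS
    have hE : ∀ p q : Fin d, (fun i j => (if i = p then 1 else 0) * (if j = q then 1 else 0)
        + (if i = q then 1 else 0) * (if j = p then 1 else 0) : Fin d → Fin d → ℝ)
        ∈ LinearMap.range T := by
      intro p q
      by_cases hpq : p = q
      · subst hpq
        refine ⟨(2 : ℝ) • Pi.single s(p, p) 1, ?_⟩
        rw [map_smul, hT1]
        ext i j
        simp only [pairVec, Pi.smul_apply, smul_eq_mul, Sym2.mem_iff, or_self]
        ring
      · refine ⟨Pi.single s(p, q) 1 - Pi.single s(p, p) 1 - Pi.single s(q, q) 1, ?_⟩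
        rw [map_sub, map_sub, hT1, hT1, hT1]
        ext i j
        simp only [pairVec, Pi.sub_apply, Sym2.mem_iff, or_self]
        split_ifs <;> simp_all
    have hS' : S = ∑ p, ∑ q, (S p q / 2) • (fun i j => (if i = p then 1 else 0) *
        (if j = q then 1 else 0) + (if i = q then 1 else 0) * (if j = p then 1 else 0) :
          Fin d → Fin d → ℝ) := by
      ext i j
      simp only [Finset.sum_apply, Pi.smul_apply, smul_eq_mul, mul_add, Finset.sum_add_distrib,
        mul_ite, mul_one, mul_zero]
      simp [hS j i]
    rw [hS']
    exact Submodule.sum_mem _ fun p _ => Submodule.sum_mem _ fun q _ =>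
      Submodule.smul_mem _ _ (hE p q)
  obtain ⟨g, hg⟩ := LinearMap.exists_rightInverse_of_surjective T.rangeRestrict
    T.range_rangeRestrict
  obtain ⟨R, hR⟩ := LinearMap.exists_extend g
  refine ⟨LinearMap.toContinuousLinearMap R, fun S hS p q => ?_⟩
  have h1 : R S = g ⟨S, hsym S hS⟩ := by
    rw [← hR]
    rfl
  have h2 : T (R S) = S := by
    rw [h1]
    simpa using congrArg Subtype.val (LinearMap.congr_fun hg ⟨S, hsym S hS⟩)
  rw [LinearMap.coe_toContinuousLinearMap', ← hT, h2]

lemma exists_injective_pairs {d k : ℕ} (hk : d * (d + 1) ≤ k) :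
    ∃ e : Sym2 (Fin d) × Bool → Fin k, Function.Injective e := by
  have hc : Fintype.card (Sym2 (Fin d) × Bool) ≤ Fintype.card (Fin k) := by
    rw [Fintype.card_prod, Sym2.card, Fintype.card_fin, Fintype.card_bool, Fintype.card_fin,
      Nat.choose_two_right, Nat.add_sub_cancel, mul_comm (d + 1)]
    exact (Nat.div_mul_le_self _ _).trans hk
  obtain ⟨f⟩ := Function.Embedding.nonempty_of_card_le hc
  exact ⟨f, f.injective⟩

variable {ι : Type*} [Fintype ι]

lemma exists_contDiff_amplitude : ∃ (F : (ι → ℝ) × (ι → ι → ℝ) → (ι → ℝ)) (r : ℝ), 0 < r ∧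
    ContDiff ℝ 3 F ∧ HasCompactSupport F ∧ ∀ u B, (∀ i, |u i - 1 / 2| ≤ r) →
      (∀ i j, |B i j| ≤ r) → ∀ i, (1 / 2) * F (u, B) i ^ 2 - ∑ j, F (u, B) j * B i j = u i := by
  let G : (ι → ℝ) × (ι → ι → ℝ) → (ι → ℝ) × (ι → ι → ℝ) :=
    fun z => (fun i => (1 / 2) * z.1 i ^ 2 - ∑ j, z.1 j * z.2 i j, z.2)
  let T : ((ι → ℝ) × (ι → ι → ℝ)) ≃ₗ[ℝ] ((ι → ℝ) × (ι → ι → ℝ)) :=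
    { toFun := fun z => (fun i => z.1 i - ∑ j, z.2 i j, z.2)
      invFun := fun z => (fun i => z.1 i + ∑ j, z.2 i j, z.2)
      map_add' := fun x y => by
        ext <;> simp [Finset.sum_add_distrib]
        ring
      map_smul' := fun c x => by
        ext <;> simp [Finset.mul_sum, mul_sub]
      left_inv := fun z => by ext <;> simp
      right_inv := fun z => by ext <;> simp }
  let p : (ι → ℝ) × (ι → ι → ℝ) := (fun _ => 1, 0)
  have hGp : G p = (fun _ => 1 / 2, 0) := by
    ext <;> simp [G, p]
  have hG : ContDiff ℝ 3 G := by
    refine ContDiff.prodMk (contDiff_pi.2 fun i => ?_) contDiff_snd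
    fun_prop
  have hG' : HasFDerivAt G (T.toContinuousLinearEquiv :
      ((ι → ℝ) × (ι → ι → ℝ)) →L[ℝ] ((ι → ℝ) × (ι → ι → ℝ))) p := by
    have h1 : ∀ i, HasFDerivAt (fun z : (ι → ℝ) × (ι → ι → ℝ) => z.1 i)
        ((ContinuousLinearMap.proj i).comp (ContinuousLinearMap.fst ℝ _ _)) p := fun i =>
      ContinuousLinearMap.hasFDerivAt
        ((ContinuousLinearMap.proj (R := ℝ) (φ := fun _ : ι => ℝ) i).comp
          (ContinuousLinearMap.fst ℝ (ι → ℝ) (ι → ι → ℝ)))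
    have h2 : ∀ i j, HasFDerivAt (fun z : (ι → ℝ) × (ι → ι → ℝ) => z.2 i j)
        ((ContinuousLinearMap.proj (R := ℝ) (φ := fun _ : ι => ℝ) j).comp
          ((ContinuousLinearMap.proj (R := ℝ) (φ := fun _ : ι => ι → ℝ) i).comp
            (ContinuousLinearMap.snd ℝ _ _))) p :=
      fun i j => ContinuousLinearMap.hasFDerivAt
        ((ContinuousLinearMap.proj (R := ℝ) (φ := fun _ : ι => ℝ) j).comp
          ((ContinuousLinearMap.proj (R := ℝ) (φ := fun _ : ι => ι → ℝ) i).comp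
            (ContinuousLinearMap.snd ℝ (ι → ℝ) (ι → ι → ℝ))))
    have h3 := HasFDerivAt.prodMk (hasFDerivAt_pi.2 fun i =>
      (((h1 i).pow 2).const_mul (1 / 2)).sub (HasFDerivAt.fun_sum fun j (_ : j ∈ Finset.univ) =>
        (h1 j).mul (h2 i j))) (hasFDerivAt_snd (p := p) (𝕜 := ℝ))
    refine h3.congr_fderiv ?_
    ext z i <;> simp [T, p]
  have hs := hG.contDiffAt.hasStrictFDerivAt' hG' (by simp)
  have hinv := hG.contDiffAt.to_localInverse hG' (by simp)
  have hright : ∀ᶠ y in nhds (G p), G (hG.contDiffAt.localInverse hG' (by simp) y) = y :=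
    hs.eventually_right_inverse
  have hev := (hinv.eventually (by simp)).and hright
  rw [hGp] at hev hinv
  obtain ⟨δ, hδ, hball⟩ := Metric.eventually_nhds_iff.1 hev
  set g := hG.contDiffAt.localInverse hG' (by simp)
  let χ : ContDiffBump ((fun _ => 1 / 2, 0) : (ι → ℝ) × (ι → ι → ℝ)) :=
    ⟨δ / 4, δ / 2, by positivity, by linarith⟩
  refine ⟨fun z => χ z • (g z).1, δ / 4, by positivity, ?_, ?_, ?_⟩
  · rw [contDiff_iff_contDiffAt]
    intro z
    by_cases hz : z ∈ tsupport χ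
    · rw [χ.tsupport_eq] at hz
      have hzδ : dist z (fun _ => 1 / 2, 0) < δ :=
        (Metric.mem_closedBall.1 hz).trans_lt (by simp only [χ]; linarith)
      exact χ.contDiffAt.smul (contDiffAt_fst.comp z (hball hzδ).1)
    · have : (fun z => χ z • (g z).1) =ᶠ[nhds z] fun _ => 0 := by
        filter_upwards [(isClosed_tsupport χ).isOpen_compl.mem_nhds hz] with y hy
        rw [image_eq_zero_of_notMem_tsupport hy, zero_smul]
      exact contDiffAt_const.congr_of_eventuallyEq this
  · exact χ.hasCompactSupport.smul_right
  · intro u B hu hB i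
    have hd : dist ((u, B) : (ι → ℝ) × (ι → ι → ℝ)) (fun _ => 1 / 2, 0) ≤ δ / 4 := by
      rw [Prod.dist_eq, max_le_iff]
      refine ⟨(dist_pi_le_iff (by positivity)).2 fun i => hu i,
        (dist_pi_le_iff (by positivity)).2 fun i =>
          (dist_pi_le_iff (by positivity)).2 fun j => ?_⟩
      simpa [Real.dist_eq] using hB i j
    have h1 : χ (u, B) = 1 := χ.one_of_mem_closedBall hd
    have h2 := (hball (hd.trans_lt (by linarith))).2
    have h3 := congrArg Prod.snd h2
    have h4 := congrFun (congrArg Prod.fst h2) i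
    simp only [h1, one_smul]
    simp only [G] at h3 h4
    rw [h3] at h4
    exact h4

end PrimitiveMatrices

section UniformEstimates

variable {d k : ℕ} {Θ : Type*} {σ ρ : Θ → ℝ}

lemma UniformCN.fderiv_pi {ι : Type*} [Fintype ι] {E : ι → Type*} [∀ i, NormedAddCommGroup (E i)]
    [∀ i, NormedSpace ℝ (E i)] {X : Type*} [NormedAddCommGroup X] [NormedSpace ℝ X] {N : ℕ}
    {f : Θ → X → ∀ i, E i} (hd : ∀ s i, Differentiable ℝ (fun x => f s x i))
    (h : ∀ i, UniformCN N σ (fun s => _root_.fderiv ℝ (fun x => f s x i))) :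
    UniformCN N σ (fun s => _root_.fderiv ℝ (f s)) := by
  classical
  have h1 := UniformCN.sum Finset.univ fun i =>
    (h i).clm ((ContinuousLinearMap.compL ℝ X (E i) (∀ i, E i)) (ContinuousLinearMap.single ℝ E i))
  convert h1 using 3 with s x
  have h2 : _root_.fderiv ℝ (f s) x
      = ContinuousLinearMap.pi fun i => _root_.fderiv ℝ (fun x => f s x i) x :=
    _root_.fderiv_pi (φ := fun i x => f s x i) fun i => hd s i x
  rw [h2]
  ext z j
  simp [Finset.sum_apply]

lemma UniformCN.pd {E : Type*} [NormedAddCommGroup E] [NormedSpace ℝ E] {N : ℕ}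
    {f : Θ → (Fin d → ℝ) → E} (h : UniformCN N σ (fun s => _root_.fderiv ℝ (f s))) (i : Fin d) :
    UniformCN N σ (fun s => _root_.pd i (f s)) :=
  h.clm (ContinuousLinearMap.apply ℝ E (Pi.single i (1 : ℝ) : Fin d → ℝ))

lemma UniformCN.zero_fderiv_iff {E X : Type*} [NormedAddCommGroup E] [NormedSpace ℝ E]
    [NormedAddCommGroup X] [NormedSpace ℝ X] {f : Θ → X → E} (h0 : UniformCN 0 σ f)
    (hd : ∀ s, ContDiff ℝ 1 (f s)) (hσ : ∀ s, 0 ≤ σ s)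
    (h1 : UniformCN 0 σ (fun s => _root_.fderiv ℝ (f s))) : UniformCN 1 σ f :=
  h0.of_fderiv (fun s => (hd s).differentiable (by simp)) hσ h1

lemma UniformCN.of_const {E X : Type*} [NormedAddCommGroup E] [NormedSpace ℝ E]
    [NormedAddCommGroup X] [NormedSpace ℝ X] {N : ℕ} {c : Θ → E} {C : ℝ} (hC : 0 ≤ C)
    (h : ∀ s, ‖c s‖ ≤ C * σ s) : UniformCN N σ (fun s (_ : X) => c s) := by
  refine ⟨fun s => contDiff_const, C, hC, fun s j _ x => ?_⟩
  rcases j with _ | j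
  · simpa using h s
  · simpa [iteratedFDeriv_succ_const] using (norm_nonneg _).trans (h s)

lemma norm_fderiv_fderiv {E X : Type*} [NormedAddCommGroup E] [NormedSpace ℝ E]
    [NormedAddCommGroup X] [NormedSpace ℝ X] (f : X → E) (x : X) :
    ‖fderiv ℝ (fderiv ℝ f) x‖ = ‖iteratedFDeriv ℝ 2 f x‖ := by
  rw [← norm_iteratedFDeriv_one, norm_iteratedFDeriv_fderiv]

lemma hess_eq_fderiv {v : (Fin d → ℝ) → Fin k → ℝ} (hv : ContDiff ℝ 2 v) (l : Fin k)
    (x : Fin d → ℝ) (p q : Fin d) : hess (fun y => v y l) x p q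
      = fderiv ℝ (fderiv ℝ v) x (Pi.single p 1) (Pi.single q 1) l := by
  have h1 : Differentiable ℝ v := hv.differentiable (by simp)
  have h2 : Differentiable ℝ (fderiv ℝ v) :=
    (hv.fderiv_right (m := 1) (by norm_num)).differentiable (by simp)
  have h3 : pd q (fun y => v y l) = fun y => fderiv ℝ v y (Pi.single q 1) l := by
    ext y
    rw [pd, fderiv_apply (h1 y)]
    rfl
  rw [hess, h3, pd, fderiv_apply
    (Φ := fun y => fderiv ℝ v y (Pi.single q 1)) ((h2 x).clm_apply (differentiableAt_const _)),
    fderiv_clm_apply (h2 x) (differentiableAt_const _)]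
  simp

lemma uniformCN_hess {V : Θ → (Fin d → ℝ) → Fin k → ℝ} (hV : ∀ s, ContDiff ℝ 3 (V s))
    (h2 : ∀ s x, ‖iteratedFDeriv ℝ 2 (V s) x‖ ≤ σ s)
    (h3 : ∀ s x, ‖iteratedFDeriv ℝ 3 (V s) x‖ ≤ ρ s) (l : Fin k) (p q : Fin d) :
    (∀ s, ContDiff ℝ 1 (fun x => hess (fun y => V s y l) x p q)) ∧
    UniformCN 0 σ (fun s x => hess (fun y => V s y l) x p q) ∧
    UniformCN 0 ρ (fun s => fderiv ℝ (fun x => hess (fun y => V s y l) x p q)) := by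
  let L : ((Fin d → ℝ) →L[ℝ] (Fin d → ℝ) →L[ℝ] (Fin k → ℝ)) →L[ℝ] ℝ :=
    (ContinuousLinearMap.proj l).comp
      ((ContinuousLinearMap.apply ℝ (Fin k → ℝ) (Pi.single q (1 : ℝ) : Fin d → ℝ)).comp
        (ContinuousLinearMap.apply ℝ ((Fin d → ℝ) →L[ℝ] (Fin k → ℝ))
          (Pi.single p (1 : ℝ) : Fin d → ℝ)))
  have hL : ∀ s x, hess (fun y => V s y l) x p q = L (fderiv ℝ (fderiv ℝ (V s)) x) := by
    intro s x
    rw [hess_eq_fderiv ((hV s).of_le (by norm_num))]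
    rfl
  have hc : ∀ s, ContDiff ℝ 1 (fderiv ℝ (fderiv ℝ (V s))) := fun s =>
    ((hV s).fderiv_right (m := 2) (by norm_num)).fderiv_right (by norm_num)
  simp only [hL]
  refine ⟨fun s => (hc s).continuousLinearMap_comp L, ?_, ?_⟩
  · refine UniformCN.clm L (UniformCN.of_norm_le (C := 1) (fun s => (hc s).continuous)
      zero_le_one fun s x => ?_)
    rw [norm_fderiv_fderiv, one_mul]
    exact h2 s x
  · have h4 : ∀ s, fderiv ℝ (fun x => L (fderiv ℝ (fderiv ℝ (V s)) x))
        = fun x => ContinuousLinearMap.compL ℝ _ _ _ L (fderiv ℝ (fderiv ℝ (fderiv ℝ (V s))) x) := by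
      intro s
      ext1 x
      exact (L.hasFDerivAt.comp x (((hc s).differentiable (by simp)) x).hasFDerivAt).fderiv
    simp only [h4]
    refine UniformCN.clm _ (UniformCN.of_norm_le (C := 1) (fun s =>
      ((hc s).continuous_fderiv (by simp))) zero_le_one fun s x => ?_)
    rw [norm_fderiv_fderiv, norm_iteratedFDeriv_fderiv, one_mul]
    exact h3 s x

lemma uniformCN_mollify_sub {f : Θ → (Fin d → ℝ) → ℝ} (hf : ∀ s, ContDiff ℝ 1 (f s))
    (hσ : ∀ s, 0 ≤ σ s) (h : UniformCN 0 σ (fun s => fderiv ℝ (f s))) (N : ℕ) :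
    UniformCN N σ (fun s => fderiv ℝ (mollify (f s))) ∧
    UniformCN 1 σ (fun s x => mollify (f s) x - f s x) := by
  obtain ⟨C, hC, hb⟩ := h.exists_norm_le
  have hosc : ∀ s x y, dist x y ≤ 1 → |f s x - f s y| ≤ C * σ s := by
    intro s x y hxy
    have := convex_univ.norm_image_sub_le_of_norm_fderiv_le (𝕜 := ℝ)
      (fun z _ => ((hf s).differentiable (by simp)) z) (fun z _ => hb s z)
      (Set.mem_univ y) (Set.mem_univ x)
    rw [← dist_eq_norm x y] at this
    refine this.trans ?_
    nlinarith [mul_nonneg hC (hσ s)]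
  have h1 : ∀ M : ℕ, UniformCN M σ (fun s => fderiv ℝ (mollify (f s))) := fun M =>
    (UniformCN.fderiv_mollify M (fun s => (hf s).continuous) hosc).bound_mono hC fun _ => le_rfl
  have hm : ∀ s, ContDiff ℝ 1 (mollify (f s)) := fun s =>
    mollify_contDiff (N := 1) (hf s).continuous
  refine ⟨h1 N, UniformCN.zero_fderiv_iff ?_ (fun s => (hm s).sub (hf s)) hσ ?_⟩
  · refine UniformCN.of_norm_le (fun s => ((hm s).sub (hf s)).continuous) hC fun s x => ?_
    exact abs_mollify_sub_le (hf s).continuous (hosc s x)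
  · convert (h1 0).sub h using 3 with s x
    exact fderiv_fun_sub (((hm s).differentiable (by simp)) x)
      (((hf s).differentiable (by simp)) x)

lemma uniformCN_trig_phase (N : ℕ) (b : Bool) (η : Fin d → ℝ) :
    UniformCN N (fun _ : Θ => (1 : ℝ)) (fun _ x => trig b (phase η x)) := by
  induction N generalizing b with
  | zero =>
    refine UniformCN.of_norm_le (C := 1) (fun _ =>
      ((contDiff_trig b (n := 0)).comp (contDiff_phase η)).continuous) zero_le_one fun _ x => ?_
    cases b
    · simpa [trig] using abs_cos_le_one _
    · simpa [trig] using abs_sin_le_one _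
  | succ N ih =>
    have hd : Differentiable ℝ (phase η) := (contDiff_phase η (n := 1)).differentiable (by simp)
    let L : (Fin d → ℝ) →L[ℝ] ℝ := fderiv ℝ (phase η) 0
    have hL : ∀ x, fderiv ℝ (phase η) x = L := by
      intro x
      refine ContinuousLinearMap.coe_injective (LinearMap.pi_ext' fun i => ?_)
      refine LinearMap.ext_ring ?_
      exact (pd_phase η x i).trans (pd_phase η 0 i).symm
    refine UniformCN.of_fderiv ((ih b).order_mono (Nat.zero_le _)) (fun _ =>
      ((contDiff_trig b (n := 1)).comp (contDiff_phase η)).differentiable (by simp))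
      (fun _ => zero_le_one) ?_
    cases b
    · convert ((ih true).neg).clm ((ContinuousLinearMap.id ℝ ℝ).smulRight L) using 3 with _ x
      simp only [trig, Bool.false_eq_true, if_false, if_true]
      rw [fderiv_cos (hd x), hL]
      simp
    · convert (ih false).clm ((ContinuousLinearMap.id ℝ ℝ).smulRight L) using 3 with _ x
      simp only [trig, Bool.false_eq_true, if_false, if_true]
      rw [fderiv_sin (hd x), hL]
      simp

end UniformEstimates

section Stage

variable {d k : ℕ} {ι : Type*} [Fintype ι]

/-- The reference matrix `½ ∑ ηᵢ ⊗ ηᵢ`. -/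
def refMat (η : ι → Fin d → ℝ) : Fin d → Fin d → ℝ :=
  fun p q => (1 / 2) * ∑ i, η i p * η i q

/-- Data of one step at unit scale: a map `V`, a deficit `D`, the size `t` of the second
derivatives of `V`, the part `o` of the deficit left over and a bound `b` for the gradient. -/
structure StageData (d k : ℕ) where
  V : (Fin d → ℝ) → Fin k → ℝ
  D : (Fin d → ℝ) → Fin d → Fin d → ℝ
  t : ℝ
  o : ℝ
  b : ℝ

namespace StageData

/-- The standing assumptions on the data of a step. -/
structure Admissible (η : ι → Fin d → ℝ) (s : StageData d k) : Prop where
  contDiff : ContDiff ℝ 3 s.V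
  continuous : ∀ p q, Continuous fun x => s.D x p q
  symm : ∀ x p q, s.D x p q = s.D x q p
  t_pos : 0 < s.t
  t_le : s.t ≤ 1
  o_nonneg : 0 ≤ s.o
  o_le : s.o ≤ 1
  near : ∀ x p q, |s.D x p q - refMat η p q| ≤ 1
  osc : ∀ x y, dist x y ≤ 1 → ∀ p q, |s.D x p q - s.D y p q| ≤ s.t ^ 2
  second : ∀ x, ‖iteratedFDeriv ℝ 2 s.V x‖ ≤ s.t
  third : ∀ x, ‖iteratedFDeriv ℝ 3 s.V x‖ ≤ s.t ^ 2
  b_nonneg : 0 ≤ s.b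
  grad : ∀ x, ‖fderiv ℝ s.V x‖ ≤ s.b

/-- The mollified deficit. -/
def meanD (s : StageData d k) (x : Fin d → ℝ) : Fin d → Fin d → ℝ :=
  fun p q => mollify (fun y => s.D y p q) x

/-- The second derivatives of `V` in the direction of the `i`-th spiral. -/
def spiralHess (η : ι → Fin d → ℝ) (e : ι × Bool → Fin k) (s : StageData d k) (i : ι)
    (x : Fin d → ℝ) : Fin d → Fin d → ℝ :=
  fun p q => ∑ b, trig b (phase (η i) x) * hess (fun y => s.V y (e (i, b))) x p q

/-- The mollified variant of `spiralHess`. -/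
def meanHess (η : ι → Fin d → ℝ) (e : ι × Bool → Fin k) (s : StageData d k) (i : ι)
    (x : Fin d → ℝ) : Fin d → Fin d → ℝ :=
  fun p q => ∑ b, trig b (phase (η i) x) *
    mollify (fun z => hess (fun y => s.V y (e (i, b))) z p q) x

/-- The argument of the amplitude function. -/
def ampArg (η : ι → Fin d → ℝ) (e : ι × Bool → Fin k) (R : (Fin d → Fin d → ℝ) →L[ℝ] (ι → ℝ))
    (s : StageData d k) (x : Fin d → ℝ) : (ι → ℝ) × (ι → ι → ℝ) :=
  (fun i => 1 / 2 + R (fun p q => s.meanD x p q - (s.o + 1) * refMat η p q) i,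
    fun i j => R (s.meanHess η e j x) i)

/-- The amplitudes of the spirals. -/
def amp (η : ι → Fin d → ℝ) (e : ι × Bool → Fin k) (R : (Fin d → Fin d → ℝ) →L[ℝ] (ι → ℝ))
    (F : (ι → ℝ) × (ι → ι → ℝ) → (ι → ℝ)) (s : StageData d k) (i : ι) (x : Fin d → ℝ) : ℝ :=
  F (s.ampArg η e R x) i

variable {η : ι → Fin d → ℝ} {e : ι × Bool → Fin k} {R : (Fin d → Fin d → ℝ) →L[ℝ] (ι → ℝ)}
  {F : (ι → ℝ) × (ι → ι → ℝ) → (ι → ℝ)}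

lemma Admissible.sq_t_le {s : StageData d k} (hs : s.Admissible η) : s.t ^ 2 ≤ s.t := by
  nlinarith [hs.t_pos, hs.t_le]

lemma uniformCN_meanD (η : ι → Fin d → ℝ) (p q : Fin d) :
    UniformCN 3 (fun _ : {s : StageData d k // s.Admissible η} => (1 : ℝ))
      (fun s x => s.1.meanD x p q) ∧
    UniformCN 2 (fun s : {s : StageData d k // s.Admissible η} => s.1.t ^ 2)
      (fun s => fderiv ℝ fun x => s.1.meanD x p q) := by
  refine ⟨UniformCN.mollify 3 (UniformCN.of_norm_le (C := 1 + |refMat η p q|)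
    (fun s => s.2.continuous p q) (by positivity) fun s x => ?_),
    UniformCN.fderiv_mollify 2 (fun s => s.2.continuous p q) fun s x y h => s.2.osc x y h p q⟩
  have h1 := s.2.near x p q
  have h2 := abs_sub_abs_le_abs_sub (s.1.D x p q) (refMat η p q)
  rw [Real.norm_eq_abs]
  linarith

lemma uniformCN_spiralHess (η : ι → Fin d → ℝ) (e : ι × Bool → Fin k) (i : ι) (p q : Fin d) :
    UniformCN 3 (fun s : {s : StageData d k // s.Admissible η} => s.1.t)
      (fun s x => s.1.meanHess η e i x p q) ∧
    UniformCN 1 (fun s : {s : StageData d k // s.Admissible η} => s.1.t ^ 2)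
      (fun s x => s.1.meanHess η e i x p q - s.1.spiralHess η e i x p q) := by
  have h := fun b => uniformCN_hess
    (V := fun s : {s : StageData d k // s.Admissible η} => s.1.V) (fun s => s.2.contDiff)
    (fun s => s.2.second) (fun s => s.2.third) (e (i, b)) p q
  have hm := fun b => uniformCN_mollify_sub (h b).1 (fun s => sq_nonneg s.1.t) (h b).2.2 0
  constructor
  · refine UniformCN.sum _ fun b => ?_
    have := (uniformCN_trig_phase 3 b (η i)).mul (fun _ => zero_le_one)
      (UniformCN.mollify 3 (h b).2.1)
    simpa using this
  · have := UniformCN.sum Finset.univ fun b =>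
      (uniformCN_trig_phase 1 b (η i)).mul (fun _ => zero_le_one) (hm b).2
    simpa only [one_mul, meanHess, spiralHess, ← Finset.sum_sub_distrib, mul_sub] using this

lemma uniformCN_ampArg (η : ι → Fin d → ℝ) (e : ι × Bool → Fin k)
    (R : (Fin d → Fin d → ℝ) →L[ℝ] (ι → ℝ)) :
    UniformCN 3 (fun _ : {s : StageData d k // s.Admissible η} => (1 : ℝ))
      (fun s x => s.1.ampArg η e R x) ∧
    UniformCN 2 (fun s : {s : StageData d k // s.Admissible η} => s.1.t)
      (fun s => fderiv ℝ fun x => s.1.ampArg η e R x) := by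
  have hH : ∀ j, UniformCN 3 (fun s : {s : StageData d k // s.Admissible η} => s.1.t)
      (fun s x => R (s.1.meanHess η e j x)) := fun j =>
    UniformCN.clm R (UniformCN.pi fun p => UniformCN.pi fun q => (uniformCN_spiralHess η e j p q).1)
  have hB : UniformCN 3 (fun s : {s : StageData d k // s.Admissible η} => s.1.t)
      (fun s x (i j : ι) => R (s.1.meanHess η e j x) i) :=
    UniformCN.pi fun i => UniformCN.pi fun j => (hH j).clm (ContinuousLinearMap.proj i)
  have hB1 : UniformCN 3 (fun _ : {s : StageData d k // s.Admissible η} => (1 : ℝ))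
      (fun s x (i j : ι) => R (s.1.meanHess η e j x) i) :=
    hB.bound_mono zero_le_one fun s => by simpa using s.2.t_le
  have hD : UniformCN 3 (fun _ : {s : StageData d k // s.Admissible η} => (1 : ℝ))
      (fun s x => s.1.meanD x) :=
    UniformCN.pi fun p => UniformCN.pi fun q => (uniformCN_meanD η p q).1
  have hDc : ∀ s : {s : StageData d k // s.Admissible η}, Differentiable ℝ s.1.meanD := fun s =>
    (hD.contDiff s).differentiable (by simp)
  have hD' : UniformCN 2 (fun s : {s : StageData d k // s.Admissible η} => s.1.t)
      (fun s => fderiv ℝ s.1.meanD) := by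
    refine UniformCN.fderiv_pi (fun s p => differentiable_pi.1 (hDc s) p) fun p =>
      UniformCN.fderiv_pi (fun s q => differentiable_pi.1 (differentiable_pi.1 (hDc s) p) q)
        fun q => ?_
    exact (uniformCN_meanD η p q).2.bound_mono zero_le_one fun s => by
      simpa using s.2.sq_t_le
  have hc : UniformCN 3 (fun _ : {s : StageData d k // s.Admissible η} => (1 : ℝ))
      (fun s (_ : Fin d → ℝ) => (fun _ => 1 / 2) - (s.1.o + 1) • R (refMat η)) := by
    refine UniformCN.of_const (C := ‖(fun _ => 1 / 2 : ι → ℝ)‖ + 2 * ‖R (refMat η)‖)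
      (by positivity) fun s => ?_
    refine (norm_sub_le _ _).trans ?_
    rw [norm_smul, Real.norm_eq_abs, abs_of_nonneg (by linarith [s.2.o_nonneg]), mul_one]
    gcongr
    linarith [s.2.o_le]
  have hu : ∀ (s : {s : StageData d k // s.Admissible η}) x, (fun i => 1 / 2 +
      R (fun p q => s.1.meanD x p q - (s.1.o + 1) * refMat η p q) i) =
      R (s.1.meanD x) + ((fun _ => 1 / 2) - (s.1.o + 1) • R (refMat η)) := by
    intro s x
    have : (fun p q => s.1.meanD x p q - (s.1.o + 1) * refMat η p q)
        = s.1.meanD x - (s.1.o + 1) • refMat η := rfl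
    rw [this, map_sub, map_smul]
    ext i
    simp only [Pi.add_apply, Pi.sub_apply]
    ring
  have hz : ∀ s : {s : StageData d k // s.Admissible η}, (fun x => s.1.ampArg η e R x) =
      fun x => (ContinuousLinearMap.inl ℝ (ι → ℝ) (ι → ι → ℝ)).comp R (s.1.meanD x) +
      ContinuousLinearMap.inr ℝ (ι → ℝ) (ι → ι → ℝ) (fun i j => R (s.1.meanHess η e j x) i) +
      ((fun _ => 1 / 2) - (s.1.o + 1) • R (refMat η), 0) := by
    intro s
    ext1 x
    rw [ampArg, hu]
    simp
  constructor
  · simp only [ampArg, hu]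
    exact ((hD.clm R).add hc).prodMk hB1
  · have h1 := hB.clm (ContinuousLinearMap.inr ℝ (ι → ℝ) (ι → ι → ℝ))
    convert (hD'.clm (ContinuousLinearMap.compL ℝ _ _ _
      ((ContinuousLinearMap.inl ℝ (ι → ℝ) (ι → ι → ℝ)).comp R))).add
      (UniformCN.fderiv (N := 2) h1) using 3 with s x
    have h2 := ((ContinuousLinearMap.inl ℝ (ι → ℝ) (ι → ι → ℝ)).comp R).hasFDerivAt.comp x
      (hDc s x).hasFDerivAt
    have h3 := (((h1.contDiff s).differentiable (by simp)) x).hasFDerivAt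
    rw [hz]
    exact ((h2.add h3).add_const _).fderiv

lemma uniformCN_amp (e : ι × Bool → Fin k) (R : (Fin d → Fin d → ℝ) →L[ℝ] (ι → ℝ))
    (hF : ContDiff ℝ 3 F) (hFc : HasCompactSupport F) (i : ι) :
    UniformCN 3 (fun _ : {s : StageData d k // s.Admissible η} => (1 : ℝ))
      (fun s x => s.1.amp η e R F i x) ∧
    UniformCN 2 (fun s : {s : StageData d k // s.Admissible η} => s.1.t)
      (fun s => fderiv ℝ fun x => s.1.amp η e R F i x) := by
  have hΦ : UniformCN 3 (fun _ : Unit => (1 : ℝ)) (fun _ z => F z i) := by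
    refine UniformCN.of_hasCompactSupport (contDiff_pi.1 (by exact_mod_cast hF) i) ?_
    exact hFc.comp_left (g := fun y : ι → ℝ => y i) rfl
  obtain ⟨h1, h2⟩ := uniformCN_ampArg η e R
  exact ⟨UniformCN.comp hΦ h1, UniformCN.fderiv_comp hΦ h1 h2⟩

lemma amp_identity (hR : ∀ S : Fin d → Fin d → ℝ, (∀ i j, S i j = S j i) → ∀ p q,
      ∑ i, R S i * (η i p * η i q) = S p q)
    {s : StageData d k} (hs : s.Admissible η) {x : Fin d → ℝ}
    (hF : ∀ i, (1 / 2) * s.amp η e R F i x ^ 2 - ∑ j, s.amp η e R F j x * R (s.meanHess η e j x) i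
      = 1 / 2 + R (fun p q => s.meanD x p q - (s.o + 1) * refMat η p q) i) (p q : Fin d) :
    ∑ i, (1 / 2) * s.amp η e R F i x ^ 2 * (η i p * η i q)
      - ∑ i, s.amp η e R F i x * s.meanHess η e i x p q = s.meanD x p q - s.o * refMat η p q := by
  have hV : ContDiff ℝ 2 s.V := hs.contDiff.of_le (by norm_num)
  have hH : ∀ j, ∑ i, R (s.meanHess η e j x) i * (η i p * η i q) = s.meanHess η e j x p q := by
    refine fun j => hR _ (fun p q => ?_) p q
    simp only [meanHess, fun (z : Fin d → ℝ) l => hess_symm (contDiff_pi.1 hV l) z p q]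
  have hD := hR (fun p q => s.meanD x p q - (s.o + 1) * refMat η p q) (fun p q => by
    simp only [meanD, hs.symm _ p q, refMat, mul_comm (η _ p)]) p q
  calc _ = ∑ i, ((1 / 2) * s.amp η e R F i x ^ 2 -
        ∑ j, s.amp η e R F j x * R (s.meanHess η e j x) i) * (η i p * η i q) := by
        simp only [← hH, sub_mul, Finset.sum_sub_distrib, Finset.mul_sum, Finset.sum_mul]
        congr 1
        rw [Finset.sum_comm]
        simp only [mul_assoc]
    _ = refMat η p q + (s.meanD x p q - (s.o + 1) * refMat η p q) := by
        simp only [hF, add_mul, Finset.sum_add_distrib, refMat, Finset.mul_sum]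
        simp only [add_mul, Finset.sum_add_distrib, refMat, Finset.mul_sum] at hD
        rw [hD]
    _ = _ := by ring

end StageData
end Stage

section UnitStage

variable {d k : ℕ} {ι : Type*} [Fintype ι] {η : ι → Fin d → ℝ} {e : ι × Bool → Fin k}
  {R : (Fin d → Fin d → ℝ) →L[ℝ] (ι → ℝ)} {F : (ι → ℝ) × (ι → ι → ℝ) → (ι → ℝ)}

namespace StageData

lemma uniformCN_spiral (he : Function.Injective e) (R : (Fin d → Fin d → ℝ) →L[ℝ] (ι → ℝ))
    (hF : ContDiff ℝ 3 F) (hFc : HasCompactSupport F) :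
    UniformCN 3 (fun _ : {s : StageData d k // s.Admissible η} => (1 : ℝ))
      (fun s => spiral η e (s.1.amp η e R F)) := by
  refine UniformCN.pi fun l => ?_
  by_cases hl : l ∈ Set.range e
  · obtain ⟨q, rfl⟩ := hl
    simp only [spiral_apply he]
    simpa using (uniformCN_amp e R hF hFc q.1).1.mul (fun _ => zero_le_one)
      (uniformCN_trig_phase 3 q.2 (η q.1))
  · simp only [spiral_apply_of_notMem hl]
    exact UniformCN.const

lemma uniformCN_cross (he : Function.Injective e) (R : (Fin d → Fin d → ℝ) →L[ℝ] (ι → ℝ))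
    (hF : ContDiff ℝ 3 F) (hFc : HasCompactSupport F) :
    UniformCN 2 (fun s : {s : StageData d k // s.Admissible η} => 1 + s.1.b)
      (fun s x j => ∑ l, pd j (fun y => s.1.V y l) x * spiral η e (s.1.amp η e R F) x l) := by
  have h0 : UniformCN 2 (fun s : {s : StageData d k // s.Admissible η} => 1 + s.1.b)
      (fun s => fderiv ℝ s.1.V) := by
    refine ⟨fun s => s.2.contDiff.fderiv_right (by norm_num), 1, zero_le_one, fun s j hj x => ?_⟩
    rw [norm_iteratedFDeriv_fderiv, one_mul]
    have hb := s.2.b_nonneg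
    have ht := s.2.t_le
    have ht2 := s.2.sq_t_le
    interval_cases j
    · rw [zero_add, norm_iteratedFDeriv_one]
      linarith [s.2.grad x]
    · linarith [s.2.second x]
    · linarith [s.2.third x]
  have h1 : ∀ j l, UniformCN 2 (fun s : {s : StageData d k // s.Admissible η} => 1 + s.1.b)
      (fun s => pd j (fun y => s.1.V y l)) := by
    intro j l
    convert (h0.pd j).clm (ContinuousLinearMap.proj l) using 3 with s x
    rw [pd, fderiv_apply ((s.2.contDiff.differentiable (by simp)) x)]
    rfl
  refine UniformCN.pi fun j => UniformCN.sum _ fun l => ?_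
  have h2 := ((uniformCN_spiral (η := η) he R hF hFc).clm
    (ContinuousLinearMap.proj (R := ℝ) (φ := fun _ : Fin k => ℝ) l)).order_mono
    (show 2 ≤ 3 by norm_num)
  simpa using (h1 j l).mul (fun s => by linarith [s.2.b_nonneg]) h2

/-- The difference between the strain of the spirals and the prescribed one. -/
def stageError (η : ι → Fin d → ℝ) (e : ι × Bool → Fin k)
    (R : (Fin d → Fin d → ℝ) →L[ℝ] (ι → ℝ)) (F : (ι → ℝ) × (ι → ι → ℝ) → (ι → ℝ))
    (s : StageData d k) (x : Fin d → ℝ) : Fin d → Fin d → ℝ :=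
  fun p q => ∑ i, s.amp η e R F i x * (s.meanHess η e i x p q - s.spiralHess η e i x p q)
    + ∑ i, (1 / 2) * (pd p (s.amp η e R F i) x * pd q (s.amp η e R F i) x)

lemma uniformCN_stageError (e : ι × Bool → Fin k) (R : (Fin d → Fin d → ℝ) →L[ℝ] (ι → ℝ))
    (hF : ContDiff ℝ 3 F) (hFc : HasCompactSupport F) (p q : Fin d) :
    UniformCN 1 (fun s : {s : StageData d k // s.Admissible η} => s.1.t ^ 2)
      (fun s x => s.1.stageError η e R F x p q) := by
  have ha := fun i => uniformCN_amp (η := η) e R hF hFc i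
  refine (UniformCN.sum _ fun i => ?_).add (UniformCN.sum _ fun i => UniformCN.const_mul _ ?_)
  · simpa using ((ha i).1.order_mono (show 1 ≤ 3 by norm_num)).mul (fun _ => zero_le_one)
      (uniformCN_spiralHess η e i p q).2
  · simpa [sq] using (((ha i).2.pd p).order_mono (show 1 ≤ 2 by norm_num)).mul
      (fun s => s.2.t_pos.le) (((ha i).2.pd q).order_mono (show 1 ≤ 2 by norm_num))

lemma spiralStrain_eq (hR : ∀ S : Fin d → Fin d → ℝ, (∀ i j, S i j = S j i) → ∀ p q,
      ∑ i, R S i * (η i p * η i q) = S p q)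
    {s : StageData d k} (hs : s.Admissible η) {x : Fin d → ℝ}
    (hF : ∀ i, (1 / 2) * s.amp η e R F i x ^ 2 - ∑ j, s.amp η e R F j x * R (s.meanHess η e j x) i
      = 1 / 2 + R (fun p q => s.meanD x p q - (s.o + 1) * refMat η p q) i) (p q : Fin d) :
    spiralStrain η e (s.amp η e R F) s.V x p q
      = s.meanD x p q - s.o * refMat η p q + s.stageError η e R F x p q := by
  rw [← amp_identity hR hs hF, stageError, spiralStrain]
  simp only [mul_sub, Finset.sum_sub_distrib, spiralHess]
  ring

lemma exists_small (e : ι × Bool → Fin k) (η : ι → Fin d → ℝ)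
    (R : (Fin d → Fin d → ℝ) →L[ℝ] (ι → ℝ)) {r : ℝ} (hr : 0 < r) :
    ∃ τ : ℝ, 0 < τ ∧ τ ≤ 1 ∧ ∀ s : StageData d k, s.Admissible η → s.t ≤ τ → s.o ≤ τ →
      (∀ x p q, |s.D x p q - refMat η p q| ≤ τ) → ∀ x,
      (∀ i, |R (fun p q => s.meanD x p q - (s.o + 1) * refMat η p q) i| ≤ r) ∧
      ∀ i j, |R (s.meanHess η e j x) i| ≤ r := by
  have h0 := (UniformCN.pi fun j => UniformCN.pi fun p => UniformCN.pi fun q =>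
    (uniformCN_spiralHess η e j p q).1).exists_norm_le
  obtain ⟨C, hC, hb⟩ := h0
  set M := ‖R‖ * (2 + ‖refMat η‖) + ‖R‖ * C + 1 with hM
  have hM0 : 0 < M := by positivity
  refine ⟨min 1 (r / M), by positivity, min_le_left _ _, fun s hs ht ho hD x => ?_⟩
  set τ := min 1 (r / M) with hτ
  have hτ0 : 0 < τ := by positivity
  have hMτ : M * τ ≤ r := by
    rw [mul_comm, ← le_div_iff₀ hM0]
    exact min_le_right _ _
  have hR0 := norm_nonneg R
  have hP0 := norm_nonneg (refMat η)
  have key : ∀ (S : Fin d → Fin d → ℝ) i, |R S i| ≤ ‖R‖ * ‖S‖ := fun S i =>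
    (norm_le_pi_norm (R S) i).trans (R.le_opNorm S)
  constructor
  · intro i
    refine (key _ i).trans ?_
    have : ‖(fun p q => s.meanD x p q - (s.o + 1) * refMat η p q)‖ ≤ (2 + ‖refMat η‖) * τ := by
      refine (pi_norm_le_iff_of_nonneg (by positivity)).2 fun p =>
        (pi_norm_le_iff_of_nonneg (by positivity)).2 fun q => ?_
      have h1 : |s.meanD x p q - s.D x p q| ≤ s.t ^ 2 :=
        abs_mollify_sub_le (hs.continuous p q) fun y hy => hs.osc x y hy p q
      have h2 := hD x p q
      have h3 : |s.o * refMat η p q| ≤ τ * ‖refMat η‖ := by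
        rw [abs_mul, abs_of_nonneg hs.o_nonneg]
        exact mul_le_mul ho ((norm_le_pi_norm (refMat η p) q).trans (norm_le_pi_norm _ p))
          (abs_nonneg _) hτ0.le
      have h4 := hs.sq_t_le
      rw [Real.norm_eq_abs]
      rw [abs_le] at *
      constructor <;> nlinarith
    nlinarith [mul_le_mul_of_nonneg_left this hR0, mul_nonneg (mul_nonneg hR0 hC) hτ0.le]
  · intro i j
    refine (key _ i).trans ?_
    have : ‖s.meanHess η e j x‖ ≤ C * τ :=
      ((norm_le_pi_norm (fun j => s.meanHess η e j x) j).trans (hb ⟨s, hs⟩ x)).trans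
        (mul_le_mul_of_nonneg_left ht hC)
    nlinarith [mul_le_mul_of_nonneg_left this hR0, mul_nonneg (mul_nonneg hR0 hP0) hτ0.le,
      mul_nonneg hR0 hτ0.le]

end StageData

open StageData in
lemma exists_unit_stage (he : Function.Injective e)
    (hR : ∀ S : Fin d → Fin d → ℝ, (∀ i j, S i j = S j i) → ∀ p q,
      ∑ i, R S i * (η i p * η i q) = S p q) :
    ∃ τ C : ℝ, 0 < τ ∧ τ ≤ 1 ∧ 0 ≤ C ∧ ∀ s : StageData d k, s.Admissible η → s.t ≤ τ → s.o ≤ τ →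
      (∀ x p q, |s.D x p q - refMat η p q| ≤ τ) →
      ∃ a : ι → (Fin d → ℝ) → ℝ, (∀ i, ContDiff ℝ 3 (a i)) ∧
        (∀ j ≤ 3, ∀ x, ‖iteratedFDeriv ℝ j (spiral η e a) x‖ ≤ C) ∧
        (∀ j ≤ 2, ∀ x, ‖iteratedFDeriv ℝ j (fun x i => ∑ l, pd i (fun y => s.V y l) x *
          spiral η e a x l) x‖ ≤ C * (1 + s.b)) ∧
        (∀ x p q, |s.D x p q - spiralStrain η e a s.V x p q - s.o * refMat η p q|
          ≤ C * s.t ^ 2) ∧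
        (∀ x y p q, |spiralStrain η e a s.V x p q - spiralStrain η e a s.V y p q|
          ≤ C * s.t ^ 2 * ‖x - y‖) := by
  obtain ⟨F, r, hr, hF, hFc, hFeq⟩ := exists_contDiff_amplitude (ι := ι)
  obtain ⟨τ, hτ, hτ1, hsmall⟩ := exists_small e η R hr
  obtain ⟨-, C₁, hC₁, h₁⟩ := uniformCN_spiral (η := η) he R hF hFc
  obtain ⟨-, C₂, hC₂, h₂⟩ := uniformCN_cross (η := η) he R hF hFc
  have hE : UniformCN 1 (fun s : {s : StageData d k // s.Admissible η} => s.1.t ^ 2)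
      (fun s => s.1.stageError η e R F) := UniformCN.pi fun p => UniformCN.pi fun q =>
    uniformCN_stageError e R hF hFc p q
  obtain ⟨C₃, hC₃, h₃⟩ := hE.exists_norm_le
  obtain ⟨C₄, hC₄, h₄⟩ := UniformCN.exists_norm_fderiv_le (N := 0) hE
  have hDc : ∀ s : {s : StageData d k // s.Admissible η}, Differentiable ℝ s.1.meanD := fun s =>
    differentiable_pi.2 fun p => differentiable_pi.2 fun q =>
      (((uniformCN_meanD η p q).1.contDiff s).differentiable (by simp))
  obtain ⟨C₅, hC₅, h₅⟩ := (UniformCN.fderiv_pi (fun s p => differentiable_pi.1 (hDc s) p)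
    fun p => UniformCN.fderiv_pi (fun s q => differentiable_pi.1 (differentiable_pi.1 (hDc s) p) q)
        fun q => (uniformCN_meanD η p q).2).exists_norm_le
  refine ⟨τ, C₁ + C₂ + (C₃ + 1) + (C₄ + C₅), hτ, hτ1, by positivity, fun s hs ht ho hD => ?_⟩
  have hs' : ∀ x i, (1 / 2) * s.amp η e R F i x ^ 2
      - ∑ j, s.amp η e R F j x * R (s.meanHess η e j x) i
      = 1 / 2 + R (fun p q => s.meanD x p q - (s.o + 1) * refMat η p q) i := fun x i =>
    hFeq _ _ (fun i => by simpa using (hsmall s hs ht ho hD x).1 i)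
      (fun i j => (hsmall s hs ht ho hD x).2 i j) i
  have heq := fun x p q => spiralStrain_eq hR hs (hs' x) p q
  have hb := hs.b_nonneg
  refine ⟨s.amp η e R F, fun i => (uniformCN_amp e R hF hFc i).1.contDiff ⟨s, hs⟩,
    fun j hj x => (h₁ ⟨s, hs⟩ j hj x).trans (by linarith),
    fun j hj x => (h₂ ⟨s, hs⟩ j hj x).trans ?_, fun x p q => ?_, fun x y p q => ?_⟩
  · gcongr
    linarith
  · have h6 : |s.meanD x p q - s.D x p q| ≤ s.t ^ 2 :=
      abs_mollify_sub_le (hs.continuous p q) fun y hy => hs.osc x y hy p q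
    have h7 : |s.stageError η e R F x p q| ≤ C₃ * s.t ^ 2 :=
      ((norm_le_pi_norm (s.stageError η e R F x p) q).trans (norm_le_pi_norm _ p)).trans
        (h₃ ⟨s, hs⟩ x)
    rw [heq, show s.D x p q - (s.meanD x p q - s.o * refMat η p q + s.stageError η e R F x p q)
      - s.o * refMat η p q = -(s.meanD x p q - s.D x p q) - s.stageError η e R F x p q by ring]
    refine (abs_sub _ _).trans ?_
    rw [abs_neg]
    have := sq_nonneg s.t
    nlinarith [mul_nonneg hC₁ this, mul_nonneg hC₂ this, mul_nonneg hC₄ this, mul_nonneg hC₅ this]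
  · have hd : ∀ z, HasFDerivAt (fun z => s.meanD z + s.stageError η e R F z)
        (fderiv ℝ s.meanD z + fderiv ℝ (s.stageError η e R F) z) z := fun z =>
      (hDc ⟨s, hs⟩ z).hasFDerivAt.add
        (((hE.contDiff ⟨s, hs⟩).differentiable (by simp)) z).hasFDerivAt
    have h8 := convex_univ.norm_image_sub_le_of_norm_hasFDerivWithin_le (𝕜 := ℝ)
      (C := (C₄ + C₅) * s.t ^ 2)
      (fun z _ => (hd z).hasFDerivWithinAt) (fun z _ => (norm_add_le _ _).trans (by
        linarith [h₄ ⟨s, hs⟩ z, h₅ ⟨s, hs⟩ z])) (Set.mem_univ y) (Set.mem_univ x)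
    have h9 := (norm_le_pi_norm _ q).trans ((norm_le_pi_norm _ p).trans h8)
    rw [heq, heq]
    have hn := mul_nonneg (sq_nonneg s.t) (norm_nonneg (x - y))
    calc _ = ‖((s.meanD x + s.stageError η e R F x) - (s.meanD y + s.stageError η e R F y)) p q‖ := by
          rw [Real.norm_eq_abs]
          congr 1
          simp only [Pi.add_apply, Pi.sub_apply]
          ring
      _ ≤ _ := h9
      _ ≤ _ := by nlinarith [mul_nonneg hC₁ hn, mul_nonneg hC₂ hn, mul_nonneg hC₃ hn]

end UnitStage

section Rescaling

variable {d k : ℕ}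

lemma norm_iteratedFDeriv_rescale {E X : Type*} [NormedAddCommGroup E] [NormedSpace ℝ E]
    [NormedAddCommGroup X] [NormedSpace ℝ X] {f : X → E} {n : WithTop ℕ∞} (hf : ContDiff ℝ n f)
    {j : ℕ} (hj : j ≤ n) {c μ : ℝ} (hc : 0 ≤ c) (hμ : 0 ≤ μ) (x : X) :
    ‖iteratedFDeriv ℝ j (fun y => c • f (μ • y)) x‖ = c * μ ^ j * ‖iteratedFDeriv ℝ j f (μ • x)‖ := by
  have h1 : ContDiff ℝ j (fun y => f (μ • y)) :=
    (hf.of_le hj).comp (contDiff_const_smul μ)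
  rw [iteratedFDeriv_const_smul_apply' h1.contDiffAt, iteratedFDeriv_comp_const_smul μ (hf.of_le hj),
    norm_smul, norm_smul, Real.norm_eq_abs, abs_of_nonneg hc, Real.norm_eq_abs, abs_pow,
    abs_of_nonneg hμ, mul_assoc]

lemma pd_rescale {f : (Fin d → ℝ) → ℝ} (hf : Differentiable ℝ f) (c μ : ℝ) (p : Fin d)
    (x : Fin d → ℝ) : pd p (fun y => c * f (μ • y)) x = c * μ * pd p f (μ • x) := by
  have h1 : HasFDerivAt (fun y : Fin d → ℝ => μ • y) (μ • ContinuousLinearMap.id ℝ _) x :=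
    (hasFDerivAt_id x).const_smul μ
  have h2 := ((hf (μ • x)).hasFDerivAt.comp x h1).const_mul c
  have h3 : fderiv ℝ (fun y => c * f (μ • y)) x = _ := h2.fderiv
  rw [pd, h3]
  simp [pd, mul_assoc]

lemma hess_rescale {f : (Fin d → ℝ) → ℝ} (hf : ContDiff ℝ 2 f) (c μ : ℝ) (p q : Fin d)
    (x : Fin d → ℝ) :
    hess (fun y => c * f (μ • y)) x p q = c * μ ^ 2 * hess f (μ • x) p q := by
  have h1 : pd q (fun y => c * f (μ • y)) = fun y => (c * μ) * pd q f (μ • y) := by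
    ext y
    exact pd_rescale (hf.differentiable (by simp)) c μ q y
  rw [hess, h1, pd_rescale ((hf.pd (m := 1) (by norm_num) q).differentiable (by simp)), hess]
  ring

variable {ι : Type*} [Fintype ι] {η : ι → Fin d → ℝ} {e : ι × Bool → Fin k}

lemma phase_smul (μ : ℝ) (η x : Fin d → ℝ) : phase (μ • η) x = phase η (μ • x) := by
  simp only [phase, Pi.smul_apply, smul_eq_mul]
  exact Finset.sum_congr rfl fun _ _ => by ring

omit [Fintype ι] in
lemma spiral_rescale (he : Function.Injective e) (a : ι → (Fin d → ℝ) → ℝ) (c μ : ℝ) :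
    spiral (fun i => μ • η i) e (fun i x => c * a i (μ • x))
      = fun x => c • spiral η e a (μ • x) := by
  ext x l
  by_cases hl : l ∈ Set.range e
  · obtain ⟨q, rfl⟩ := hl
    simp only [spiral_apply he, phase_smul, Pi.smul_apply, smul_eq_mul, mul_assoc]
  · simp [spiral_apply_of_notMem hl]

lemma spiralStrain_rescale {a : ι → (Fin d → ℝ) → ℝ} (ha : ∀ i, ContDiff ℝ 1 (a i))
    {V : (Fin d → ℝ) → Fin k → ℝ} (hV : ContDiff ℝ 2 V) {δ μ : ℝ} (hμ : μ ≠ 0)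
    (x : Fin d → ℝ) (p q : Fin d) :
    spiralStrain (fun i => μ • η i) e (fun i x => (δ / μ) * a i (μ • x))
      (fun y => (δ / μ) • V (μ • y)) x p q = δ ^ 2 * spiralStrain η e a V (μ • x) p q := by
  have h1 : ∀ i p, pd p (fun x => (δ / μ) * a i (μ • x)) x = δ / μ * μ * pd p (a i) (μ • x) :=
    fun i p => pd_rescale ((ha i).differentiable (by simp)) _ _ _ _
  have h2 : ∀ l, hess (fun y => ((δ / μ) • V (μ • y)) l) x p q
      = δ / μ * μ ^ 2 * hess (fun y => V y l) (μ • x) p q := fun l =>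
    hess_rescale (contDiff_pi.1 hV l) _ _ _ _ _
  simp only [spiralStrain, h1, h2, phase_smul]
  simp only [mul_sub, mul_add, Finset.mul_sum]
  congr 1
  · congr 1
    · exact Finset.sum_congr rfl fun i _ => by simp only [Pi.smul_apply, smul_eq_mul]; field_simp
    · exact Finset.sum_congr rfl fun i _ => by field_simp
  · exact Finset.sum_congr rfl fun i _ => Finset.sum_congr rfl fun b _ => by field_simp

lemma exists_stage (he : Function.Injective e) {R : (Fin d → Fin d → ℝ) →L[ℝ] (ι → ℝ)}
    (hR : ∀ S : Fin d → Fin d → ℝ, (∀ i j, S i j = S j i) → ∀ p q,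
      ∑ i, R S i * (η i p * η i q) = S p q) :
    ∃ τ C : ℝ, 0 < τ ∧ τ ≤ 1 ∧ 0 ≤ C ∧ ∀ (A : (Fin d → ℝ) → Fin d → Fin d → ℝ)
      (v : (Fin d → ℝ) → Fin k → ℝ) (w : (Fin d → ℝ) → Fin d → ℝ) (δ δ' μ t b : ℝ),
      (∀ p q, Continuous fun x => A x p q) → (∀ x p q, A x p q = A x q p) →
      ContDiff ℝ 3 v → ContDiff ℝ 2 w → 0 < δ → δ ≤ 1 → δ' ^ 2 ≤ τ * δ ^ 2 → 0 < μ →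
      0 < t → t ≤ τ → (∀ x, ‖fderiv ℝ v x‖ ≤ b) →
      (∀ x, ‖iteratedFDeriv ℝ 2 v x‖ ≤ t * δ * μ) →
      (∀ x, ‖iteratedFDeriv ℝ 3 v x‖ ≤ t ^ 2 * δ * μ ^ 2) →
      (∀ x p q, |deficit A v w x p q - δ ^ 2 * refMat η p q| ≤ τ * δ ^ 2) →
      (∀ x y, μ * dist x y ≤ 1 → ∀ p q,
        |deficit A v w x p q - deficit A v w y p q| ≤ t ^ 2 * δ ^ 2) →
      ∃ (v' : (Fin d → ℝ) → Fin k → ℝ) (w' : (Fin d → ℝ) → Fin d → ℝ),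
        ContDiff ℝ 3 v' ∧ ContDiff ℝ 2 w' ∧
        (∀ j ≤ 3, ∀ x, ‖iteratedFDeriv ℝ j (fun y => v' y - v y) x‖ ≤ C * (δ / μ) * μ ^ j) ∧
        (∀ j ≤ 2, ∀ x, ‖iteratedFDeriv ℝ j (fun y => w' y - w y) x‖
          ≤ C * (1 + b) * (δ / μ) * μ ^ j) ∧
        (∀ x p q, |deficit A v' w' x p q - δ' ^ 2 * refMat η p q| ≤ C * t ^ 2 * δ ^ 2) ∧
        (∀ x y p q, |strain v' w' x p q - strain v' w' y p q|
          ≤ |strain v w x p q - strain v w y p q| + C * t ^ 2 * δ ^ 2 * μ * ‖x - y‖) := by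
  obtain ⟨τ, C, hτ, hτ1, hC, H⟩ := exists_unit_stage he hR
  refine ⟨τ, C, hτ, hτ1, hC, fun A v w δ δ' μ t b hA hAs hv hw hδ hδ1 hδ' hμ ht htτ hb h2 h3 hD
    hosc => ?_⟩
  have hμ0 : μ ≠ 0 := hμ.ne'
  have hb0 : 0 ≤ b := (norm_nonneg _).trans (hb 0)
  have hDc : ∀ p q, Continuous fun x => deficit A v w x p q := by
    intro p q
    have hv1 : ∀ i l, Continuous (pd i fun y => v y l) := fun i l =>
      ((contDiff_pi.1 hv l).pd (m := 0) (by norm_num) i).continuous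
    have hw1 : ∀ i l, Continuous (pd i fun y => w y l) := fun i l =>
      ((contDiff_pi.1 hw l).pd (m := 0) (by norm_num) i).continuous
    unfold deficit gradTgrad symGrad
    have := hA p q
    fun_prop
  let s : StageData d k :=
    { V := fun y => (μ / δ) • v (μ⁻¹ • y)
      D := fun y p q => (δ ^ 2)⁻¹ * deficit A v w (μ⁻¹ • y) p q
      t := t
      o := δ' ^ 2 / δ ^ 2
      b := b / δ }
  have hsV : ∀ j ≤ 3, ∀ x, ‖iteratedFDeriv ℝ j s.V x‖
      = μ / δ * μ⁻¹ ^ j * ‖iteratedFDeriv ℝ j v (μ⁻¹ • x)‖ := fun j hj x =>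
    norm_iteratedFDeriv_rescale hv (by exact_mod_cast hj) (by positivity) (by positivity) x
  have hso : s.o ≤ τ := by
    change δ' ^ 2 / δ ^ 2 ≤ τ
    rwa [div_le_iff₀ (by positivity)]
  have hsD : ∀ x p q, |s.D x p q - refMat η p q| ≤ τ := by
    intro x p q
    have : s.D x p q - refMat η p q
        = (δ ^ 2)⁻¹ * (deficit A v w (μ⁻¹ • x) p q - δ ^ 2 * refMat η p q) := by
      simp only [s]
      field_simp
    rw [this, abs_mul, abs_of_pos (by positivity), inv_mul_le_iff₀ (by positivity)]
    exact (hD _ _ _).trans_eq (mul_comm _ _)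
  have hs : s.Admissible η :=
    { contDiff := ContDiff.const_smul (μ / δ) (hv.comp (contDiff_const_smul μ⁻¹))
      continuous := fun p q => continuous_const.mul ((hDc p q).comp (continuous_const_smul _))
      symm := fun x p q => by
        have h := strain_symm v w (μ⁻¹ • x) p q
        simp only [strain] at h
        simp only [s, deficit, hAs _ p q, h]
      t_pos := ht
      t_le := htτ.trans hτ1
      o_nonneg := by positivity
      o_le := hso.trans hτ1
      near := fun x p q => (hsD x p q).trans hτ1
      osc := fun x y hxy p q => by
        have h := hosc (μ⁻¹ • x) (μ⁻¹ • y) (by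
          rw [dist_smul₀, Real.norm_eq_abs, abs_of_pos (by positivity)]
          field_simp
          exact hxy) p q
        simp only [s]
        rw [← mul_sub, abs_mul, abs_of_pos (by positivity), inv_mul_le_iff₀ (by positivity)]
        exact h.trans_eq (mul_comm _ _)
      second := fun x => by
        rw [hsV 2 (by norm_num)]
        calc _ ≤ μ / δ * μ⁻¹ ^ 2 * (t * δ * μ) := by gcongr; exact h2 _
          _ = t := by field_simp
      third := fun x => by
        rw [hsV 3 (by norm_num)]
        calc _ ≤ μ / δ * μ⁻¹ ^ 3 * (t ^ 2 * δ * μ ^ 2) := by gcongr; exact h3 _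
          _ = t ^ 2 := by field_simp
      b_nonneg := by positivity
      grad := fun x => by
        rw [← norm_iteratedFDeriv_one, hsV 1 (by norm_num), norm_iteratedFDeriv_one]
        calc _ ≤ μ / δ * μ⁻¹ ^ 1 * b := by gcongr; exact hb _
          _ = b / δ := by field_simp }
  obtain ⟨a, ha, hP, hX, hE, hL⟩ := H s hs htτ hso hsD
  have ha1 : ∀ i, ContDiff ℝ 1 (a i) := fun i => (ha i).of_le (by norm_num)
  have hPc : ContDiff ℝ 3 (spiral η e a) := contDiff_spiral he ha
  set P := spiral (fun i => μ • η i) e (fun i x => (δ / μ) * a i (μ • x)) with hPdef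
  have hPeq : P = fun x => (δ / μ) • spiral η e a (μ • x) := spiral_rescale he a _ _
  have ha' : ∀ i, ContDiff ℝ 3 (fun x => (δ / μ) * a i (μ • x)) := fun i =>
    contDiff_const.mul ((ha i).comp (contDiff_const_smul _))
  have hPc' : ContDiff ℝ 3 P := contDiff_spiral he ha'
  have hvV : v = fun y => (δ / μ) • s.V (μ • y) := by
    ext y l
    simp only [s, smul_smul, inv_mul_cancel₀ hμ0, one_smul]
    rw [show δ / μ * (μ / δ) = 1 by field_simp, one_smul]
  have hstrain : ∀ x p q, strain (fun y l => v y l + P y l) (correctW v P w) x p q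
      = strain v w x p q + δ ^ 2 * spiralStrain η e a s.V (μ • x) p q := by
    intro x p q
    rw [strain_add_spiral he (fun i => (ha' i).of_le (by norm_num)) (hv.of_le (by norm_num))
      (hw.of_le (by norm_num)), ← spiralStrain_rescale ha1 (hs.contDiff.of_le (by norm_num)) hμ0,
      ← hvV]
  have hXc : ContDiff ℝ 2 (fun x i => ∑ l, pd i (fun y => s.V y l) x * spiral η e a x l) := by
    refine contDiff_pi.2 fun i => ContDiff.sum fun l _ => ContDiff.mul ?_ ?_
    · exact (contDiff_pi.1 hs.contDiff l).pd (by norm_num) i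
    · exact contDiff_pi.1 (hPc.of_le (by norm_num)) l
  have hwdiff : (fun y => correctW v P w y - w y) = fun y => -((δ ^ 2 / μ) •
      (fun x i => ∑ l, pd i (fun y => s.V y l) x * spiral η e a x l) (μ • y)) := by
    ext y i
    have h1 : ∀ l, pd i (fun y => v y l) y = δ * pd i (fun y => s.V y l) (μ • y) := by
      intro l
      have := pd_rescale (((contDiff_pi.1 hs.contDiff l)).differentiable (by simp)) (δ / μ) μ i y
      rw [div_mul_cancel₀ _ hμ0] at this
      rw [← this]
      conv_lhs => rw [hvV]
      rfl
    simp only [correctW, h1, hPeq, Pi.sub_apply, Pi.neg_apply, Pi.smul_apply, smul_eq_mul,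
      Finset.mul_sum, sub_sub_cancel_left]
    congr 1
    exact Finset.sum_congr rfl fun l _ => by ring
  refine ⟨fun y l => v y l + P y l, correctW v P w, hv.add hPc', ?_, fun j hj x => ?_,
    fun j hj x => ?_, fun x p q => ?_, fun x y p q => ?_⟩
  · have : correctW v P w = fun y => w y + (correctW v P w y - w y) := by ext; simp
    rw [this]
    refine hw.add ?_
    rw [hwdiff]
    exact (ContDiff.const_smul (δ ^ 2 / μ) (hXc.comp (contDiff_const_smul μ))).neg
  · have : (fun y => (fun l => v y l + P y l) - v y) = fun y => (δ / μ) • spiral η e a (μ • y) := by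
      ext y l
      simp [hPeq]
    rw [this, norm_iteratedFDeriv_rescale hPc (by exact_mod_cast hj) (by positivity) hμ.le]
    calc _ ≤ δ / μ * μ ^ j * C := by gcongr; exact hP j hj _
      _ = _ := by ring
  · rw [hwdiff]
    change ‖iteratedFDeriv ℝ j (-_) x‖ ≤ _
    rw [iteratedFDeriv_neg_apply, norm_neg,
      norm_iteratedFDeriv_rescale hXc (by exact_mod_cast hj) (by positivity) hμ.le]
    calc _ ≤ δ ^ 2 / μ * μ ^ j * (C * (1 + b / δ)) := by gcongr; exact hX j hj _
      _ = C * (δ + b) * (δ / μ) * μ ^ j := by field_simp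
      _ ≤ _ := by gcongr
  · have h := hE (μ • x) p q
    have h4 : deficit A (fun y l => v y l + P y l) (correctW v P w) x p q - δ' ^ 2 * refMat η p q
        = δ ^ 2 * (s.D (μ • x) p q - spiralStrain η e a s.V (μ • x) p q - s.o * refMat η p q) := by
      have h5 : deficit A (fun y l => v y l + P y l) (correctW v P w) x p q
          = A x p q - strain (fun y l => v y l + P y l) (correctW v P w) x p q := rfl
      have h6 : s.D (μ • x) p q = (δ ^ 2)⁻¹ * (A x p q - strain v w x p q) := by
        simp only [s, smul_smul, inv_mul_cancel₀ hμ0, one_smul]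
        rfl
      rw [h5, hstrain, h6]
      simp only [s]
      field_simp
      ring
    rw [h4, abs_mul, abs_of_pos (by positivity)]
    calc _ ≤ δ ^ 2 * (C * t ^ 2) := by gcongr
      _ = _ := by ring
  · have h := hL (μ • x) (μ • y) p q
    rw [← smul_sub, norm_smul, Real.norm_eq_abs, abs_of_pos hμ] at h
    rw [hstrain, hstrain]
    calc _ = |(strain v w x p q - strain v w y p q) + δ ^ 2 *
          (spiralStrain η e a s.V (μ • x) p q - spiralStrain η e a s.V (μ • y) p q)| := by
          congr 1; ring
      _ ≤ |strain v w x p q - strain v w y p q| + δ ^ 2 * (C * t ^ 2 * (μ * ‖x - y‖)) := by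
          refine (abs_add_le _ _).trans ?_
          rw [abs_mul, abs_of_pos (by positivity : 0 < δ ^ 2)]
          gcongr
      _ = _ := by ring

end Rescaling

section Limit

open Filter Topology

variable {d k : ℕ}

lemma isHolder_of_dist_le {E : Type*} [NormedAddCommGroup E] {α : ℝ} (hα : 0 ≤ α)
    {f : (Fin d → ℝ) → E} {C : ℝ} (hC : 0 ≤ C)
    (h : ∀ x y, dist (f x) (f y) ≤ C * dist x y ^ α) : IsHolder α f := by
  refine ⟨C.toNNReal, fun x y => ?_⟩
  rw [edist_dist, edist_dist, Real.coe_toNNReal _ hα, ENNReal.ofReal_rpow_of_nonneg dist_nonneg hα]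
  change _ ≤ ENNReal.ofReal C * _
  rw [← ENNReal.ofReal_mul hC]
  exact ENNReal.ofReal_le_ofReal (h x y)

lemma IsHolder.exists_dist_le {E : Type*} [NormedAddCommGroup E] {α : ℝ} (hα : 0 ≤ α)
    {f : (Fin d → ℝ) → E} (h : IsHolder α f) :
    ∃ C : ℝ, 0 ≤ C ∧ ∀ x y, dist (f x) (f y) ≤ C * dist x y ^ α := by
  obtain ⟨C, hC⟩ := h
  refine ⟨C, C.2, fun x y => ?_⟩
  have := hC.dist_le x y
  rwa [Real.coe_toNNReal _ hα] at this

lemma exists_isC1Holder_limit {E : Type*} [NormedAddCommGroup E] [NormedSpace ℝ E]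
    [CompleteSpace E] {α : ℝ} (hα : 0 ≤ α) {f : ℕ → (Fin d → ℝ) → E} (hf0 : IsC1Holder α (f 0))
    (hf : ∀ n, ContDiff ℝ 1 (f n)) {a b h : ℕ → ℝ} (ha : Summable a) (hb : Summable b)
    (hh : Summable h) (hhn : ∀ n, 0 ≤ h n)
    (h0 : ∀ n x, ‖f (n + 1) x - f n x‖ ≤ a n)
    (h1 : ∀ n x, ‖fderiv ℝ (fun y => f (n + 1) y - f n y) x‖ ≤ b n)
    (h2 : ∀ n x y, dist (fderiv ℝ (fun y => f (n + 1) y - f n y) x)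
      (fderiv ℝ (fun y => f (n + 1) y - f n y) y) ≤ h n * dist x y ^ α) :
    ∃ F : (Fin d → ℝ) → E, IsC1Holder α F ∧ (∀ x, ‖F x - f 0 x‖ ≤ ∑' n, a n) ∧
      ∀ x, Tendsto (fun n => fderiv ℝ (f n) x) atTop (𝓝 (fderiv ℝ F x)) := by
  set g : ℕ → (Fin d → ℝ) → E := fun n y => f (n + 1) y - f n y with hg
  have hgC : ∀ n, ContDiff ℝ 1 (g n) := fun n => (hf (n + 1)).sub (hf n)
  have hgd : ∀ n, Differentiable ℝ (g n) := fun n => (hgC n).differentiable (by simp)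
  have hsum : ∀ x, Summable fun n => g n x := fun x =>
    Summable.of_norm_bounded ha fun n => h0 n x
  have hsum' : ∀ x, Summable fun n => fderiv ℝ (g n) x := fun x =>
    Summable.of_norm_bounded hb fun n => h1 n x
  have hS : ContDiff ℝ 1 (fun x => ∑' n, g n x) := by
    refine contDiff_tsum (v := fun j => if j = 0 then a else b) (N := 1)
      (fun n => by exact_mod_cast hgC n) ?_ ?_
    · intro j _
      by_cases hj : j = 0 <;> simp [hj, ha, hb]
    · intro j n x hj
      have hj' : j ≤ 1 := by exact_mod_cast hj
      interval_cases j
      · simpa using h0 n x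
      · simpa [norm_iteratedFDeriv_one] using h1 n x
  have hfd : ∀ x, fderiv ℝ (fun x => ∑' n, g n x) x = ∑' n, fderiv ℝ (g n) x := by
    intro x
    have := fderiv_tsum (𝕜 := ℝ) hb hgd h1 (hsum 0)
    exact congrFun this x
  have hFd : ∀ x, fderiv ℝ (fun x => f 0 x + ∑' n, g n x) x
      = fderiv ℝ (f 0) x + ∑' n, fderiv ℝ (g n) x := by
    intro x
    rw [fderiv_fun_add ((hf 0).differentiable (by simp) x) (hS.differentiable (by simp) x), hfd]
  refine ⟨fun x => f 0 x + ∑' n, g n x, ⟨(hf 0).add hS, ?_⟩, fun x => ?_, fun x => ?_⟩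
  · obtain ⟨C, hC, hC0⟩ := hf0.2.exists_dist_le hα
    have hh0 : 0 ≤ ∑' n, h n := tsum_nonneg hhn
    refine isHolder_of_dist_le hα (C := C + ∑' n, h n) (by positivity) fun x y => ?_
    rw [hFd, hFd, add_mul]
    refine (dist_add_add_le _ _ _ _).trans (add_le_add (hC0 x y) ?_)
    rw [dist_eq_norm, ← (hsum' x).tsum_sub (hsum' y), ← tsum_mul_right]
    refine tsum_of_norm_bounded ((hh.mul_right _).hasSum) fun n => ?_
    rw [← dist_eq_norm]
    exact h2 n x y
  · rw [add_sub_cancel_left]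
    exact tsum_of_norm_bounded ha.hasSum fun n => h0 n x
  · rw [hFd]
    have h4 : ∀ n, fderiv ℝ (f n) x = fderiv ℝ (f 0) x + ∑ i ∈ Finset.range n, fderiv ℝ (g i) x := by
      intro n
      induction n with
      | zero => simp
      | succ n ih =>
        rw [Finset.sum_range_succ, ← add_assoc, ← ih, ← fderiv_fun_add
          ((hf n).differentiable (by simp) x) (hgd n x)]
        congr 1
        ext y
        simp [hg]
    refine Tendsto.congr (fun n => (h4 n).symm) ?_
    exact ((hsum' x).hasSum.tendsto_sum_nat).const_add _

lemma min_le_mul_rpow {X t α r : ℝ} (hX : 0 ≤ X) (ht : 0 ≤ t) (hα : 0 ≤ α) (hα1 : α ≤ 1)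
    (h1 : r ≤ 2 * X) (h2 : r ≤ X * t) : r ≤ 2 * X * t ^ α := by
  rcases le_total 1 t with h | h
  · exact h1.trans (le_mul_of_one_le_right (by positivity) (Real.one_le_rpow h hα))
  · have h3 : t ≤ t ^ α := by
      rcases ht.eq_or_lt with rfl | ht0
      · exact Real.rpow_nonneg le_rfl _
      · simpa using Real.rpow_le_rpow_of_exponent_ge ht0 h hα1
    nlinarith [mul_le_mul_of_nonneg_left h3 hX, mul_nonneg hX (Real.rpow_nonneg ht α)]

lemma dist_fderiv_le_rpow {E : Type*} [NormedAddCommGroup E] [NormedSpace ℝ E]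
    {g : (Fin d → ℝ) → E} (hg : ContDiff ℝ 2 g) {X l α : ℝ} (hX : 0 ≤ X) (hl : 0 ≤ l) (hα : 0 ≤ α)
    (hα1 : α ≤ 1) (h1 : ∀ x, ‖fderiv ℝ g x‖ ≤ X) (h2 : ∀ x, ‖iteratedFDeriv ℝ 2 g x‖ ≤ X * l)
    (x y : Fin d → ℝ) :
    dist (fderiv ℝ g x) (fderiv ℝ g y) ≤ 2 * X * l ^ α * dist x y ^ α := by
  rw [mul_assoc, ← Real.mul_rpow hl dist_nonneg]
  refine min_le_mul_rpow hX (by positivity) hα hα1 ?_ ?_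
  · rw [dist_eq_norm, two_mul]
    exact (norm_sub_le _ _).trans (add_le_add (h1 x) (h1 y))
  · have hd : Differentiable ℝ (fderiv ℝ g) :=
      (hg.fderiv_right (m := 1) (by norm_num)).differentiable (by simp)
    rw [← mul_assoc, dist_comm, dist_comm x, dist_eq_norm, dist_eq_norm]
    refine convex_univ.norm_image_sub_le_of_norm_fderiv_le (fun z _ => hd z) (fun z _ => ?_)
      (Set.mem_univ x) (Set.mem_univ y)
    rw [norm_fderiv_fderiv]
    exact h2 z

lemma pd_eval {F : (Fin d → ℝ) → Fin k → ℝ} {x : Fin d → ℝ} (hF : DifferentiableAt ℝ F x)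
    (i : Fin d) (l : Fin k) : pd i (fun y => F y l) x = fderiv ℝ F x (Pi.single i 1) l := by
  rw [pd, fderiv_apply hF]
  rfl

lemma tendsto_deficit {A : (Fin d → ℝ) → Fin d → Fin d → ℝ} {v : ℕ → (Fin d → ℝ) → Fin k → ℝ}
    {w : ℕ → (Fin d → ℝ) → Fin d → ℝ} {v' : (Fin d → ℝ) → Fin k → ℝ}
    {w' : (Fin d → ℝ) → Fin d → ℝ} {x : Fin d → ℝ} (hv : ∀ n, DifferentiableAt ℝ (v n) x)
    (hw : ∀ n, DifferentiableAt ℝ (w n) x) (hv' : DifferentiableAt ℝ v' x)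
    (hw' : DifferentiableAt ℝ w' x)
    (hvt : Tendsto (fun n => fderiv ℝ (v n) x) atTop (𝓝 (fderiv ℝ v' x)))
    (hwt : Tendsto (fun n => fderiv ℝ (w n) x) atTop (𝓝 (fderiv ℝ w' x))) (p q : Fin d) :
    Tendsto (fun n => deficit A (v n) (w n) x p q) atTop (𝓝 (deficit A v' w' x p q)) := by
  have h1 : ∀ i l, Tendsto (fun n => pd i (fun y => v n y l) x) atTop
      (𝓝 (pd i (fun y => v' y l) x)) := by
    intro i l
    simp only [pd_eval (hv _), pd_eval hv']
    exact tendsto_pi_nhds.1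
      (((ContinuousLinearMap.apply ℝ _ (Pi.single i 1)).continuous.tendsto _).comp hvt) l
  have h2 : ∀ i l, Tendsto (fun n => pd i (fun y => w n y l) x) atTop
      (𝓝 (pd i (fun y => w' y l) x)) := by
    intro i l
    simp only [pd_eval (hw _), pd_eval hw']
    exact tendsto_pi_nhds.1
      (((ContinuousLinearMap.apply ℝ _ (Pi.single i 1)).continuous.tendsto _).comp hwt) l
  unfold deficit gradTgrad symGrad
  refine tendsto_const_nhds.sub (Tendsto.add (tendsto_const_nhds.mul ?_)
    (((h2 p q).add (h2 q p)).div_const 2))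
  exact tendsto_finsetSum _ fun l _ => (h1 p l).mul (h1 q l)

lemma exists_ratio {α β τ : ℝ} (hα : 0 < α) (hα1 : α < β / 2) (hβ1 : β ≤ 1) (hτ : 0 < τ) (M : ℝ) :
    ∃ σ q : ℝ, 1 < σ ∧ 0 < q ∧ q ≤ 1 / 2 ∧ q ^ 2 ≤ τ ∧ M ≤ q ^ 2 * σ ∧ q * σ ^ α < 1 ∧
      σ ^ (-β) ≤ q ^ 2 := by
  set a := (α + β / 2) / 2 with ha
  have ha1 : α < a := by linarith
  have ha2 : a < β / 2 := by linarith
  have hlim : Tendsto (fun σ : ℝ => σ ^ (-a)) atTop (𝓝 0) := tendsto_rpow_neg_atTop (by linarith)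
  have hlim2 : Tendsto (fun σ : ℝ => σ ^ (1 - 2 * a)) atTop atTop := tendsto_rpow_atTop (by linarith)
  have hm : 0 < min (1 / 2) τ := by positivity
  obtain ⟨σ, h1, h2, h3⟩ := ((eventually_gt_atTop 1).and
    ((hlim.eventually_le_const hm).and (hlim2.eventually_ge_atTop M))).exists
  have hσ : 0 < σ := by linarith
  have hq : (σ ^ (-a)) ^ 2 = σ ^ (-(2 * a)) := by
    rw [← Real.rpow_natCast, ← Real.rpow_mul hσ.le]; congr 1; push_cast; ring
  have hq1 : σ ^ (-a) ≤ 1 / 2 := h2.trans (min_le_left _ _)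
  have hq0 : 0 < σ ^ (-a) := by positivity
  refine ⟨σ, σ ^ (-a), h1, hq0, hq1, ?_, ?_, ?_, ?_⟩
  · nlinarith [h2.trans (min_le_right _ _)]
  · rwa [hq, ← Real.rpow_add_one hσ.ne', neg_add_eq_sub]
  · rw [← Real.rpow_add hσ]
    exact Real.rpow_lt_one_of_one_lt_of_neg h1 (by linarith)
  · rw [hq]
    exact Real.rpow_le_rpow_of_exponent_le h1.le (by linarith)

end Limit

section Iteration

open Filter Topology

variable {d k : ℕ}

/-- The estimates carried along the iteration: amplitude `δ`, frequency `μ`. -/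
structure Approx (A : (Fin d → ℝ) → Fin d → Fin d → ℝ) (P : Fin d → Fin d → ℝ) (τ t b δ μ : ℝ)
    (v : (Fin d → ℝ) → Fin k → ℝ) (w : (Fin d → ℝ) → Fin d → ℝ) : Prop where
  contDiff_v : ContDiff ℝ 3 v
  contDiff_w : ContDiff ℝ 2 w
  grad : ∀ x, ‖fderiv ℝ v x‖ ≤ b
  second : ∀ x, ‖iteratedFDeriv ℝ 2 v x‖ ≤ t * δ * μ
  third : ∀ x, ‖iteratedFDeriv ℝ 3 v x‖ ≤ t ^ 2 * δ * μ ^ 2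
  near : ∀ x p q, |deficit A v w x p q - δ ^ 2 * P p q| ≤ τ * δ ^ 2
  lip : ∀ x y p q, |strain v w x p q - strain v w y p q| ≤ t ^ 2 * δ ^ 2 / 2 * μ * ‖x - y‖

lemma norm_iteratedFDeriv_le_of_sub {E : Type*} [NormedAddCommGroup E] [NormedSpace ℝ E] {j : ℕ}
    {n : WithTop ℕ∞} (hj : j ≤ n) {f g : (Fin d → ℝ) → E} (hf : ContDiff ℝ n f)
    (hg : ContDiff ℝ n g) {x : Fin d → ℝ} {X Y : ℝ} (h1 : ‖iteratedFDeriv ℝ j f x‖ ≤ X)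
    (h2 : ‖iteratedFDeriv ℝ j (fun y => g y - f y) x‖ ≤ Y) : ‖iteratedFDeriv ℝ j g x‖ ≤ X + Y := by
  have h3 : g = f + fun y => g y - f y := by ext y; simp
  rw [h3, iteratedFDeriv_add_apply (hf.of_le hj).contDiffAt ((hg.sub hf).of_le hj).contDiffAt]
  exact (norm_add_le _ _).trans (add_le_add h1 h2)

lemma strain_sub_le_of_deficit {A : (Fin d → ℝ) → Fin d → Fin d → ℝ}
    {v : (Fin d → ℝ) → Fin k → ℝ} {w : (Fin d → ℝ) → Fin d → ℝ} (x y : Fin d → ℝ) (p q : Fin d) :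
    |deficit A v w x p q - deficit A v w y p q|
      ≤ |A x p q - A y p q| + |strain v w x p q - strain v w y p q| := by
  have h : deficit A v w x p q - deficit A v w y p q
      = (A x p q - A y p q) - (strain v w x p q - strain v w y p q) := by
    simp only [deficit, strain]; ring
  rw [h]
  exact abs_sub _ _

variable {ι : Type*} [Fintype ι] {η : ι → Fin d → ℝ} {e : ι × Bool → Fin k}

lemma exists_approx_succ (he : Function.Injective e) {R : (Fin d → Fin d → ℝ) →L[ℝ] (ι → ℝ)}
    (hR : ∀ S : Fin d → Fin d → ℝ, (∀ i j, S i j = S j i) → ∀ p q,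
      ∑ i, R S i * (η i p * η i q) = S p q) :
    ∃ τ C c M : ℝ, 0 < τ ∧ 0 ≤ C ∧ 0 < c ∧ 1 ≤ M ∧ ∀ (A : (Fin d → ℝ) → Fin d → Fin d → ℝ)
      (v : (Fin d → ℝ) → Fin k → ℝ) (w : (Fin d → ℝ) → Fin d → ℝ) (δ μ q σ b K β : ℝ),
      (∀ p q, Continuous fun x => A x p q) → (∀ x p q, A x p q = A x q p) → 0 ≤ β →
      (∀ x y, ‖x - y‖ ≤ 1 → ∀ p q, |A x p q - A y p q| ≤ K * ‖x - y‖ ^ β) → 0 ≤ K →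
      0 < δ → δ ≤ 1 → 1 ≤ μ → 0 < q → q ≤ 1 / 2 → q ^ 2 ≤ τ → 1 < σ → M ≤ q ^ 2 * σ →
      K * μ ^ (-β) ≤ (c * q) ^ 2 * δ ^ 2 / 2 →
      Approx A (refMat η) τ (c * q) (b - 2 * C * δ) δ μ v w →
      ∃ (v' : (Fin d → ℝ) → Fin k → ℝ) (w' : (Fin d → ℝ) → Fin d → ℝ),
        Approx A (refMat η) τ (c * q) (b - 2 * C * (q * δ)) (q * δ) (σ * μ) v' w' ∧
        (∀ j ≤ 2, ∀ x, ‖iteratedFDeriv ℝ j (fun y => v' y - v y) x‖ ≤ C * (δ / μ) * μ ^ j) ∧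
        (∀ j ≤ 2, ∀ x, ‖iteratedFDeriv ℝ j (fun y => w' y - w y) x‖
          ≤ C * (1 + b) * (δ / μ) * μ ^ j) := by
  obtain ⟨τ, C, hτ, hτ1, hC, H⟩ := exists_stage he hR
  set c := τ / (1 + C) with hc
  have hc0 : 0 < c := by positivity
  have hcτ : c ≤ τ := div_le_self hτ.le (by linarith)
  have hc2 : C * c ^ 2 ≤ τ := by
    have h1 : C * c ≤ τ := by
      rw [hc, mul_div_assoc', div_le_iff₀ (by positivity)]
      nlinarith
    calc C * c ^ 2 = (C * c) * c := by ring
      _ ≤ τ * 1 := by gcongr; exact hcτ.trans hτ1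
      _ = τ := mul_one _
  have hM1 : 0 ≤ C / c := by positivity
  have hM2 : 0 ≤ C / c ^ 2 := by positivity
  refine ⟨τ, C, c, 1 + 2 * C + C / c + C / c ^ 2, hτ, hC, hc0, by linarith, ?_⟩
  intro A v w δ μ q σ b K β hA hAs hβ hAh hK hδ hδ1 hμ hq hq1 hqτ hσ hM hKμ h
  have hμ0 : 0 < μ := by linarith
  have hCδ : 0 ≤ C * δ := by positivity
  have hb0 : 0 ≤ b - 2 * C * δ := (norm_nonneg _).trans (h.grad 0)
  obtain ⟨v', w', hv', hw', hdv, hdw, hD, hL⟩ := H A v w δ (q * δ) μ (c * q) b hA hAs h.contDiff_v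
    h.contDiff_w hδ hδ1 (by rw [mul_pow]; gcongr) hμ0 (by positivity)
    (by nlinarith) (fun x => (h.grad x).trans (by linarith)) h.second h.third h.near (by
      intro x y hxy p r
      have h1 : ‖x - y‖ ≤ μ⁻¹ := by
        rw [dist_eq_norm] at hxy
        rwa [← one_div, le_div_iff₀ hμ0, mul_comm]
      refine (strain_sub_le_of_deficit x y p r).trans ?_
      have h2 := hAh x y (h1.trans (inv_le_one_of_one_le₀ hμ)) p r
      have h3 : ‖x - y‖ ^ β ≤ μ ^ (-β) := by
        rw [Real.rpow_neg hμ0.le, ← Real.inv_rpow hμ0.le]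
        exact Real.rpow_le_rpow (norm_nonneg _) h1 hβ
      have h4 : (c * q) ^ 2 * δ ^ 2 / 2 * μ * ‖x - y‖ ≤ (c * q) ^ 2 * δ ^ 2 / 2 := by
        rw [mul_assoc]
        refine mul_le_of_le_one_right (by positivity) ?_
        rw [dist_eq_norm] at hxy
        exact hxy
      have h5 := h.lip x y p r
      have h6 := mul_le_mul_of_nonneg_left h3 hK
      linarith)
  have hq2 : q ^ 2 ≤ 1 := by nlinarith
  have hZ : 1 ≤ q ^ 2 * σ := by linarith
  refine ⟨v', w', ⟨hv', hw', fun x => ?_, fun x => ?_, fun x => ?_, fun x p r => ?_,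
    fun x y p r => ?_⟩, fun j hj => hdv j (hj.trans (by norm_num)), hdw⟩
  · have h1 := norm_iteratedFDeriv_le_of_sub (j := 1) (X := b - 2 * C * δ) (by norm_num) h.contDiff_v hv'
      (by rw [norm_iteratedFDeriv_one]; exact h.grad x) (hdv 1 (by norm_num) x)
    rw [norm_iteratedFDeriv_one] at h1
    refine h1.trans ?_
    have : C * (δ / μ) * μ ^ 1 = C * δ := by field_simp
    rw [this]
    nlinarith
  · refine (norm_iteratedFDeriv_le_of_sub (j := 2) (by norm_num) h.contDiff_v hv' (h.second x)
      (hdv 2 (by norm_num) x)).trans ?_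
    have h1 : C * (δ / μ) * μ ^ 2 = (C / c) * (c * δ * μ) := by field_simp
    have h2 : c * q * (q * δ) * (σ * μ) = (q ^ 2 * σ) * (c * δ * μ) := by ring
    have h3 : c * q * δ * μ ≤ 1 * (c * δ * μ) := by
      have : 0 ≤ c * δ * μ := by positivity
      nlinarith
    rw [h1, h2]
    refine (add_le_add_left h3 _).trans ?_
    rw [← add_mul]
    gcongr
    linarith
  · refine (norm_iteratedFDeriv_le_of_sub (j := 3) (by norm_num) h.contDiff_v hv' (h.third x)
      (hdv 3 (by norm_num) x)).trans ?_
    have h1 : C * (δ / μ) * μ ^ 3 = (C / c ^ 2) * (c ^ 2 * δ * μ ^ 2) := by field_simp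
    have h2 : (c * q) ^ 2 * (q * δ) * (σ * μ) ^ 2 = (q ^ 3 * σ ^ 2) * (c ^ 2 * δ * μ ^ 2) := by ring
    have h3 : (c * q) ^ 2 * δ * μ ^ 2 ≤ 1 * (c ^ 2 * δ * μ ^ 2) := by
      have : 0 ≤ c ^ 2 * δ * μ ^ 2 := by positivity
      nlinarith
    have h4 : q ^ 2 * σ ≤ q ^ 3 * σ ^ 2 := by
      have h5 : q ^ 2 * σ ≤ (q ^ 2 * σ) * (q ^ 2 * σ) := by nlinarith
      have h6 : (q ^ 2 * σ) * (q ^ 2 * σ) = q * (q ^ 3 * σ ^ 2) := by ring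
      have h7 : 0 ≤ q ^ 3 * σ ^ 2 := by positivity
      nlinarith
    rw [h1, h2]
    refine (add_le_add_left h3 _).trans ?_
    rw [← add_mul]
    gcongr
    linarith
  · refine (hD x p r).trans ?_
    calc C * (c * q) ^ 2 * δ ^ 2 = C * c ^ 2 * (q * δ) ^ 2 := by ring
      _ ≤ _ := by gcongr
  · refine (hL x y p r).trans ((add_le_add_left (h.lip x y p r) _).trans ?_)
    have h1 : (c * q) ^ 2 * δ ^ 2 / 2 * μ * ‖x - y‖ + C * (c * q) ^ 2 * δ ^ 2 * μ * ‖x - y‖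
        = (1 + 2 * C) * ((c * q) ^ 2 * δ ^ 2 / 2 * μ * ‖x - y‖) := by ring
    have h2 : (c * q) ^ 2 * (q * δ) ^ 2 / 2 * (σ * μ) * ‖x - y‖
        = (q ^ 2 * σ) * ((c * q) ^ 2 * δ ^ 2 / 2 * μ * ‖x - y‖) := by ring
    rw [h1, h2]
    gcongr
    linarith

end Iteration

section IterationLimit

open Filter Topology

variable {d k : ℕ}

lemma exists_isC1Holder_limit_of_geometric {E : Type*} [NormedAddCommGroup E] [NormedSpace ℝ E]
    [CompleteSpace E] {α : ℝ} (hα : 0 ≤ α) (hα1 : α ≤ 1) {f : ℕ → (Fin d → ℝ) → E}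
    (hf0 : IsC1Holder α (f 0)) (hf : ∀ n, ContDiff ℝ 2 (f n)) {M δ μ q σ : ℝ} (hM : 0 ≤ M)
    (hδ : 0 ≤ δ) (hμ : 0 < μ) (hq : 0 < q) (hq1 : q ≤ 1 / 2) (hσ : 1 < σ) (hqσ : q * σ ^ α < 1)
    (hinc : ∀ n, ∀ j ≤ 2, ∀ x, ‖iteratedFDeriv ℝ j (fun y => f (n + 1) y - f n y) x‖
      ≤ M * (q ^ n * δ / (σ ^ n * μ)) * (σ ^ n * μ) ^ j) :
    ∃ F : (Fin d → ℝ) → E, IsC1Holder α F ∧ (∀ x, ‖F x - f 0 x‖ ≤ 2 * M * δ / μ) ∧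
      ∀ x, Tendsto (fun n => fderiv ℝ (f n) x) atTop (𝓝 (fderiv ℝ F x)) := by
  have hσ0 : 0 < σ := by linarith
  have hb : ∀ n x, ‖fderiv ℝ (fun y => f (n + 1) y - f n y) x‖ ≤ M * δ * q ^ n := by
    intro n x
    have := hinc n 1 (by norm_num) x
    rw [norm_iteratedFDeriv_one] at this
    refine this.trans_eq ?_
    field_simp
  have hh : ∀ n x y, dist (fderiv ℝ (fun y => f (n + 1) y - f n y) x)
      (fderiv ℝ (fun y => f (n + 1) y - f n y) y)
      ≤ 2 * M * δ * μ ^ α * (q * σ ^ α) ^ n * dist x y ^ α := by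
    intro n x y
    refine (dist_fderiv_le_rpow ((hf (n + 1)).sub (hf n)) (X := M * δ * q ^ n) (l := σ ^ n * μ)
      (by positivity) (by positivity) hα hα1 (hb n) (fun x => ?_) x y).trans_eq ?_
    · refine (hinc n 2 le_rfl x).trans_eq ?_
      field_simp
    · rw [Real.mul_rpow (by positivity) hμ.le, ← Real.rpow_pow_comm hσ0.le, mul_pow]
      ring
  obtain ⟨F, hF, hF0, hF1⟩ := exists_isC1Holder_limit hα hf0 (fun n => (hf n).of_le (by norm_num))
    (a := fun n => M * δ / μ * (1 / 2) ^ n) (b := fun n => M * δ * q ^ n)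
    (h := fun n => 2 * M * δ * μ ^ α * (q * σ ^ α) ^ n)
    (summable_geometric_two.mul_left _)
    ((summable_geometric_of_lt_one hq.le (by linarith)).mul_left _)
    ((summable_geometric_of_lt_one (by positivity) hqσ).mul_left _) (fun n => by positivity)
    (fun n x => by
      have := hinc n 0 (by norm_num) x
      rw [norm_iteratedFDeriv_zero] at this
      refine this.trans ?_
      have h1 : M * (q ^ n * δ / (σ ^ n * μ)) * (σ ^ n * μ) ^ 0 = M * δ / μ * (q / σ) ^ n := by
        rw [div_pow]; field_simp
      have h2 : q / σ ≤ 1 / 2 := (div_le_self hq.le hσ.le).trans hq1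
      rw [h1]
      gcongr) hb hh
  refine ⟨F, hF, fun x => (hF0 x).trans_eq ?_, hF1⟩
  rw [tsum_mul_left, tsum_geometric_two]
  ring

variable {ι : Type*} [Fintype ι] {η : ι → Fin d → ℝ} {e : ι × Bool → Fin k}

lemma exists_exact_of_near (he : Function.Injective e) {R : (Fin d → Fin d → ℝ) →L[ℝ] (ι → ℝ)}
    (hR : ∀ S : Fin d → Fin d → ℝ, (∀ i j, S i j = S j i) → ∀ p q,
      ∑ i, R S i * (η i p * η i q) = S p q) {α β : ℝ} (hα : 0 < α) (hα1 : α < β / 2)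
    (hβ1 : β ≤ 1) :
    ∃ τ : ℝ, 0 < τ ∧ ∀ (A : (Fin d → ℝ) → Fin d → Fin d → ℝ)
      (v₀ : (Fin d → ℝ) → Fin k → ℝ) (w₀ : (Fin d → ℝ) → Fin d → ℝ) (δ K B ε : ℝ),
      (∀ p q, Continuous fun x => A x p q) → (∀ x p q, A x p q = A x q p) → 0 ≤ K →
      (∀ x y, ‖x - y‖ ≤ 1 → ∀ p q, |A x p q - A y p q| ≤ K * ‖x - y‖ ^ β) →
      ContDiff ℝ 3 v₀ → ContDiff ℝ 2 w₀ → IsC1Holder α v₀ → IsC1Holder α w₀ →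
      (∀ x, ‖fderiv ℝ v₀ x‖ ≤ B) → (∀ x, ‖iteratedFDeriv ℝ 2 v₀ x‖ ≤ B) →
      (∀ x, ‖iteratedFDeriv ℝ 3 v₀ x‖ ≤ B) →
      (∀ x y p q, |strain v₀ w₀ x p q - strain v₀ w₀ y p q| ≤ B * ‖x - y‖) →
      0 < δ → δ ≤ 1 → 0 < ε →
      (∀ x p q, |deficit A v₀ w₀ x p q - δ ^ 2 * refMat η p q| ≤ τ * δ ^ 2) →
      ∃ (v : (Fin d → ℝ) → Fin k → ℝ) (w : (Fin d → ℝ) → Fin d → ℝ),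
        IsC1Holder α v ∧ IsC1Holder α w ∧ (∀ x, ‖v x - v₀ x‖ ≤ ε) ∧ (∀ x, ‖w x - w₀ x‖ ≤ ε) ∧
        ∀ x p q, deficit A v w x p q = 0 := by
  obtain ⟨τ, C, c, M, hτ, hC, hc, hM, H⟩ := exists_approx_succ he hR
  refine ⟨τ, hτ, ?_⟩
  intro A v₀ w₀ δ K B ε hA hAs hK hAh hv₀ hw₀ hv₀' hw₀' hB1 hB2 hB3 hBL hδ hδ1 hε hD
  obtain ⟨σ, q, hσ, hq, hq1, hqτ, hMq, hqα, hσβ⟩ := exists_ratio hα hα1 hβ1 hτ M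
  have hσ0 : 0 < σ := by linarith
  have hB0 : 0 ≤ B := (norm_nonneg _).trans (hB1 0)
  set b := B + 2 * C * δ with hb
  have hb0 : 0 ≤ b := by positivity
  have hlin : ∀ (s Y : ℝ), 0 < s → ∀ᶠ μ : ℝ in atTop, Y ≤ s * μ := fun s Y hs =>
    (tendsto_id.const_mul_atTop hs).eventually_ge_atTop Y
  have hlim : Tendsto (fun μ : ℝ => K * μ ^ (-β)) atTop (𝓝 0) := by
    simpa using (tendsto_rpow_neg_atTop (show 0 < β by linarith)).const_mul K
  obtain ⟨μ, ⟨hμ1, hm1⟩, ⟨hm2, hm3⟩, hm4, hm5⟩ := (((eventually_ge_atTop 1).and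
    (hlin (c * q * δ) B (by positivity))).and (((hlin ((c * q) ^ 2 * δ) B (by positivity)).and
    (hlin ((c * q) ^ 2 * δ ^ 2 / 2) B (by positivity))).and
    ((hlin ε (2 * (C * (1 + b)) * δ) hε).and (hlim.eventually_le_const
      (show 0 < (c * q) ^ 2 * δ ^ 2 / 2 by positivity))))).exists
  have hμ0 : 0 < μ := by linarith
  have hstep : ∀ (n : ℕ) (v : (Fin d → ℝ) → Fin k → ℝ) (w : (Fin d → ℝ) → Fin d → ℝ),
      Approx A (refMat η) τ (c * q) (b - 2 * C * (q ^ n * δ)) (q ^ n * δ) (σ ^ n * μ) v w →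
      ∃ (v' : (Fin d → ℝ) → Fin k → ℝ) (w' : (Fin d → ℝ) → Fin d → ℝ),
        Approx A (refMat η) τ (c * q) (b - 2 * C * (q ^ (n + 1) * δ)) (q ^ (n + 1) * δ)
          (σ ^ (n + 1) * μ) v' w' ∧
        (∀ j ≤ 2, ∀ x, ‖iteratedFDeriv ℝ j (fun y => v' y - v y) x‖
          ≤ C * (q ^ n * δ / (σ ^ n * μ)) * (σ ^ n * μ) ^ j) ∧
        (∀ j ≤ 2, ∀ x, ‖iteratedFDeriv ℝ j (fun y => w' y - w y) x‖
          ≤ C * (1 + b) * (q ^ n * δ / (σ ^ n * μ)) * (σ ^ n * μ) ^ j) := by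
    intro n v w h
    have h1 : K * (σ ^ n * μ) ^ (-β) ≤ (c * q) ^ 2 * (q ^ n * δ) ^ 2 / 2 := by
      rw [Real.mul_rpow (by positivity) hμ0.le, ← Real.rpow_pow_comm hσ0.le]
      calc K * ((σ ^ (-β)) ^ n * μ ^ (-β)) = (σ ^ (-β)) ^ n * (K * μ ^ (-β)) := by ring
        _ ≤ (q ^ 2) ^ n * ((c * q) ^ 2 * δ ^ 2 / 2) := by gcongr
        _ = _ := by ring
    have h2 := H A v w (q ^ n * δ) (σ ^ n * μ) q σ b K β hA hAs (by linarith) hAh hK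
      (by positivity) (mul_le_one₀ (pow_le_one₀ hq.le (by linarith)) hδ.le hδ1)
      (one_le_mul_of_one_le_of_one_le (one_le_pow₀ hσ.le) hμ1) hq hq1 hqτ hσ hMq h1 h
    rw [pow_succ', pow_succ', mul_assoc q, mul_assoc σ]
    exact h2
  choose! nv nw hnext hnv hnw using hstep
  let u : ℕ → ((Fin d → ℝ) → Fin k → ℝ) × ((Fin d → ℝ) → Fin d → ℝ) := fun n =>
    Nat.rec (v₀, w₀) (fun n p => (nv n p.1 p.2, nw n p.1 p.2)) n
  have hu : ∀ n, Approx A (refMat η) τ (c * q) (b - 2 * C * (q ^ n * δ)) (q ^ n * δ) (σ ^ n * μ)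
      (u n).1 (u n).2 := by
    intro n
    induction n with
    | zero =>
      simp only [pow_zero, one_mul]
      refine ⟨hv₀, hw₀, fun x => (hB1 x).trans_eq (by rw [hb]; ring), fun x => (hB2 x).trans hm1,
        fun x => ((hB3 x).trans hm2).trans ?_, hD, fun x y p r => (hBL x y p r).trans ?_⟩
      · gcongr
        nlinarith
      · gcongr
    | succ n ih => exact hnext n _ _ ih
  obtain ⟨v, hv, hv0, hvt⟩ := exists_isC1Holder_limit_of_geometric (f := fun n => (u n).1) hα.le
    (by linarith) hv₀' (fun n => (hu n).contDiff_v.of_le (by norm_num)) hC hδ.le hμ0 hq hq1 hσ hqα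
    (fun n j hj x => hnv n _ _ (hu n) j hj x)
  obtain ⟨w, hw, hw0, hwt⟩ := exists_isC1Holder_limit_of_geometric (f := fun n => (u n).2) hα.le
    (by linarith) hw₀' (fun n => (hu n).contDiff_w) (M := C * (1 + b)) (by positivity) hδ.le hμ0 hq
    hq1 hσ hqα (fun n j hj x => hnw n _ _ (hu n) j hj x)
  refine ⟨v, w, hv, hw, fun x => (hv0 x).trans ?_, fun x => (hw0 x).trans ?_, fun x p r => ?_⟩
  · rw [div_le_iff₀ hμ0]
    refine le_trans ?_ hm4
    have : C ≤ C * (1 + b) := le_mul_of_one_le_right hC (by linarith)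
    gcongr
  · rwa [div_le_iff₀ hμ0]
  · have h1 := tendsto_deficit (A := A) (x := x) (v := fun n => (u n).1) (w := fun n => (u n).2)
      (fun n => (hu n).contDiff_v.differentiable (by simp) x)
      (fun n => (hu n).contDiff_w.differentiable (by simp) x)
      (hv.1.differentiable (by simp) x) (hw.1.differentiable (by simp) x) (hvt x) (hwt x) p r
    have hq0 : Tendsto (fun n : ℕ => (q ^ n * δ) ^ 2) atTop (𝓝 0) := by
      have := (((tendsto_pow_atTop_nhds_zero_of_lt_one hq.le (by linarith)).mul_const δ).pow 2)
      simpa using this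
    have h2 : Tendsto (fun n => deficit A (u n).1 (u n).2 x p r - (q ^ n * δ) ^ 2 * refMat η p r)
        atTop (𝓝 0) := by
      refine squeeze_zero_norm (fun n => (hu n).near x p r) ?_
      simpa using hq0.const_mul τ
    have h3 := h2.add (hq0.mul_const (refMat η p r))
    simp only [sub_add_cancel, zero_mul, add_zero] at h3
    exact tendsto_nhds_unique h1 h3

end IterationLimit

section Smoothing

open Filter Topology
open scoped ContDiff

variable {d k : ℕ}

lemma exists_cutoff {K : Set (Fin d → ℝ)} (hK : IsCompact K) :
    ∃ χ : (Fin d → ℝ) → ℝ, ContDiff ℝ ∞ χ ∧ HasCompactSupport χ ∧ ∀ x ∈ K, χ =ᶠ[𝓝 x] 1 := by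
  obtain ⟨r, hr0, hr⟩ := hK.isBounded.subset_ball_lt 0 0
  let f : ContDiffBump (0 : Fin d → ℝ) := ⟨r, r + 1, hr0, by linarith⟩
  refine ⟨f, f.contDiff, f.hasCompactSupport, fun x hx => ?_⟩
  exact f.eventuallyEq_one_of_mem_ball (hr hx)

lemma exists_contDiff_fderiv_near {F : Type} [NormedAddCommGroup F] [NormedSpace ℝ F]
    [CompleteSpace F] {f : (Fin d → ℝ) → F} (hf : ContDiff ℝ 1 f) {K : Set (Fin d → ℝ)}
    (hK : IsCompact K) {ε : ℝ} (hε : 0 < ε) :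
    ∃ g : (Fin d → ℝ) → F, ContDiff ℝ ∞ g ∧ (∀ x ∈ K, ‖g x - f x‖ ≤ ε) ∧
      ∀ x ∈ K, ‖fderiv ℝ g x - fderiv ℝ f x‖ ≤ ε := by
  obtain ⟨χ, hχ, hχc, hχ1⟩ := exists_cutoff hK
  set h : (Fin d → ℝ) → F := fun x => χ x • f x with hh
  have hhC : ContDiff ℝ 1 h := (hχ.of_le (by exact_mod_cast le_top)).smul hf
  have hhc : HasCompactSupport h := hχc.smul_right
  have heq : ∀ x ∈ K, h =ᶠ[𝓝 x] f := fun x hx => by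
    filter_upwards [hχ1 x hx] with y hy
    simp [hh, hy]
  have hu1 := hhc.uniformContinuous_of_continuous hhC.continuous
  have hu2 := (hhc.fderiv ℝ).uniformContinuous_of_continuous
    (hhC.continuous_fderiv (by simp))
  obtain ⟨r1, hr1, h1⟩ := Metric.uniformContinuous_iff.1 hu1 ε hε
  obtain ⟨r2, hr2, h2⟩ := Metric.uniformContinuous_iff.1 hu2 ε hε
  have hr : 0 < min r1 r2 := lt_min hr1 hr2
  let φ : ContDiffBump (0 : Fin d → ℝ) := ⟨min r1 r2 / 2, min r1 r2, by positivity, by linarith⟩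
  have hφ : ContDiff ℝ ∞ (φ.normed volume) := φ.contDiff_normed
  refine ⟨convolution (φ.normed volume) h (ContinuousLinearMap.lsmul ℝ ℝ) volume, ?_,
    fun x hx => ?_, fun x hx => ?_⟩
  · exact (φ.hasCompactSupport_normed (μ := volume)).contDiff_convolution_left _ hφ
      hhC.continuous.locallyIntegrable
  · rw [← (heq x hx).eq_of_nhds, ← dist_eq_norm]
    exact φ.dist_normed_convolution_le hhC.continuous.aestronglyMeasurable fun y hy =>
      (h1 (lt_of_lt_of_le hy (min_le_left _ _))).le
  · rw [← (heq x hx).fderiv_eq, ← dist_eq_norm,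
      fderiv_convolution_lsmul hφ.continuous hhC hhc]
    exact φ.dist_normed_convolution_le
      (hhC.continuous_fderiv (by simp)).aestronglyMeasurable fun y hy =>
      (h2 (lt_of_lt_of_le hy (min_le_right _ _))).le

lemma abs_pd_le {v : (Fin d → ℝ) → Fin k → ℝ} {x : Fin d → ℝ} (hv : DifferentiableAt ℝ v x)
    (i : Fin d) (l : Fin k) : |pd i (fun y => v y l) x| ≤ ‖fderiv ℝ v x‖ := by
  rw [pd_eval hv, ← Real.norm_eq_abs]
  refine (norm_le_pi_norm _ l).trans ((ContinuousLinearMap.le_opNorm _ _).trans ?_)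
  exact mul_le_of_le_one_right (norm_nonneg _) (by rw [Pi.norm_single]; simp)

lemma abs_strain_sub_le {v v' : (Fin d → ℝ) → Fin k → ℝ} {w w' : (Fin d → ℝ) → Fin d → ℝ}
    {x : Fin d → ℝ} (hv : DifferentiableAt ℝ v x) (hv' : DifferentiableAt ℝ v' x)
    (hw : DifferentiableAt ℝ w x) (hw' : DifferentiableAt ℝ w' x) {M κ : ℝ}
    (hM : ‖fderiv ℝ v x‖ ≤ M) (hκ1 : κ ≤ 1) (h1 : ‖fderiv ℝ v' x - fderiv ℝ v x‖ ≤ κ)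
    (h2 : ‖fderiv ℝ w' x - fderiv ℝ w x‖ ≤ κ) (p q : Fin d) :
    |strain v' w' x p q - strain v w x p q| ≤ (k * (2 * M + 1) + 1) * κ := by
  have hκ : 0 ≤ κ := (norm_nonneg _).trans h1
  have hM0 : 0 ≤ M := (norm_nonneg _).trans hM
  have e1 : ∀ i l, |pd i (fun y => v' y l) x - pd i (fun y => v y l) x| ≤ κ := fun i l => by
    have h3 := abs_pd_le (hv'.sub hv) i l
    rw [fderiv_sub hv' hv] at h3
    have h4 : pd i (fun y => (v' - v) y l) x = pd i (fun y => v' y l) x - pd i (fun y => v y l) x := by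
      rw [pd_eval (hv'.sub hv), pd_eval hv', pd_eval hv, fderiv_sub hv' hv]
      rfl
    rw [← h4]
    exact h3.trans h1
  have e2 : ∀ i l, |pd i (fun y => w' y l) x - pd i (fun y => w y l) x| ≤ κ := fun i l => by
    have h3 := abs_pd_le (hw'.sub hw) i l
    rw [fderiv_sub hw' hw] at h3
    have h4 : pd i (fun y => (w' - w) y l) x = pd i (fun y => w' y l) x - pd i (fun y => w y l) x := by
      rw [pd_eval (hw'.sub hw), pd_eval hw', pd_eval hw, fderiv_sub hw' hw]
      rfl
    rw [← h4]
    exact h3.trans h2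
  have e3 : ∀ i l, |pd i (fun y => v y l) x| ≤ M := fun i l => (abs_pd_le hv i l).trans hM
  have e4 : |gradTgrad v' x p q - gradTgrad v x p q| ≤ k * ((2 * M + 1) * κ) := by
    rw [gradTgrad, gradTgrad, ← Finset.sum_sub_distrib]
    refine (Finset.abs_sum_le_sum_abs _ _).trans ((Finset.sum_le_card_nsmul _ _ _ fun l _ => ?_).trans
      (by simp : Finset.univ.card • ((2 * M + 1) * κ) ≤ (k : ℝ) * ((2 * M + 1) * κ)))
    generalize hX : pd p (fun y => v y l) x = X
    generalize hX' : pd p (fun y => v' y l) x = X'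
    generalize hY : pd q (fun y => v y l) x = Y
    generalize hY' : pd q (fun y => v' y l) x = Y'
    have a1 : |X' - X| ≤ κ := by rw [← hX, ← hX']; exact e1 p l
    have a2 : |Y' - Y| ≤ κ := by rw [← hY, ← hY']; exact e1 q l
    have a3 : |X| ≤ M := by rw [← hX]; exact e3 p l
    have a4 : |Y| ≤ M := by rw [← hY]; exact e3 q l
    calc |X' * Y' - X * Y| = |((X' - X) * (Y' - Y) + (X' - X) * Y) + X * (Y' - Y)| := by
          congr 1; ring
      _ ≤ |X' - X| * |Y' - Y| + |X' - X| * |Y| + |X| * |Y' - Y| := by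
          refine (abs_add_le _ _).trans (add_le_add ((abs_add_le _ _).trans ?_) ?_) <;>
            simp [abs_mul]
      _ ≤ κ * 1 + κ * M + M * κ := by
          gcongr
          exact a2.trans hκ1
      _ = _ := by ring
  have h5 := e2 p q
  have h6 := e2 q p
  rw [abs_le] at e4 h5 h6 ⊢
  have h7 : 0 ≤ (k : ℝ) * ((2 * M + 1) * κ) := by positivity
  simp only [strain, symGrad]
  constructor <;> nlinarith

end Smoothing

section RankOne

open Filter Topology
open scoped ContDiff Manifold

variable {d k : ℕ}

lemma exists_sum_rank_one {S : Fin d → Fin d → ℝ} (hS : ∀ i j, S i j = S j i)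
    (hpos : ∀ ξ : Fin d → ℝ, 0 ≤ ∑ i, ∑ j, S i j * ξ i * ξ j) :
    ∃ (m : ℕ) (ξ : Fin m → Fin d → ℝ), ∀ p q, S p q = ∑ i, ξ i p * ξ i q := by
  have h : (Matrix.of S).PosSemidef := by
    rw [Matrix.posSemidef_iff_dotProduct_mulVec]
    refine ⟨?_, fun ξ => (hpos ξ).trans_eq ?_⟩
    · ext i j
      simpa using hS j i
    · simp only [dotProduct, Matrix.mulVec, Matrix.of_apply, star_trivial, Finset.mul_sum]
      exact Finset.sum_congr rfl fun i _ => Finset.sum_congr rfl fun j _ => by ring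
  obtain ⟨m, ξ, hξ⟩ := Matrix.posSemidef_iff_eq_sum_vecMulVec.1 h
  refine ⟨m, ξ, fun p q => ?_⟩
  have := congrFun (congrFun hξ p) q
  simpa [Matrix.sum_apply, Matrix.vecMulVec_apply] using this

lemma exists_partition_approx {E : (Fin d → ℝ) → Fin d → Fin d → ℝ}
    (hE : ∀ p q, Continuous fun x => E x p q) {K : Set (Fin d → ℝ)} (hK : IsCompact K) {ε : ℝ}
    (hε : 0 < ε) :
    ∃ (t : Finset (Fin d → ℝ)) (f : t → (Fin d → ℝ) → ℝ), (∀ y ∈ t, y ∈ K) ∧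
      (∀ y, ContDiff ℝ ∞ (f y)) ∧ (∀ y x, 0 ≤ f y x) ∧
      ∀ x ∈ K, ∀ p q, |E x p q - ∑ y : t, f y x * E y.1 p q| ≤ ε := by
  let U : (Fin d → ℝ) → Set (Fin d → ℝ) := fun y => ⋂ p, ⋂ q, {x | |E x p q - E y p q| < ε}
  have hUo : ∀ y, IsOpen (U y) := fun y => isOpen_iInter_of_finite fun p =>
    isOpen_iInter_of_finite fun q =>
      isOpen_lt (((hE p q).sub continuous_const).abs) continuous_const
  have hUy : ∀ y, y ∈ U y := fun y => by simp [U, hε]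
  obtain ⟨t, htK, htc⟩ := hK.elim_nhds_subcover U fun y _ => (hUo y).mem_nhds (hUy y)
  obtain ⟨f, hf⟩ := SmoothPartitionOfUnity.exists_isSubordinate 𝓘(ℝ, Fin d → ℝ) hK.isClosed
    (fun y : t => U y) (fun y => hUo y) (fun x hx => by
      obtain ⟨y, hy, hxy⟩ := Set.mem_iUnion₂.1 (htc hx)
      exact Set.mem_iUnion.2 ⟨⟨y, hy⟩, hxy⟩)
  refine ⟨t, fun y => f y, htK, fun y => (f y).contMDiff.contDiff, fun y x => f.nonneg y x,
    fun x hx p q => ?_⟩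
  have h1 : ∑ y : t, f y x = 1 := by
    rw [← finsum_eq_sum_of_fintype]
    exact f.sum_eq_one hx
  have h2 : E x p q - ∑ y : t, f y x * E y.1 p q = ∑ y : t, f y x * (E x p q - E y.1 p q) := by
    simp only [mul_sub, Finset.sum_sub_distrib, ← Finset.sum_mul, h1, one_mul]
  rw [h2]
  calc |∑ y : t, f y x * (E x p q - E y.1 p q)| ≤ ∑ y : t, |f y x * (E x p q - E y.1 p q)| :=
        Finset.abs_sum_le_sum_abs _ _
    _ ≤ ∑ y : t, f y x * ε := Finset.sum_le_sum fun y _ => by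
        rw [abs_mul, abs_of_nonneg (f.nonneg y x)]
        by_cases h0 : f y x = 0
        · simp [h0]
        · have h3 : x ∈ U y := hf y (subset_tsupport _ h0)
          have h4 := Set.mem_iInter.1 (Set.mem_iInter.1 h3 p) q
          exact mul_le_mul_of_nonneg_left (le_of_lt h4) (f.nonneg y x)
    _ = ε := by rw [← Finset.sum_mul, h1, one_mul]

lemma exists_rank_one_approx {E : (Fin d → ℝ) → Fin d → Fin d → ℝ}
    (hE : ∀ p q, Continuous fun x => E x p q) (hsym : ∀ x p q, E x p q = E x q p)
    {K : Set (Fin d → ℝ)} (hK : IsCompact K)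
    (hpos : ∀ x ∈ K, ∀ ξ : Fin d → ℝ, 0 ≤ ∑ i, ∑ j, E x i j * ξ i * ξ j) {ε : ℝ} (hε : 0 < ε) :
    ∃ (J : Type) (_ : Fintype J) (a : J → (Fin d → ℝ) → ℝ) (ξ : J → Fin d → ℝ),
      (∀ j, ContDiff ℝ ∞ (a j)) ∧
      ∀ x ∈ K, ∀ p q, |E x p q - ∑ j, a j x ^ 2 * (ξ j p * ξ j q)| ≤ ε := by
  obtain ⟨t, f, ht, hf, hf0, hfE⟩ := exists_partition_approx hE hK (half_pos hε)
  have h1 : ∀ y : t, ∃ (m : ℕ) (ξ : Fin m → Fin d → ℝ), ∀ p q, E y p q = ∑ i, ξ i p * ξ i q :=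
    fun y => exists_sum_rank_one (hsym y) (hpos y (ht y y.2))
  choose m ξ hξ using h1
  set N : ℝ := ∑ p, ∑ q, ∑ y : t, ∑ i, |ξ y i p * ξ y i q| with hN
  have hN0 : 0 ≤ N := by positivity
  set κ : ℝ := ε / 2 / (1 + N) with hκ
  have hκ0 : 0 < κ := by positivity
  have hpos' : ∀ y x, 0 < f y x + κ := fun y x => by linarith [hf0 y x]
  refine ⟨Σ y : t, Fin (m y), inferInstance, fun j x => √(f j.1 x + κ), fun j => ξ j.1 j.2,
    fun j => ((hf j.1).add contDiff_const).sqrt fun x => (hpos' _ x).ne', fun x hx p q => ?_⟩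
  have h2 : ∑ j : Σ y : t, Fin (m y), √(f j.1 x + κ) ^ 2 * (ξ j.1 j.2 p * ξ j.1 j.2 q)
      = ∑ y : t, f y x * E y.1 p q + κ * ∑ y : t, ∑ i, ξ y i p * ξ y i q := by
    rw [Fintype.sum_sigma, Finset.mul_sum, ← Finset.sum_add_distrib]
    refine Finset.sum_congr rfl fun y _ => ?_
    simp only [Real.sq_sqrt (hpos' y x).le]
    rw [← Finset.mul_sum, hξ]
    ring
  have h3 : |∑ y : t, ∑ i, ξ y i p * ξ y i q| ≤ N := by
    refine (Finset.abs_sum_le_sum_abs _ _).trans ((Finset.sum_le_sum fun y _ =>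
      Finset.abs_sum_le_sum_abs _ _).trans ?_)
    refine le_trans ?_ (Finset.single_le_sum (f := fun p => ∑ q, ∑ y : t, ∑ i, |ξ y i p * ξ y i q|)
      (fun p _ => by positivity) (Finset.mem_univ p))
    exact Finset.single_le_sum (f := fun q => ∑ y : t, ∑ i, |ξ y i p * ξ y i q|)
      (fun q _ => by positivity) (Finset.mem_univ q)
  have h4 : κ * N ≤ ε / 2 := by
    rw [hκ, div_mul_eq_mul_div, div_le_iff₀ (by positivity)]
    nlinarith
  rw [h2, ← sub_sub]
  calc _ ≤ ε / 2 + κ * |∑ y : t, ∑ i, ξ y i p * ξ y i q| := by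
        refine (abs_sub _ _).trans (add_le_add (hfE x hx p q) ?_)
        rw [abs_mul, abs_of_pos hκ0]
    _ ≤ ε / 2 + κ * N := by gcongr
    _ ≤ ε := by linarith

end RankOne

section Primitives

open Filter Topology
open scoped ContDiff

variable {d k : ℕ}

lemma abs_trig_le_one (b : Bool) (t : ℝ) : |trig b t| ≤ 1 := by
  cases b
  · exact abs_cos_le_one t
  · exact abs_sin_le_one t

lemma exists_injective_unit_bool (hk : 2 ≤ k) : ∃ e : Unit × Bool → Fin k, Function.Injective e := by
  refine ⟨fun q => if q.2 then ⟨0, by omega⟩ else ⟨1, by omega⟩, fun p q h => ?_⟩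
  rcases p with ⟨⟨⟩, _ | _⟩ <;> rcases q with ⟨⟨⟩, _ | _⟩ <;> simp_all

lemma exists_add_primitive (hk : 2 ≤ k) {v : (Fin d → ℝ) → Fin k → ℝ}
    {w : (Fin d → ℝ) → Fin d → ℝ} (hv : ContDiff ℝ ∞ v) (hw : ContDiff ℝ ∞ w)
    {a : (Fin d → ℝ) → ℝ} (ha : ContDiff ℝ ∞ a) (ξ : Fin d → ℝ) {K : Set (Fin d → ℝ)}
    (hK : IsCompact K) {ε : ℝ} (hε : 0 < ε) :
    ∃ (v' : (Fin d → ℝ) → Fin k → ℝ) (w' : (Fin d → ℝ) → Fin d → ℝ), ContDiff ℝ ∞ v' ∧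
      ContDiff ℝ ∞ w' ∧ (∀ x ∈ K, ‖v' x - v x‖ ≤ ε) ∧ (∀ x ∈ K, ‖w' x - w x‖ ≤ ε) ∧
      ∀ x ∈ K, ∀ p q,
        |strain v' w' x p q - strain v w x p q - a x ^ 2 * (ξ p * ξ q)| ≤ ε := by
  obtain ⟨e, he⟩ := exists_injective_unit_bool hk
  have hvl : ∀ l, ContDiff ℝ ∞ fun y => v y l := contDiff_pi.1 hv
  have hpdv : ∀ i l, ContDiff ℝ ∞ (pd i fun y => v y l) := fun i l => (hvl l).pd (by simp) i
  have hpda : ∀ i, ContDiff ℝ ∞ (pd i a) := fun i => ha.pd (by simp) i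
  have hhess : ∀ l p q, Continuous fun x => hess (fun y => v y l) x p q := fun l p q =>
    ((hpdv q l).pd (m := ∞) (by simp) p).continuous
  let G : (Fin d → ℝ) → (ℝ × (Fin d → ℝ)) × ((Fin k → Fin d → ℝ) × (Fin k → Fin d → Fin d → ℝ)) :=
    fun x => ((a x, fun p => pd p a x),
      (fun l p => pd p (fun y => v y l) x, fun l p q => hess (fun y => v y l) x p q))
  have hG : Continuous G :=
    (ha.continuous.prodMk (continuous_pi fun p => (hpda p).continuous)).prodMk
      ((continuous_pi fun l => continuous_pi fun p => (hpdv p l).continuous).prodMk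
        (continuous_pi fun l => continuous_pi fun p => continuous_pi fun q => hhess l p q))
  obtain ⟨Q₀, hQ₀⟩ := hK.exists_bound_of_continuousOn hG.continuousOn
  set Q := max Q₀ 0 with hQdef
  have hQ0 : 0 ≤ Q := le_max_right _ _
  have hQ : ∀ x ∈ K, ‖G x‖ ≤ Q := fun x hx => (hQ₀ x hx).trans (le_max_left _ _)
  have ha0 : ∀ x ∈ K, |a x| ≤ Q := fun x hx =>
    ((norm_fst_le _).trans (norm_fst_le _)).trans (hQ x hx)
  have ha1 : ∀ x ∈ K, ∀ p, |pd p a x| ≤ Q := fun x hx p =>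
    ((norm_le_pi_norm (G x).1.2 p).trans ((norm_snd_le _).trans (norm_fst_le _))).trans (hQ x hx)
  have hv1 : ∀ x ∈ K, ∀ l p, |pd p (fun y => v y l) x| ≤ Q := fun x hx l p =>
    ((norm_le_pi_norm ((G x).2.1 l) p).trans ((norm_le_pi_norm (G x).2.1 l).trans
      ((norm_fst_le _).trans (norm_snd_le _)))).trans (hQ x hx)
  have hv2 : ∀ x ∈ K, ∀ l p q, |hess (fun y => v y l) x p q| ≤ Q := fun x hx l p q =>
    ((norm_le_pi_norm ((G x).2.2 l p) q).trans ((norm_le_pi_norm ((G x).2.2 l) p).trans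
      ((norm_le_pi_norm (G x).2.2 l).trans
      ((norm_snd_le _).trans (norm_snd_le _))))).trans (hQ x hx)
  set T := 1 + Q + (k + 3) * Q ^ 2 with hT
  have hT0 : 0 < T := by positivity
  set s := min 1 (ε / T) with hs
  have hs0 : 0 < s := lt_min one_pos (by positivity)
  have hs1 : s ≤ 1 := min_le_left _ _
  have hsT : s * T ≤ ε := by
    rw [← le_div_iff₀ hT0]
    exact min_le_right _ _
  have hsk : 0 ≤ s * (k * Q ^ 2) := by positivity
  have hsQ : 0 ≤ s * Q := by positivity
  have hsQ2 : 0 ≤ s * Q ^ 2 := by positivity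
  have hsum : s + s * Q + s * (k * Q ^ 2) + 3 * (s * Q ^ 2) ≤ ε := by
    refine le_trans (le_of_eq ?_) hsT
    rw [hT]; ring
  let b : Unit → (Fin d → ℝ) → ℝ := fun _ x => s * a x
  let η : Unit → Fin d → ℝ := fun _ => (√2 / s) • ξ
  have hb : ∀ i, ContDiff ℝ ∞ (b i) := fun i => contDiff_const.mul ha
  have hP : ContDiff ℝ ∞ (spiral η e b) := contDiff_spiral he hb
  have hPle : ∀ x ∈ K, ∀ l, |spiral η e b x l| ≤ s * Q := by
    intro x hx l
    by_cases hl : l ∈ Set.range e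
    · obtain ⟨q, rfl⟩ := hl
      rw [spiral_apply he, abs_mul, abs_mul, abs_of_pos hs0]
      calc _ ≤ s * Q * 1 := by gcongr; exacts [ha0 x hx, abs_trig_le_one _ _]
        _ = _ := mul_one _
    · rw [spiral_apply_of_notMem hl, abs_zero]
      exact hsQ
  refine ⟨fun y l => v y l + spiral η e b y l, correctW v (spiral η e b) w, hv.add hP, ?_,
    fun x hx => ?_, fun x hx => ?_, fun x hx p q => ?_⟩
  · refine contDiff_pi.2 fun j => ContDiff.sub (contDiff_pi.1 hw j) ?_
    exact ContDiff.sum fun l _ => (hpdv j l).mul (contDiff_pi.1 hP l)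
  · refine (pi_norm_le_iff_of_nonneg hε.le).2 fun l => ?_
    rw [Pi.sub_apply, add_sub_cancel_left, Real.norm_eq_abs]
    linarith [hPle x hx l]
  · refine (pi_norm_le_iff_of_nonneg hε.le).2 fun j => ?_
    rw [Pi.sub_apply, correctW, sub_sub_cancel_left, norm_neg]
    refine (norm_sum_le _ _).trans ((Finset.sum_le_card_nsmul _ _ (Q * (s * Q)) fun l _ => ?_).trans ?_)
    · rw [norm_mul]
      exact mul_le_mul (hv1 x hx l j) (hPle x hx l) (norm_nonneg _) hQ0
    · rw [Finset.card_univ, Fintype.card_fin, nsmul_eq_mul]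
      linarith
  · rw [strain_add_spiral he (fun i => contDiff_infty.1 (hb i) 1)
      (contDiff_infty.1 hv 2) (contDiff_infty.1 hw 1),
      add_sub_cancel_left]
    have hpd : ∀ p, pd p (fun y => s * a y) x = s * pd p a x := fun p => by
      rw [pd, fderiv_const_mul (ha.differentiable (by simp) x)]
      rfl
    have h2 : s ^ 2 * (√2 / s * (√2 / s)) = 2 := by
      rw [div_mul_div_comm, Real.mul_self_sqrt (by norm_num)]
      field_simp
    have h3 : spiralStrain η e b v x p q - a x ^ 2 * (ξ p * ξ q)
        = 1 / 2 * (s ^ 2 * (pd p a x * pd q a x)) - s * (a x * (∑ c, trig c (phase (η ()) x) *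
          hess (fun y => v y (e ((), c))) x p q)) := by
      simp only [spiralStrain, Finset.univ_unique, Finset.sum_singleton, b, hpd, η, Pi.smul_apply,
        smul_eq_mul, PUnit.default_eq_unit]
      linear_combination (1 / 2 * a x ^ 2 * ξ p * ξ q) * h2
    have h4 : |∑ c, trig c (phase (η ()) x) * hess (fun y => v y (e ((), c))) x p q| ≤ 2 * Q := by
      refine (Finset.abs_sum_le_sum_abs _ _).trans
        ((Finset.sum_le_card_nsmul _ _ Q fun c _ => ?_).trans ?_)
      · rw [abs_mul]
        calc _ ≤ 1 * Q := by
              gcongr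
              exacts [abs_trig_le_one _ _, hv2 x hx _ p q]
          _ = Q := one_mul _
      · simp
    rw [h3]
    calc _ ≤ 1 / 2 * (s ^ 2 * (|pd p a x| * |pd q a x|)) + s * (|a x| * |∑ c, trig c (phase (η ()) x)
          * hess (fun y => v y (e ((), c))) x p q|) := by
          refine (abs_sub _ _).trans_eq ?_
          simp only [abs_mul, abs_of_pos hs0, abs_of_pos (show (0 : ℝ) < 1 / 2 by norm_num), abs_pow]
      _ ≤ 1 / 2 * (s * (Q * Q)) + s * (Q * (2 * Q)) := by
          have h5 : s ^ 2 ≤ s := by nlinarith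
          gcongr
          exacts [ha1 x hx p, ha1 x hx q, ha0 x hx]
      _ ≤ ε := by nlinarith

lemma exists_add_primitives (hk : 2 ≤ k) {v : (Fin d → ℝ) → Fin k → ℝ}
    {w : (Fin d → ℝ) → Fin d → ℝ} (hv : ContDiff ℝ ∞ v) (hw : ContDiff ℝ ∞ w) {J : Type*}
    {a : J → (Fin d → ℝ) → ℝ} (ha : ∀ j, ContDiff ℝ ∞ (a j)) (ξ : J → Fin d → ℝ)
    {K : Set (Fin d → ℝ)} (hK : IsCompact K) (s : Finset J) {ε : ℝ} (hε : 0 < ε) :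
    ∃ (v' : (Fin d → ℝ) → Fin k → ℝ) (w' : (Fin d → ℝ) → Fin d → ℝ), ContDiff ℝ ∞ v' ∧
      ContDiff ℝ ∞ w' ∧ (∀ x ∈ K, ‖v' x - v x‖ ≤ ε) ∧ (∀ x ∈ K, ‖w' x - w x‖ ≤ ε) ∧
      ∀ x ∈ K, ∀ p q,
        |strain v' w' x p q - strain v w x p q - ∑ j ∈ s, a j x ^ 2 * (ξ j p * ξ j q)| ≤ ε := by
  classical
  induction s using Finset.induction_on generalizing ε with
  | empty => exact ⟨v, w, hv, hw, by simp [hε.le], by simp [hε.le], by simp [hε.le]⟩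
  | insert i s hi ih =>
    obtain ⟨v₁, w₁, hv₁, hw₁, h1, h2, h3⟩ := ih (half_pos hε)
    obtain ⟨v₂, w₂, hv₂, hw₂, h1', h2', h3'⟩ :=
      exists_add_primitive hk hv₁ hw₁ (ha i) (ξ i) hK (half_pos hε)
    refine ⟨v₂, w₂, hv₂, hw₂, fun x hx => ?_, fun x hx => ?_, fun x hx p q => ?_⟩
    · rw [← sub_add_sub_cancel _ (v₁ x)]
      exact (norm_add_le _ _).trans (by linarith [h1 x hx, h1' x hx])
    · rw [← sub_add_sub_cancel _ (w₁ x)]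
      exact (norm_add_le _ _).trans (by linarith [h2 x hx, h2' x hx])
    · rw [Finset.sum_insert hi]
      have e1 := abs_le.1 (h3 x hx p q)
      have e2 := abs_le.1 (h3' x hx p q)
      exact abs_le.2 ⟨by linarith, by linarith⟩

end Primitives

section Flexibility

open Filter Topology
open scoped ContDiff

variable {d k : ℕ}

lemma strain_congr {v v' : (Fin d → ℝ) → Fin k → ℝ} {w w' : (Fin d → ℝ) → Fin d → ℝ}
    {x : Fin d → ℝ} (hv : v' =ᶠ[𝓝 x] v) (hw : w' =ᶠ[𝓝 x] w) : strain v' w' x = strain v w x := by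
  have h1 : ∀ i l, pd i (fun y => v' y l) x = pd i (fun y => v y l) x := fun i l => by
    have h : (fun y => v' y l) =ᶠ[𝓝 x] fun y => v y l := hv.fun_comp (· l)
    rw [pd, h.fderiv_eq, pd]
  have h2 : ∀ i l, pd i (fun y => w' y l) x = pd i (fun y => w y l) x := fun i l => by
    have h : (fun y => w' y l) =ᶠ[𝓝 x] fun y => w y l := hw.fun_comp (· l)
    rw [pd, h.fderiv_eq, pd]
  ext p q
  simp only [strain, gradTgrad, symGrad, h1, h2]

lemma contDiff_strain {v : (Fin d → ℝ) → Fin k → ℝ} {w : (Fin d → ℝ) → Fin d → ℝ}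
    {m n : WithTop ℕ∞} (hv : ContDiff ℝ n v) (hw : ContDiff ℝ n w) (hmn : m + 1 ≤ n) (p q : Fin d) :
    ContDiff ℝ m fun x => strain v w x p q := by
  have h1 : ∀ i l, ContDiff ℝ m (pd i fun y => v y l) := fun i l => (contDiff_pi.1 hv l).pd hmn i
  have h2 : ∀ i l, ContDiff ℝ m (pd i fun y => w y l) := fun i l => (contDiff_pi.1 hw l).pd hmn i
  exact (contDiff_const.mul (ContDiff.sum fun l _ => (h1 p l).mul (h1 q l))).add
    (((h2 p q).add (h2 q p)).div_const 2)

lemma strain_zero (x : Fin d → ℝ) :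
    strain (0 : (Fin d → ℝ) → Fin k → ℝ) 0 x = 0 := by
  ext p q
  simp [strain, gradTgrad, symGrad, pd]

lemma exists_strain_lipschitz {v : (Fin d → ℝ) → Fin k → ℝ} {w : (Fin d → ℝ) → Fin d → ℝ}
    (hv : ContDiff ℝ ∞ v) (hw : ContDiff ℝ ∞ w) (hvc : HasCompactSupport v)
    (hwc : HasCompactSupport w) :
    ∃ B : ℝ, 0 ≤ B ∧ ∀ x y p q, |strain v w x p q - strain v w y p q| ≤ B * ‖x - y‖ := by
  have h : ∀ pq : Fin d × Fin d, ∃ C : ℝ≥0, LipschitzWith C fun x => strain v w x pq.1 pq.2 := by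
    intro pq
    refine (contDiff_strain hv hw (m := 1) (by norm_cast) pq.1
      pq.2).lipschitzWith_of_hasCompactSupport ?_ (by simp)
    refine HasCompactSupport.intro (hvc.isCompact.union hwc.isCompact) fun x hx => ?_
    rw [Set.mem_union, not_or] at hx
    rw [strain_congr (notMem_tsupport_iff_eventuallyEq.1 hx.1)
      (notMem_tsupport_iff_eventuallyEq.1 hx.2), strain_zero]
    rfl
  choose C hC using h
  refine ⟨∑ pq, (C pq : ℝ), by positivity, fun x y p q => ?_⟩
  have h1 := (hC (p, q)).dist_le_mul x y
  rw [Real.dist_eq, dist_eq_norm] at h1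
  refine h1.trans (mul_le_mul_of_nonneg_right ?_ (norm_nonneg _))
  exact Finset.single_le_sum (f := fun pq => (C pq : ℝ)) (fun i _ => (C i).2) (Finset.mem_univ (p, q))

lemma exists_bound_iteratedFDeriv {E : Type*} [NormedAddCommGroup E] [NormedSpace ℝ E]
    {g : (Fin d → ℝ) → E} (hg : ContDiff ℝ ∞ g) (hgc : HasCompactSupport g) (n : ℕ) :
    ∃ B : ℝ, ∀ x, ‖iteratedFDeriv ℝ n g x‖ ≤ B :=
  (hgc.iteratedFDeriv n).exists_bound_of_continuous
    (hg.continuous_iteratedFDeriv (by exact_mod_cast le_top))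

lemma isC1Holder_of_hasCompactSupport {E : Type*} [NormedAddCommGroup E] [NormedSpace ℝ E]
    {g : (Fin d → ℝ) → E} (hg : ContDiff ℝ ∞ g) (hgc : HasCompactSupport g) {α : ℝ} (hα : 0 ≤ α)
    (hα1 : α ≤ 1) : IsC1Holder α g := by
  obtain ⟨B₁, h1⟩ := exists_bound_iteratedFDeriv hg hgc 1
  obtain ⟨B₂, h2⟩ := exists_bound_iteratedFDeriv hg hgc 2
  have hX : 0 ≤ max B₁ B₂ := le_max_of_le_left ((norm_nonneg _).trans (h1 0))
  refine ⟨contDiff_infty.1 hg 1, isHolder_of_dist_le hα (C := 2 * max B₁ B₂ * 1 ^ α) (by positivity)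
    (dist_fderiv_le_rpow (contDiff_infty.1 hg 2) hX zero_le_one hα hα1 (fun x => ?_) fun x => ?_)⟩
  · rw [← norm_iteratedFDeriv_one]
    exact (h1 x).trans (le_max_left _ _)
  · rw [mul_one]
    exact (h2 x).trans (le_max_right _ _)

/-- A positive semidefinite deficit is realised up to an arbitrarily small error on a compact set
by smooth compactly supported fields that are uniformly close to the given ones. -/
lemma exists_smooth_strain_approx (hk : 2 ≤ k) {v : (Fin d → ℝ) → Fin k → ℝ}
    {w : (Fin d → ℝ) → Fin d → ℝ} (hv : ContDiff ℝ 1 v) (hw : ContDiff ℝ 1 w)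
    {E : (Fin d → ℝ) → Fin d → Fin d → ℝ} (hE : ∀ p q, Continuous fun x => E x p q)
    (hsym : ∀ x p q, E x p q = E x q p) {K : Set (Fin d → ℝ)} (hK : IsCompact K)
    (hpos : ∀ x ∈ K, ∀ ξ : Fin d → ℝ, 0 ≤ ∑ i, ∑ j, E x i j * ξ i * ξ j) {ε : ℝ} (hε : 0 < ε) :
    ∃ (v' : (Fin d → ℝ) → Fin k → ℝ) (w' : (Fin d → ℝ) → Fin d → ℝ), ContDiff ℝ ∞ v' ∧
      ContDiff ℝ ∞ w' ∧ HasCompactSupport v' ∧ HasCompactSupport w' ∧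
      (∀ x ∈ K, ‖v' x - v x‖ ≤ ε) ∧ (∀ x ∈ K, ‖w' x - w x‖ ≤ ε) ∧
      ∀ x ∈ K, ∀ p q, |strain v' w' x p q - strain v w x p q - E x p q| ≤ ε := by
  obtain ⟨J, _, a, ξ, ha, haE⟩ := exists_rank_one_approx hE hsym hK hpos (half_pos (half_pos hε))
  obtain ⟨M, hM⟩ := hK.exists_bound_of_continuousOn (hv.continuous_fderiv (by simp)).continuousOn
  set L : ℝ := k * (2 * |M| + 1) + 1 with hL
  have hL0 : 0 < L := by positivity
  set κ : ℝ := min 1 (min (ε / 2) (ε / 4 / L)) with hκ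
  have hκ0 : 0 < κ := by positivity
  have hκε : κ ≤ ε / 2 := (min_le_right _ _).trans (min_le_left _ _)
  have hLκ : L * κ ≤ ε / 4 := by
    rw [mul_comm, ← le_div_iff₀ hL0]
    exact (min_le_right _ _).trans (min_le_right _ _)
  obtain ⟨v₁, hv₁, hv0, hv1⟩ := exists_contDiff_fderiv_near hv hK hκ0
  obtain ⟨w₁, hw₁, hw0, hw1⟩ := exists_contDiff_fderiv_near hw hK hκ0
  obtain ⟨v₂, w₂, hv₂, hw₂, hv2, hw2, h2⟩ :=
    exists_add_primitives hk hv₁ hw₁ ha ξ hK Finset.univ (half_pos (half_pos hε))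
  obtain ⟨χ, hχ, hχc, hχ1⟩ := exists_cutoff hK
  have hveq : ∀ x ∈ K, (fun y => χ y • v₂ y) =ᶠ[𝓝 x] v₂ := fun x hx => by
    filter_upwards [hχ1 x hx] with y hy
    simp [hy]
  have hweq : ∀ x ∈ K, (fun y => χ y • w₂ y) =ᶠ[𝓝 x] w₂ := fun x hx => by
    filter_upwards [hχ1 x hx] with y hy
    simp [hy]
  refine ⟨fun y => χ y • v₂ y, fun y => χ y • w₂ y, hχ.smul hv₂, hχ.smul hw₂, hχc.smul_right,
    hχc.smul_right, fun x hx => ?_, fun x hx => ?_, fun x hx p q => ?_⟩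
  · beta_reduce
    rw [(hveq x hx).eq_of_nhds, ← sub_add_sub_cancel (v₂ x) (v₁ x)]
    exact (norm_add_le _ _).trans (by linarith [hv2 x hx, hv0 x hx])
  · beta_reduce
    rw [(hweq x hx).eq_of_nhds, ← sub_add_sub_cancel (w₂ x) (w₁ x)]
    exact (norm_add_le _ _).trans (by linarith [hw2 x hx, hw0 x hx])
  · rw [strain_congr (hveq x hx) (hweq x hx)]
    have h3 := abs_strain_sub_le (hv.differentiable (by simp) x) (hv₁.differentiable (by simp) x)
      (hw.differentiable (by simp) x) (hw₁.differentiable (by simp) x)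
      ((hM x hx).trans (le_abs_self M)) (min_le_left _ _) (hv1 x hx) (hw1 x hx) p q
    have h4 := abs_le.1 (h3.trans hLκ)
    have h5 := abs_le.1 (h2 x hx p q)
    have h6 := abs_le.1 (haE x hx p q)
    rw [abs_le]
    constructor <;> linarith [h4.1, h4.2, h5.1, h5.2, h6.1, h6.2]

lemma exists_scale_posSemidef (P : Fin d → Fin d → ℝ) {c : ℝ} (hc : 0 < c) :
    ∃ δ : ℝ, 0 < δ ∧ δ ≤ 1 ∧ ∀ ξ : Fin d → ℝ,
      δ ^ 2 * ∑ i, ∑ j, P i j * ξ i * ξ j ≤ c * ∑ i, ξ i ^ 2 := by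
  set N : ℝ := ∑ i, ∑ j, |P i j| with hN
  have hN0 : 0 ≤ N := by positivity
  refine ⟨min 1 (c / (N + 1)), by positivity, min_le_left _ _, fun ξ => ?_⟩
  set δ : ℝ := min 1 (c / (N + 1)) with hδ
  have hδ0 : 0 < δ := by positivity
  have hδc : δ * (N + 1) ≤ c := by
    rw [← le_div_iff₀ (by positivity)]
    exact min_le_right _ _
  have hξ : ∀ i, ξ i ^ 2 ≤ ∑ i, ξ i ^ 2 := fun i =>
    Finset.single_le_sum (f := fun i => ξ i ^ 2) (fun i _ => sq_nonneg _) (Finset.mem_univ i)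
  set T : ℝ := ∑ i, ξ i ^ 2 with hT
  have hT0 : 0 ≤ T := by positivity
  have h1 : ∑ i, ∑ j, P i j * ξ i * ξ j ≤ N * T := by
    rw [hN, Finset.sum_mul]
    refine Finset.sum_le_sum fun i _ => ?_
    rw [Finset.sum_mul]
    refine Finset.sum_le_sum fun j _ => ?_
    calc P i j * ξ i * ξ j ≤ |P i j * (ξ i * ξ j)| := by rw [← mul_assoc]; exact le_abs_self _
      _ = |P i j| * |ξ i * ξ j| := abs_mul _ _
      _ ≤ |P i j| * T := by
        refine mul_le_mul_of_nonneg_left (abs_le.2 ⟨?_, ?_⟩) (abs_nonneg _)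
        · nlinarith [hξ i, hξ j, sq_nonneg (ξ i + ξ j)]
        · nlinarith [hξ i, hξ j, sq_nonneg (ξ i - ξ j)]
  have h2 : δ ^ 2 ≤ δ := by nlinarith [min_le_left 1 (c / (N + 1))]
  calc _ ≤ δ ^ 2 * (N * T) := by gcongr
    _ ≤ δ * (N * T) := by gcongr
    _ ≤ δ * (N + 1) * T := by nlinarith
    _ ≤ c * T := by gcongr

/-- Clamping `A` to a band around a Lipschitz field keeps it Hölder continuous. -/
lemma abs_clamp_sub_le {A S : (Fin d → ℝ) → ℝ} {C B β r : ℝ} (hβ1 : β ≤ 1) (hB : 0 ≤ B)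
    (hA : ∀ x y, |A x - A y| ≤ C * ‖x - y‖ ^ β) (hS : ∀ x y, |S x - S y| ≤ B * ‖x - y‖)
    {x y : Fin d → ℝ} (hxy : ‖x - y‖ ≤ 1) :
    |(S x + max (-r) (min (A x - S x) r)) - (S y + max (-r) (min (A y - S y) r))|
      ≤ (C + 2 * B) * ‖x - y‖ ^ β := by
  have h1 : |max (-r) (min (A x - S x) r) - max (-r) (min (A y - S y) r)|
      ≤ |(A x - S x) - (A y - S y)| :=
    by
    rw [max_comm (-r), max_comm (-r)]
    exact (abs_max_sub_max_le_abs _ _ _).trans ((abs_min_sub_min_le_max _ _ _ _).trans (by simp))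
  have h2 : ‖x - y‖ ≤ ‖x - y‖ ^ β := by
    rcases (norm_nonneg (x - y)).eq_or_lt with h | h
    · rw [← h]
      positivity
    · simpa using Real.rpow_le_rpow_of_exponent_ge h hxy hβ1
  have h3 := (hS x y).trans (mul_le_mul_of_nonneg_left h2 hB)
  have h4 := hA x y
  have h5 : |(A x - S x) - (A y - S y)| ≤ |A x - A y| + |S x - S y| := by
    rw [sub_sub_sub_comm]
    exact abs_sub _ _
  rw [add_sub_add_comm]
  refine (abs_add_le _ _).trans ?_
  linarith

end Flexibility

/-- Theorem 1.3 (flexibility of the von Kármán system up to `C^{1,1}` for codimension `k ≥ d(d+1)`). -/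
theorem flexibility_VK_high_codimension
    {d k : ℕ} (hd : 1 ≤ d) (hk : d * (d + 1) ≤ k)
    (ω : Set (Fin d → ℝ)) (hω : IsOpen ω) (hωbd : Bornology.IsBounded ω)
    (hωne : ω.Nonempty)
    (v : (Fin d → ℝ) → Fin k → ℝ) (w : (Fin d → ℝ) → Fin d → ℝ)
    (A : (Fin d → ℝ) → Fin d → Fin d → ℝ)
    (hv : ContDiff ℝ 1 v) (hw : ContDiff ℝ 1 w)
    (β : ℝ) (hβ0 : 0 < β) (hβ1 : β ≤ 1)
    (hA : IsHolder β A) (hAsym : ∀ x i j, A x i j = A x j i)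
    (c : ℝ) (hc : 0 < c)
    (hD : ∀ x ∈ closure ω, MatGt (deficit A v w x) c)
    (ε : ℝ) (hε : 0 < ε)
    (α : ℝ) (hα0 : 0 < α)
    (hα1 : α < min (β / 2) 1) :
    ∃ (vt : (Fin d → ℝ) → Fin k → ℝ) (wt : (Fin d → ℝ) → Fin d → ℝ),
      IsC1Holder α vt ∧ IsC1Holder α wt ∧
      supNorm ω (fun x => vt x - v x) ≤ ε ∧
      supNorm ω (fun x => wt x - w x) ≤ ε ∧
      ∀ x ∈ closure ω, ∀ i j, deficit A vt wt x i j = 0 := by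
  have hα := hα1.trans_le (min_le_left _ _)
  have hαlt := hα1.trans_le (min_le_right _ _)
  have hk2 : 2 ≤ k := le_trans (by nlinarith) hk
  have hK : IsCompact (closure ω) := hωbd.isCompact_closure
  obtain ⟨R, hR⟩ := exists_primitive_decomposition d
  obtain ⟨e, he⟩ := exists_injective_pairs hk
  obtain ⟨τ, hτ, hexact⟩ := exists_exact_of_near he hR hα0 hα hβ1
  set P : Fin d → Fin d → ℝ := refMat pairVec with hP
  have hPsym : ∀ p q, P p q = P q p := fun p q => by simp only [hP, refMat, mul_comm]
  obtain ⟨δ, hδ, hδ1, hδP⟩ := exists_scale_posSemidef P hc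
  obtain ⟨C, hC, hAC⟩ := hA.exists_dist_le hβ0.le
  have hAC' : ∀ p q x y, |A x p q - A y p q| ≤ C * ‖x - y‖ ^ β := fun p q x y => by
    rw [← dist_eq_norm x y, ← Real.dist_eq]
    exact (dist_le_pi_dist _ _ q).trans ((dist_le_pi_dist _ _ p).trans (hAC x y))
  have hAcont : ∀ p q, Continuous fun x => A x p q := by
    obtain ⟨C', hC'⟩ := hA
    have := hC'.continuous (Real.toNNReal_pos.2 hβ0)
    fun_prop
  obtain ⟨v₀, w₀, hv₀, hw₀, hv₀c, hw₀c, hv₀v, hw₀w, happ⟩ :=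
    exists_smooth_strain_approx hk2 hv hw (E := fun x p q => deficit A v w x p q - δ ^ 2 * P p q)
      (fun p q => ((hAcont p q).sub (contDiff_strain hv hw (m := 0) (by simp) p q).continuous).sub
        continuous_const)
      (fun x p q => by
        rw [hPsym p q]
        change A x p q - strain v w x p q - _ = A x q p - strain v w x q p - _
        rw [hAsym, strain_symm])
      hK (fun x hx ξ => by
        have h1 : c * ∑ i, ξ i ^ 2 ≤ ∑ i, ∑ j, deficit A v w x i j * ξ i * ξ j := by
          rcases eq_or_ne ξ 0 with rfl | hξ
          · simp
          · exact (hD x hx ξ hξ).le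
        have h2 : ∑ i, ∑ j, (deficit A v w x i j - δ ^ 2 * P i j) * ξ i * ξ j
            = ∑ i, ∑ j, deficit A v w x i j * ξ i * ξ j - δ ^ 2 * ∑ i, ∑ j, P i j * ξ i * ξ j := by
          simp only [Finset.mul_sum, ← Finset.sum_sub_distrib]
          exact Finset.sum_congr rfl fun i _ => Finset.sum_congr rfl fun j _ => by ring
        rw [h2]
        linarith [hδP ξ])
      (ε := min (ε / 2) (τ * δ ^ 2)) (by positivity)
  obtain ⟨B, hB, hstrain⟩ := exists_strain_lipschitz hv₀ hw₀ hv₀c hw₀c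
  obtain ⟨B₁, hB₁⟩ := exists_bound_iteratedFDeriv hv₀ hv₀c 1
  obtain ⟨B₂, hB₂⟩ := exists_bound_iteratedFDeriv hv₀ hv₀c 2
  obtain ⟨B₃, hB₃⟩ := exists_bound_iteratedFDeriv hv₀ hv₀c 3
  set M : ℝ := max (max B B₁) (max B₂ B₃) with hM
  set S : (Fin d → ℝ) → Fin d → Fin d → ℝ := fun x p q => strain v₀ w₀ x p q + δ ^ 2 * P p q with hS
  set r : ℝ := τ * δ ^ 2 with hr
  have hr0 : 0 ≤ r := by positivity
  set At : (Fin d → ℝ) → Fin d → Fin d → ℝ := fun x p q =>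
    S x p q + max (-r) (min (A x p q - S x p q) r) with hAt
  have hScont : ∀ p q, Continuous fun x => S x p q := fun p q =>
    (contDiff_strain hv₀ hw₀ (m := 0) (by simp) p q).continuous.add continuous_const
  have hSsym : ∀ x p q, S x p q = S x q p := fun x p q => by
    simp only [hS, hPsym p q, strain_symm v₀ w₀ x p q]
  have hAtA : ∀ x ∈ closure ω, ∀ p q, At x p q = A x p q := fun x hx p q => by
    have h1 := abs_le.1 ((happ x hx p q).trans (min_le_right _ _))
    have h2 : deficit A v w x p q = A x p q - strain v w x p q := rfl
    have h3 : A x p q - S x p q ≤ r := by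
      simp only [hS]
      linarith [h1.1]
    have h4 : -r ≤ A x p q - S x p q := by
      simp only [hS]
      linarith [h1.2]
    simp only [hAt]
    rw [min_eq_left h3, max_eq_right h4, add_sub_cancel]
  obtain ⟨vt, wt, hvt, hwt, hvt0, hwt0, hdef⟩ := hexact At v₀ w₀ δ (C + 2 * B) M (ε / 2)
    (fun p q => (hScont p q).add (continuous_const.max (((hAcont p q).sub (hScont p q)).min
      continuous_const)))
    (fun x p q => by simp only [hAt, hSsym x p q, hAsym x p q]) (by positivity)
    (fun x y hxy p q => abs_clamp_sub_le (S := fun x => S x p q) hβ1 hB (hAC' p q)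
      (fun x y => by simpa only [hS, add_sub_add_right_eq_sub] using hstrain x y p q) hxy)
    (contDiff_infty.1 hv₀ 3) (contDiff_infty.1 hw₀ 2)
    (isC1Holder_of_hasCompactSupport hv₀ hv₀c hα0.le hαlt.le)
    (isC1Holder_of_hasCompactSupport hw₀ hw₀c hα0.le hαlt.le)
    (fun x => by
      rw [← norm_iteratedFDeriv_one]
      exact (hB₁ x).trans (by simp [hM]))
    (fun x => (hB₂ x).trans (by simp [hM])) (fun x => (hB₃ x).trans (by simp [hM]))
    (fun x y p q => (hstrain x y p q).trans
      (mul_le_mul_of_nonneg_right (by simp [hM]) (norm_nonneg _)))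
    hδ hδ1 (half_pos hε) (fun x p q => by
      have h1 : deficit At v₀ w₀ x p q - δ ^ 2 * P p q = max (-r) (min (A x p q - S x p q) r) := by
        change At x p q - strain v₀ w₀ x p q - _ = _
        simp only [hAt, hS]
        ring
      rw [h1, abs_le]
      exact ⟨le_max_left _ _, max_le (by linarith) (min_le_right _ _)⟩)
  refine ⟨vt, wt, hvt, hwt, Real.iSup_le (fun x => ?_) hε.le, Real.iSup_le (fun x => ?_) hε.le,
    fun x hx p q => ?_⟩
  · beta_reduce
    rw [← sub_add_sub_cancel (vt x.1) (v₀ x.1)]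
    linarith [norm_add_le (vt x.1 - v₀ x.1) (v₀ x.1 - v x.1), hvt0 x.1,
      (hv₀v x.1 x.2).trans (min_le_left _ _)]
  · beta_reduce
    rw [← sub_add_sub_cancel (wt x.1) (w₀ x.1)]
    linarith [norm_add_le (wt x.1 - w₀ x.1) (w₀ x.1 - w x.1), hwt0 x.1,
      (hw₀w x.1 x.2).trans (min_le_left _ _)]
  · rw [← hdef x p q, deficit, deficit, hAtA x hx]
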